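/- Let p, q, r ≥ 0 be integers with at most one of them equal to 0. If G is any simple graph whose signless Laplacian permanental polynomial equals that of θ(p,q,r), i.e., per(xI − Q(G)) = per(xI − Q(θ(p,q,r))) as polynomials in x, then G is isomorphic to θ(p,q,r). -/

import Mathlib

open scoped Classical
open Polynomial

noncomputable section

/-- The signless Laplacian matrix `Q(G) = D(G) + A(G)` of a graph `G`. -/
def signlessLapMatrix {V : Type*} [Fintype V] (G : SimpleGraph V) : Matrix V V ℚ :=
  G.degMatrix ℚ + G.adjMatrix ℚ

/-- The signless Laplacian permanental polynomial `per(x·I − Q(G))` of a graph `G`. -/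
def qPermPoly {V : Type*} [Fintype V] (G : SimpleGraph V) : Polynomial ℚ :=
  Matrix.permanent
    (Matrix.diagonal (fun _ : V => (X : Polynomial ℚ)) - (signlessLapMatrix G).map Polynomial.C)

/-- The bicyclic graph `θ(p,q,r)` on `p + q + r + 2` vertices: the two hub vertices `0`
and `1` are joined by three internally disjoint paths having `p`, `q` and `r` internal
vertices respectively (internal vertices `2, …, p+1`, then `p+2, …, p+q+1`, then
`p+q+2, …, p+q+r+1`); a path with `0` internal vertices is the edge `{0, 1}`. -/
def thetaGraph (p q r : ℕ) : SimpleGraph (Fin (p + q + r + 2)) :=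
  SimpleGraph.fromRel (fun i j =>
    (p = 0 ∧ i.val = 0 ∧ j.val = 1) ∨
    (0 < p ∧ i.val = 0 ∧ j.val = 2) ∨
    (2 ≤ i.val ∧ i.val + 1 = j.val ∧ j.val < p + 2) ∨
    (0 < p ∧ i.val = p + 1 ∧ j.val = 1) ∨
    (q = 0 ∧ i.val = 0 ∧ j.val = 1) ∨
    (0 < q ∧ i.val = 0 ∧ j.val = p + 2) ∨
    (p + 2 ≤ i.val ∧ i.val + 1 = j.val ∧ j.val < p + q + 2) ∨
    (0 < q ∧ i.val = p + q + 1 ∧ j.val = 1) ∨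
    (r = 0 ∧ i.val = 0 ∧ j.val = 1) ∨
    (0 < r ∧ i.val = 0 ∧ j.val = p + q + 2) ∨
    (p + q + 2 ≤ i.val ∧ i.val + 1 = j.val) ∨
    (0 < r ∧ i.val = p + q + r + 1 ∧ j.val = 1))

section PermLemmas

variable {V : Type*} [Fintype V] {R : Type*} [CommRing R]

/-- Replace row and column `w` by those of the identity matrix. -/
def killV (w : V) (N : Matrix V V R) : Matrix V V R := fun i j =>
  if i = w ∨ j = w then (if i = j then 1 else 0) else N i j

/-- Row `i` replaced by the `j`-th basis vector. -/
def rowTo (N : Matrix V V R) (i j : V) : Matrix V V R := N.updateRow i (Pi.single j 1)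

theorem killV_apply (w : V) (N : Matrix V V R) (i j : V) : killV w N i j =
    if i = w ∨ j = w then (if i = j then 1 else 0) else N i j := rfl

theorem rowTo_apply (N : Matrix V V R) (i j a b : V) :
    rowTo N i j a b = if a = i then (if b = j then 1 else 0) else N a b := by
  unfold rowTo
  by_cases h : a = i
  · subst h; simp [Pi.single_apply]
  · simp [Matrix.updateRow_apply, h]

theorem per_col_expand (N : Matrix V V R) (w : V) :
    N.permanent = ∑ i, N i w * (N.updateCol w (Pi.single i 1)).permanent := by
  have h1 : ∀ i, (N.updateCol w (Pi.single i 1)).permanent =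
      ∑ σ : Equiv.Perm V, (if σ w = i then 1 else 0) * ∏ k ∈ Finset.univ.erase w, N (σ k) k := by
    intro i
    unfold Matrix.permanent
    refine Finset.sum_congr rfl fun σ _ => ?_
    rw [← Finset.mul_prod_erase Finset.univ _ (Finset.mem_univ w)]
    congr 1
    · simp [Pi.single_apply]
    · refine Finset.prod_congr rfl fun k hk => ?_
      rw [Matrix.updateCol_ne (Finset.ne_of_mem_erase hk)]
  simp_rw [h1, Finset.mul_sum]
  rw [Finset.sum_comm]
  unfold Matrix.permanent
  refine Finset.sum_congr rfl fun σ _ => ?_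
  rw [← Finset.mul_prod_erase Finset.univ _ (Finset.mem_univ w)]
  simp

theorem per_row_expand (N : Matrix V V R) (w : V) :
    N.permanent = ∑ j, N w j * (rowTo N w j).permanent := by
  rw [← Matrix.permanent_transpose, per_col_expand _ w]
  refine Finset.sum_congr rfl fun j _ => ?_
  rw [← Matrix.permanent_transpose, Matrix.updateCol_transpose, Matrix.transpose_transpose]
  rfl

theorem per_zero_row (N : Matrix V V R) (w : V) (h : ∀ j, N w j = 0) : N.permanent = 0 := by
  rw [per_row_expand N w]; simp [h]

theorem per_swap (N : Matrix V V R) (a b : V) :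
    (N.submatrix (Equiv.swap a b) id).permanent = N.permanent :=
  Matrix.permanent_permute_cols _ _

theorem per_col_id (N : Matrix V V R) (w : V) (h : ∀ i, N i w = if i = w then 1 else 0) :
    N.permanent = (killV w N).permanent := by
  unfold Matrix.permanent
  refine Finset.sum_congr rfl fun σ _ => ?_
  by_cases hs : σ w = w
  · refine Finset.prod_congr rfl fun k _ => ?_
    unfold killV
    by_cases hk : k = w
    · subst hk; simp [hs, h]
    · have : σ k ≠ w := fun h' => hk (σ.injective (h'.trans hs.symm))
      simp [hk, this]
  · rw [Finset.prod_eq_zero (Finset.mem_univ w), Finset.prod_eq_zero (Finset.mem_univ w)]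
    · simp [killV, hs]
    · simp [h, hs]

theorem per_double (N : Matrix V V R) (w : V) :
    N.permanent = N w w * (killV w N).permanent +
      ∑ i ∈ Finset.univ.erase w, ∑ j ∈ Finset.univ.erase w,
        N i w * N w j * (rowTo (killV w N) i j).permanent := by
  rw [per_col_expand N w, ← Finset.add_sum_erase _ _ (Finset.mem_univ w)]
  congr 1
  · congr 1
    rw [per_col_id _ w]
    · congr 1
      ext i j
      unfold killV
      by_cases hj : j = w
      · simp [hj]
      · simp [hj]
    · intro i; simp [Pi.single_apply]
  · refine Finset.sum_congr rfl fun i hi => ?_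
    have hi : i ≠ w := Finset.ne_of_mem_erase hi
    rw [per_row_expand _ w, ← Finset.add_sum_erase _ _ (Finset.mem_univ w), mul_add,
      Finset.mul_sum]
    have h0 : (N.updateCol w (Pi.single i 1)) w w = 0 := by simp [hi.symm]
    rw [h0]
    simp only [zero_mul, mul_zero, zero_add]
    refine Finset.sum_congr rfl fun j hj => ?_
    have hj : j ≠ w := Finset.ne_of_mem_erase hj
    rw [mul_assoc]
    congr 1
    rw [Matrix.updateCol_ne hj]
    congr 1
    rw [← per_swap _ i w, per_col_id _ w]
    · congr 1
      ext a b
      simp only [killV_apply, rowTo_apply, Matrix.submatrix_apply, id]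
      by_cases hb : b = w
      · subst hb
        by_cases ha : a = b
        · subst ha; simp [hi.symm]
        · by_cases hai : a = i <;> simp [hai, hj.symm, ha, hi]
      · by_cases ha : a = w
        · subst ha; simp [hi.symm]
        · by_cases hai : a = i
          · subst hai; simp [hb, hi]
          · simp [ha, hb, hai, Equiv.swap_apply_of_ne_of_ne hai ha]
    · intro a
      simp only [rowTo_apply, Matrix.submatrix_apply, id]
      by_cases ha : a = w
      · subst ha; simp [hi]
      · by_cases hai : a = i
        · subst hai; simp [hi, hj.symm]
        · simp [ha, hai, Equiv.swap_apply_of_ne_of_ne hai ha]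

theorem per_row_add (N N' : Matrix V V R) (x j : V) (c : R)
    (h1 : ∀ k, N' x k = N x k + (if k = j then c else 0))
    (h2 : ∀ i k, i ≠ x → N' i k = N i k) :
    N'.permanent = N.permanent + c * (rowTo N x j).permanent := by
  have h3 : ∀ k, rowTo N' x k = rowTo N x k := by
    intro k; ext a b
    unfold rowTo
    by_cases ha : a = x
    · subst ha; simp
    · simp [Matrix.updateRow_apply, ha, h2]
  rw [per_row_expand N' x, per_row_expand N x]
  simp [h1, h3, add_mul, Finset.sum_add_distrib]

theorem per_map {S : Type*} [CommRing S] (f : R →+* S) (N : Matrix V V R) :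
    (N.map f).permanent = f N.permanent := by
  simp [Matrix.permanent, map_sum, map_prod]

end PermLemmas

section Elim

variable {V : Type*} [Fintype V] {R : Type*} [CommRing R]

theorem per_pend (N : Matrix V V R) (w y : V) (hy : y ≠ w)
    (h1 : ∀ i, i ≠ w → i ≠ y → N i w = 0) (h2 : ∀ i, i ≠ w → i ≠ y → N w i = 0) :
    N.permanent = N w w * (killV w N).permanent +
      N y w * N w y * (rowTo (killV w N) y y).permanent := by
  conv_lhs => rw [per_double N w]
  congr 1
  rw [Finset.sum_eq_single y, Finset.sum_eq_single y]
  · intro j hj hjy; rw [h2 j (Finset.ne_of_mem_erase hj) hjy]; ring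
  · intro h; exact absurd (Finset.mem_erase.2 ⟨hy, Finset.mem_univ _⟩) h
  · intro i hi hiy
    refine Finset.sum_eq_zero fun j _ => ?_
    rw [h1 i (Finset.ne_of_mem_erase hi) hiy]; ring
  · intro h; exact absurd (Finset.mem_erase.2 ⟨hy, Finset.mem_univ _⟩) h

theorem per_two (N : Matrix V V R) (w x y : V) (hx : x ≠ w) (hy : y ≠ w) (hxy : x ≠ y)
    (h1 : ∀ i, i ≠ w → i ≠ x → i ≠ y → N i w = 0)
    (h2 : ∀ i, i ≠ w → i ≠ x → i ≠ y → N w i = 0) :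
    N.permanent = N w w * (killV w N).permanent +
      N x w * N w x * (rowTo (killV w N) x x).permanent +
      N x w * N w y * (rowTo (killV w N) x y).permanent +
      N y w * N w x * (rowTo (killV w N) y x).permanent +
      N y w * N w y * (rowTo (killV w N) y y).permanent := by
  conv_lhs => rw [per_double N w]
  have hs : ({x, y} : Finset V) ⊆ Finset.univ.erase w := by
    intro i hi
    simp only [Finset.mem_insert, Finset.mem_singleton] at hi
    rcases hi with rfl | rfl <;> simp [hx, hy]
  rw [← Finset.sum_subset hs]
  · have h3 : ∀ i, ∑ j ∈ Finset.univ.erase w,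
        N i w * N w j * (rowTo (killV w N) i j).permanent =
        ∑ j ∈ ({x, y} : Finset V), N i w * N w j * (rowTo (killV w N) i j).permanent := by
      intro i
      symm
      apply Finset.sum_subset hs
      intro j hj hj2
      simp only [Finset.mem_insert, Finset.mem_singleton, not_or] at hj2
      rw [h2 j (Finset.ne_of_mem_erase hj) hj2.1 hj2.2]; ring
    simp only [h3, Finset.sum_pair hxy]
    ring
  · intro i hi hi2
    simp only [Finset.mem_insert, Finset.mem_singleton, not_or] at hi2
    refine Finset.sum_eq_zero fun j _ => ?_
    rw [h1 i (Finset.ne_of_mem_erase hi) hi2.1 hi2.2]; ring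

/-- Normalised weight of a path of length `a` attached at `x` and `w`. -/
def Gv (v : R) (a : ℕ) (N : Matrix V V R) (x w : V) : R :=
  (1 - (-v ^ 2) ^ a) * N.permanent +
  (v ^ 2 + (-v ^ 2) ^ a) * ((rowTo N x x).permanent + (rowTo N w w).permanent) +
  (v ^ 4 - (-v ^ 2) ^ a) * (rowTo (rowTo N x x) w w).permanent +
  (1 + v ^ 2) * v ^ a * ((rowTo N x w).permanent + (rowTo N w x).permanent)

/-- Normalised weight of a cycle of length `a` attached at `x`. -/
def Lv (v : R) (a : ℕ) (N : Matrix V V R) (x : V) : R :=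
  (1 - (-v ^ 2) ^ a) * N.permanent +
  2 * (v ^ 2 + (-v ^ 2) ^ a + (1 + v ^ 2) * v ^ a) * (rowTo N x x).permanent

/-- `w` is pendant, attached to `y`. -/
structure Pend (v : R) (N : Matrix V V R) (w y : V) : Prop where
  ne : y ≠ w
  diag : N w w = 1 - v ^ 2
  row : N w y = v
  col : N y w = v
  rowz : ∀ i, i ≠ w → i ≠ y → N w i = 0
  colz : ∀ i, i ≠ w → i ≠ y → N i w = 0

theorem two_start (v : R) (N : Matrix V V R) (w x y : V) (hx : x ≠ w) (hy : y ≠ w) (hxy : x ≠ y)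
    (hd : N w w = 1 - v ^ 2) (hwx : N w x = v) (hxw : N x w = v) (hwy : N w y = v)
    (hyw : N y w = v)
    (h1 : ∀ i, i ≠ w → i ≠ x → i ≠ y → N i w = 0)
    (h2 : ∀ i, i ≠ w → i ≠ x → i ≠ y → N w i = 0) :
    (1 + v ^ 2) * N.permanent = Gv v 2 (killV w N) x y := by
  rw [per_two N w x y hx hy hxy h1 h2, hd, hwx, hxw, hwy, hyw, Gv]
  ring

theorem killV_rowTo (N : Matrix V V R) (w i j : V) (hi : i ≠ w) (hj : j ≠ w) :
    killV w (rowTo N i j) = rowTo (killV w N) i j := by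
  ext a b
  simp only [killV_apply, rowTo_apply]
  by_cases ha : a = i
  · subst ha; by_cases hb : b = w
    · subst hb; simp [hi, hj.symm]
    · simp [hi, hb]
  · simp [ha]

theorem killV_rowTo_self (N : Matrix V V R) (w j : V) :
    killV w (rowTo N w j) = killV w N := by
  ext a b
  simp only [killV_apply, rowTo_apply]
  by_cases ha : a = w <;> simp [ha]

theorem rowTo_killV_rowTo (N : Matrix V V R) (w i j k : V) :
    rowTo (killV w (rowTo N i j)) i k = rowTo (killV w N) i k := by
  ext a b
  simp only [killV_apply, rowTo_apply]
  by_cases ha : a = i <;> simp [ha]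

theorem gv_step (v : R) (a : ℕ) (N : Matrix V V R) (x w y : V) (hx : x ≠ w) (hxy : x ≠ y)
    (hp : Pend v N w y) : Gv v a N x w = Gv v (a + 1) (killV w N) x y := by
  have hy := hp.ne
  have e1 : N.permanent = (1 - v ^ 2) * (killV w N).permanent +
      v ^ 2 * (rowTo (killV w N) y y).permanent := by
    rw [per_pend N w y hy hp.colz hp.rowz, hp.diag, hp.row, hp.col]; ring
  have e2 : (rowTo N x x).permanent = (1 - v ^ 2) * (rowTo (killV w N) x x).permanent +
      v ^ 2 * (rowTo (rowTo (killV w N) x x) y y).permanent := by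
    rw [per_pend (rowTo N x x) w y hy, killV_rowTo _ _ _ _ hx hx]
    · simp only [rowTo_apply, hx.symm, hxy.symm, if_false, hp.diag, hp.row, hp.col]; ring
    · intro i h1 h2; simp [rowTo_apply, hp.colz i h1 h2, hx.symm]
    · intro i h1 h2; simp [rowTo_apply, hp.rowz i h1 h2, hx.symm]
  have e3 : (rowTo N w w).permanent = (killV w N).permanent := by
    rw [per_pend (rowTo N w w) w y hy, killV_rowTo_self]
    · simp [rowTo_apply, hy]
    · intro i h1 h2; simp [rowTo_apply, hp.colz i h1 h2, h1]
    · intro i h1 h2; simp [rowTo_apply, h1]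
  have e4 : (rowTo (rowTo N x x) w w).permanent = (rowTo (killV w N) x x).permanent := by
    rw [per_pend _ w y hy, killV_rowTo_self, killV_rowTo _ _ _ _ hx hx]
    · simp [rowTo_apply, hy]
    · intro i h1 h2; simp [rowTo_apply, hp.colz i h1 h2, h1, hx.symm]
    · intro i h1 h2; simp [rowTo_apply, h1]
  have e5 : (rowTo N x w).permanent = v * (rowTo (killV w N) x y).permanent := by
    rw [per_two _ w x y hx hy hxy, rowTo_killV_rowTo, rowTo_killV_rowTo,
      per_zero_row (killV w (rowTo N x w)) x, per_zero_row (rowTo (killV w (rowTo N x w)) y y) x]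
    · simp [rowTo_apply, hx.symm, hy, hp.row, hp.rowz x hx hxy, hxy.symm]
    · intro j; simp only [rowTo_apply, killV_apply]
      by_cases hj : j = w <;> simp [hj, hxy, hx]
    · intro j; simp only [rowTo_apply, killV_apply]
      by_cases hj : j = w <;> simp [hj, hx]
    · intro i h1 h2 h3; simp [rowTo_apply, hp.colz i h1 h3, h2]
    · intro i h1 h2 h3; simp [rowTo_apply, hp.rowz i h1 h3, hx.symm]
  have e6 : (rowTo N w x).permanent = v * (rowTo (killV w N) y x).permanent := by
    rw [per_two _ w x y hx hy hxy, killV_rowTo_self]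
    · simp [rowTo_apply, hx, hx.symm, hy, hp.col, hp.colz x hx hxy, hxy.symm]
    · intro i h1 h2 h3; simp [rowTo_apply, hp.colz i h1 h3, h1]
    · intro i h1 h2 h3; simp [rowTo_apply, h2]
  unfold Gv
  rw [e1, e2, e3, e4, e5, e6]
  ring

theorem gv_loop (v : R) (a : ℕ) (N : Matrix V V R) (x w : V)
    (hp : Pend v N w x) : Gv v a N x w = Lv v (a + 1) (killV w N) x := by
  have hx := hp.ne
  have e1 : N.permanent = (1 - v ^ 2) * (killV w N).permanent +
      v ^ 2 * (rowTo (killV w N) x x).permanent := by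
    rw [per_pend N w x hx hp.colz hp.rowz, hp.diag, hp.row, hp.col]; ring
  have e2 : (rowTo N x x).permanent = (1 - v ^ 2) * (rowTo (killV w N) x x).permanent := by
    rw [per_pend (rowTo N x x) w x hx, killV_rowTo _ _ _ _ hx hx]
    · simp [rowTo_apply, hx.symm, hp.diag]
    · intro i h1 h2; simp [rowTo_apply, hp.colz i h1 h2, hx.symm]
    · intro i h1 h2; simp [rowTo_apply, hp.rowz i h1 h2, hx.symm]
  have e3 : (rowTo N w w).permanent = (killV w N).permanent := by
    rw [per_pend (rowTo N w w) w x hx, killV_rowTo_self]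
    · simp [rowTo_apply, hx]
    · intro i h1 h2; simp [rowTo_apply, hp.colz i h1 h2, h1]
    · intro i h1 h2; simp [rowTo_apply, h1]
  have e4 : (rowTo (rowTo N x x) w w).permanent = (rowTo (killV w N) x x).permanent := by
    rw [per_pend _ w x hx, killV_rowTo_self, killV_rowTo _ _ _ _ hx hx]
    · simp [rowTo_apply, hx]
    · intro i h1 h2; simp [rowTo_apply, hp.colz i h1 h2, h1, hx.symm]
    · intro i h1 h2; simp [rowTo_apply, h1]
  have e5 : (rowTo N x w).permanent = v * (rowTo (killV w N) x x).permanent := by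
    rw [per_pend _ w x hx, rowTo_killV_rowTo,
      per_zero_row (killV w (rowTo N x w)) x]
    · simp [rowTo_apply, hx.symm, hp.row]
    · intro j; simp only [rowTo_apply, killV_apply]
      by_cases hj : j = w <;> simp [hj, hx]
    · intro i h1 h2; simp [rowTo_apply, hp.colz i h1 h2, h2]
    · intro i h1 h2; simp [rowTo_apply, hp.rowz i h1 h2, hx.symm]
  have e6 : (rowTo N w x).permanent = v * (rowTo (killV w N) x x).permanent := by
    rw [per_pend _ w x hx, killV_rowTo_self]
    · simp [rowTo_apply, hx, hx.symm, hp.col]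
    · intro i h1 h2; simp [rowTo_apply, hp.colz i h1 h2, h1]
    · intro i h1 h2; simp [rowTo_apply, h2]
  unfold Gv Lv
  rw [e1, e2, e3, e4, e5, e6]
  ring

end Elim

section MatSec

variable {V : Type*} [Fintype V] {R : Type*} [CommRing R]

/-- The matrix of the graph `G`, vertices in `S` removed, hub block prescribed. -/
def Mat (G : SimpleGraph V) (v : R) (x y : V) (S : Finset V) (α β γ δ : R) : Matrix V V R :=
  fun i j =>
    if i ∈ S ∨ j ∈ S then (if i = j then 1 else 0)
    else if i = x ∧ j = x then α else if i = y ∧ j = y then β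
    else if i = x ∧ j = y then γ else if i = y ∧ j = x then δ
    else if i = j then 1 - v ^ 2 else if G.Adj i j then v else 0

/-- Permanent of `Mat`. -/
def FF (G : SimpleGraph V) (v : R) (x y : V) (S : Finset V) (α β γ δ : R) : R :=
  (Mat G v x y S α β γ δ).permanent

theorem mat_kill (G : SimpleGraph V) (v : R) (x y : V) (S : Finset V) (α β γ δ : R) (w : V) :
    killV w (Mat G v x y S α β γ δ) = Mat G v x y (insert w S) α β γ δ := by
  ext i j
  simp only [killV_apply, Mat, Finset.mem_insert]
  by_cases h1 : i = w
  · simp [h1]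
  · by_cases h2 : j = w
    · simp [h2]
    · simp [h1, h2]

theorem ff_xx (G : SimpleGraph V) (v : R) (x y : V) (S : Finset V) (hxy : x ≠ y)
    (hx : x ∉ S) (α β γ δ : R) :
    (rowTo (Mat G v x y S α β γ δ) x x).permanent =
    FF G v x y S (α + 1) β γ δ - FF G v x y S α β γ δ := by
  unfold FF
  rw [per_row_add (Mat G v x y S α β γ δ) (Mat G v x y S (α + 1) β γ δ) x x 1]
  · ring
  · intro k
    by_cases hk : k = x
    · subst hk; simp [Mat, hx]
    · simp [Mat, hk, hxy]
  · intro i k hi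
    simp [Mat, hi]

theorem ff_yy (G : SimpleGraph V) (v : R) (x y : V) (S : Finset V) (hxy : x ≠ y)
    (hy : y ∉ S) (α β γ δ : R) :
    (rowTo (Mat G v x y S α β γ δ) y y).permanent =
    FF G v x y S α (β + 1) γ δ - FF G v x y S α β γ δ := by
  unfold FF
  rw [per_row_add (Mat G v x y S α β γ δ) (Mat G v x y S α (β + 1) γ δ) y y 1]
  · ring
  · intro k
    by_cases hk : k = y
    · subst hk; simp [Mat, hy, hxy.symm]
    · simp [Mat, hk]
  · intro i k hi
    simp [Mat, hi]

theorem ff_xy (G : SimpleGraph V) (v : R) (x y : V) (S : Finset V) (hxy : x ≠ y)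
    (hx : x ∉ S) (hy : y ∉ S) (α β γ δ : R) :
    (rowTo (Mat G v x y S α β γ δ) x y).permanent =
    FF G v x y S α β (γ + 1) δ - FF G v x y S α β γ δ := by
  unfold FF
  rw [per_row_add (Mat G v x y S α β γ δ) (Mat G v x y S α β (γ + 1) δ) x y 1]
  · ring
  · intro k
    by_cases hk : k = y
    · subst hk; simp [Mat, hx, hy, hxy, hxy.symm]
    · simp [Mat, hk, hxy]
  · intro i k hi
    simp [Mat, hi]

theorem ff_yx (G : SimpleGraph V) (v : R) (x y : V) (S : Finset V) (hxy : x ≠ y)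
    (hx : x ∉ S) (hy : y ∉ S) (α β γ δ : R) :
    (rowTo (Mat G v x y S α β γ δ) y x).permanent =
    FF G v x y S α β γ (δ + 1) - FF G v x y S α β γ δ := by
  unfold FF
  rw [per_row_add (Mat G v x y S α β γ δ) (Mat G v x y S α β γ (δ + 1)) y x 1]
  · ring
  · intro k
    by_cases hk : k = x
    · subst hk; simp [Mat, hx, hy, hxy, hxy.symm]
    · simp [Mat, hk, hxy.symm]
  · intro i k hi
    simp [Mat, hi]

theorem ff_xxyy (G : SimpleGraph V) (v : R) (x y : V) (S : Finset V) (hxy : x ≠ y)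
    (hx : x ∉ S) (hy : y ∉ S) (α β γ δ : R) :
    (rowTo (rowTo (Mat G v x y S α β γ δ) x x) y y).permanent =
    FF G v x y S (α + 1) (β + 1) γ δ - FF G v x y S (α + 1) β γ δ
    - FF G v x y S α (β + 1) γ δ + FF G v x y S α β γ δ := by
  have h := per_row_add (rowTo (Mat G v x y S α β γ δ) x x)
    (rowTo (Mat G v x y S α (β + 1) γ δ) x x) y y 1 ?_ ?_
  · rw [ff_xx _ _ _ _ _ hxy hx, ff_xx _ _ _ _ _ hxy hx] at h
    linear_combination -h
  · intro k
    by_cases hk : k = y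
    · subst hk; simp [rowTo_apply, Mat, hy, hxy.symm]
    · simp [rowTo_apply, Mat, hk]
  · intro i k hi
    simp [rowTo_apply, Mat, hi]

/-- path operator -/
def GF (v : R) (a : ℕ) (F : R → R → R → R → R) (α β γ δ : R) : R :=
  (1 - (-v ^ 2) ^ a) * F α β γ δ +
  (v ^ 2 + (-v ^ 2) ^ a) * (F (α + 1) β γ δ + F α (β + 1) γ δ - 2 * F α β γ δ) +
  (v ^ 4 - (-v ^ 2) ^ a) *
    (F (α + 1) (β + 1) γ δ - F (α + 1) β γ δ - F α (β + 1) γ δ + F α β γ δ) +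
  (1 + v ^ 2) * v ^ a * (F α β (γ + 1) δ + F α β γ (δ + 1) - 2 * F α β γ δ)

/-- loop operator at the first hub -/
def LX (v : R) (a : ℕ) (F : R → R → R → R → R) (α β γ δ : R) : R :=
  (1 - (-v ^ 2) ^ a) * F α β γ δ +
  2 * (v ^ 2 + (-v ^ 2) ^ a + (1 + v ^ 2) * v ^ a) * (F (α + 1) β γ δ - F α β γ δ)

/-- loop operator at the second hub -/
def LY (v : R) (a : ℕ) (F : R → R → R → R → R) (α β γ δ : R) : R :=
  (1 - (-v ^ 2) ^ a) * F α β γ δ +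
  2 * (v ^ 2 + (-v ^ 2) ^ a + (1 + v ^ 2) * v ^ a) * (F α (β + 1) γ δ - F α β γ δ)

/-- Trace of a path. -/
inductive Tr (G : SimpleGraph V) (H : Finset V) : Finset V → V → V → List V → V → Prop
  | last (S : Finset V) (p c y : V) (h1 : c ∉ S) (h2 : c ∉ H) (h3 : y ∈ H) (h4 : y ∉ S)
      (h5 : p ≠ y) (h6 : ∀ z, G.Adj c z ↔ z = p ∨ z = y) : Tr G H S p c [c] y
  | step (S : Finset V) (p c n : V) (l : List V) (y : V) (h1 : c ∉ S) (h2 : c ∉ H) (h3 : n ∉ H)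
      (h4 : n ∉ S) (h5 : p ≠ n) (h6 : ∀ z, G.Adj c z ↔ z = p ∨ z = n)
      (h7 : Tr G H (insert c S) c n l y) : Tr G H S p c (c :: l) y

theorem mat_pend (G : SimpleGraph V) (v : R) (x y : V) (S : Finset V) (α β γ δ : R)
    (p c n : V) (hx : c ≠ x) (hy : c ≠ y) (h1 : c ∉ S) (h4 : n ∉ S) (hp : p ∈ S)
    (h6 : ∀ z, G.Adj c z ↔ z = p ∨ z = n) :
    Pend v (Mat G v x y S α β γ δ) c n := by
  have hadj : G.Adj c n := (h6 n).2 (Or.inr rfl)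
  have hne : c ≠ n := hadj.ne
  refine ⟨hne.symm, ?_, ?_, ?_, ?_, ?_⟩
  · simp [Mat, hx, hy, h1]
  · simp [Mat, hx, hy, h1, h4, hne, hadj]
  · simp [Mat, hx, hy, h1, h4, hne.symm, hadj.symm]
  · intro i hi1 hi2
    by_cases hi : i ∈ S
    · simp [Mat, hi, Ne.symm hi1]
    · have : ¬ G.Adj c i := fun h => by
        rcases (h6 i).1 h with rfl | rfl
        · exact hi hp
        · exact hi2 rfl
      simp [Mat, hx, hy, h1, hi, Ne.symm hi1, this]
  · intro i hi1 hi2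
    by_cases hi : i ∈ S
    · simp [Mat, hi, hi1]
    · have : ¬ G.Adj i c := fun h => by
        rcases (h6 i).1 h.symm with rfl | rfl
        · exact hi hp
        · exact hi2 rfl
      simp [Mat, hx, hy, h1, hi, hi1, this]

theorem mat_two (G : SimpleGraph V) (v : R) (x y : V) (S : Finset V) (α β γ δ : R)
    (p c n : V) (hx : c ≠ x) (hy : c ≠ y) (h1 : c ∉ S) (h4 : n ∉ S) (hp : p ∉ S) (h5 : p ≠ n)
    (h6 : ∀ z, G.Adj c z ↔ z = p ∨ z = n) :
    (1 + v ^ 2) * (Mat G v x y S α β γ δ).permanent =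
      Gv v 2 (Mat G v x y (insert c S) α β γ δ) p n := by
  have ha1 : G.Adj c n := (h6 n).2 (Or.inr rfl)
  have ha2 : G.Adj c p := (h6 p).2 (Or.inl rfl)
  rw [two_start v (Mat G v x y S α β γ δ) c p n ha2.ne.symm ha1.ne.symm h5, mat_kill]
  · simp [Mat, hx, hy, h1]
  · simp [Mat, hx, hy, h1, hp, ha2, ha2.ne]
  · simp [Mat, hx, hy, h1, hp, ha2.symm, ha2.ne.symm]
  · simp [Mat, hx, hy, h1, h4, ha1, ha1.ne]
  · simp [Mat, hx, hy, h1, h4, ha1.symm, ha1.ne.symm]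
  · intro i hi1 hi2 hi3
    have : ¬ G.Adj i c := fun h => by
      rcases (h6 i).1 h.symm with rfl | rfl
      · exact hi2 rfl
      · exact hi3 rfl
    simp [Mat, hx, hy, hi1, this]
  · intro i hi1 hi2 hi3
    have : ¬ G.Adj c i := fun h => by
      rcases (h6 i).1 h with rfl | rfl
      · exact hi2 rfl
      · exact hi3 rfl
    simp [Mat, hx, hy, Ne.symm hi1, this]

theorem tr_tail (G : SimpleGraph V) (H : Finset V) (v : R) (x y : V) (hxH : x ∈ H) (hyH : y ∈ H)
    (α β γ δ : R) (z : V) (hz : z ∈ H) {S : Finset V} {p c : V} {l : List V} {e : V}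
    (h : Tr G H S p c l e) : p ∈ S → z ∉ S → ∀ a : ℕ,
    Gv v a (Mat G v x y S α β γ δ) z c =
      if e = z then Lv v (a + l.length) (Mat G v x y (S ∪ l.toFinset) α β γ δ) z
      else Gv v (a + l.length) (Mat G v x y (S ∪ l.toFinset) α β γ δ) z e := by
  induction h with
  | last S p c e h1 h2 h3 h4 h5 h6 =>
    intro hp hzS a
    have hcx : c ≠ x := fun h => h2 (h ▸ hxH)
    have hcy : c ≠ y := fun h => h2 (h ▸ hyH)
    have hzc : z ≠ c := fun h => h2 (h ▸ hz)
    have hP := mat_pend G v x y S α β γ δ p c e hcx hcy h1 h4 hp h6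
    have hU : S ∪ [c].toFinset = insert c S := by ext; simp
    rw [hU, ← mat_kill]
    split_ifs with he
    · subst he
      exact gv_loop v a _ _ _ hP
    · exact gv_step v a _ z c e hzc (Ne.symm he) hP
  | step S p c n l e h1 h2 h3 h4 h5 h6 h7 ih =>
    intro hp hzS a
    have hcx : c ≠ x := fun h => h2 (h ▸ hxH)
    have hcy : c ≠ y := fun h => h2 (h ▸ hyH)
    have hzc : z ≠ c := fun h => h2 (h ▸ hz)
    have hzn : z ≠ n := fun h => h3 (h ▸ hz)
    have hP := mat_pend G v x y S α β γ δ p c n hcx hcy h1 h4 hp h6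
    have hU : S ∪ (c :: l).toFinset = insert c S ∪ l.toFinset := by
      ext; simp
    rw [gv_step v a _ z c n hzc hzn hP, mat_kill, ih (by simp) (by simp [hzc, hzS]), hU]
    simp [add_assoc, add_comm 1]

theorem tr_elim (G : SimpleGraph V) (H : Finset V) (v : R) (x y : V) (hxH : x ∈ H) (hyH : y ∈ H)
    (α β γ δ : R) (z : V) (hz : z ∈ H) {S : Finset V} {c : V} {l : List V} {e : V}
    (h : Tr G H S z c l e) (hzS : z ∉ S) :
    (1 + v ^ 2) * (Mat G v x y S α β γ δ).permanent =
      if e = z then Lv v (l.length + 1) (Mat G v x y (S ∪ l.toFinset) α β γ δ) z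
      else Gv v (l.length + 1) (Mat G v x y (S ∪ l.toFinset) α β γ δ) z e := by
  cases h with
  | last _ _ _ _ h1 h2 h3 h4 h5 h6 =>
    have hcx : c ≠ x := fun h => h2 (h ▸ hxH)
    have hcy : c ≠ y := fun h => h2 (h ▸ hyH)
    have hU : S ∪ [c].toFinset = insert c S := by ext; simp
    rw [hU, if_neg (Ne.symm h5)]
    exact mat_two G v x y S α β γ δ z c e hcx hcy h1 h4 hzS h5 h6
  | step _ _ _ n l _ h1 h2 h3 h4 h5 h6 h7 =>
    have hcx : c ≠ x := fun h => h2 (h ▸ hxH)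
    have hcy : c ≠ y := fun h => h2 (h ▸ hyH)
    have hzc : z ≠ c := fun h => h2 (h ▸ hz)
    have hU : S ∪ (c :: l).toFinset = insert c S ∪ l.toFinset := by
      ext; simp
    rw [mat_two G v x y S α β γ δ z c n hcx hcy h1 h4 hzS h5 h6,
      tr_tail G H v x y hxH hyH α β γ δ z hz h7 (by simp) (by simp [hzc, hzS]), hU]
    have hlen : 2 + l.length = (c :: l).length + 1 := by simp; omega
    rw [hlen]

theorem tr_facts (G : SimpleGraph V) (H : Finset V) {S : Finset V} {p c : V} {l : List V} {e : V}
    (h : Tr G H S p c l e) :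
    l.Nodup ∧ (∀ u ∈ l, u ∉ S ∧ u ∉ H) ∧ List.IsChain G.Adj (p :: (l ++ [e])) ∧ e ∈ H ∧ e ∉ S
      ∧ l ≠ [] := by
  induction h with
  | last S p c e h1 h2 h3 h4 h5 h6 =>
    refine ⟨by simp, by simp [h1, h2], ?_, h3, h4, by simp⟩
    simp [((h6 p).2 (Or.inl rfl)).symm, (h6 e).2 (Or.inr rfl)]
  | step S p c n l e h1 h2 h3 h4 h5 h6 h7 ih =>
    obtain ⟨i1, i2, i3, i4, i5, i6⟩ := ih
    refine ⟨?_, ?_, ?_, i4, fun h => i5 (by simp [h]), by simp⟩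
    · rw [List.nodup_cons]
      exact ⟨fun h => (i2 c h).1 (by simp), i1⟩
    · intro u hu
      rcases List.mem_cons.1 hu with rfl | hu
      · exact ⟨h1, h2⟩
      · exact ⟨fun h => (i2 u hu).1 (by simp [h]), (i2 u hu).2⟩
    · rw [List.cons_append, List.isChain_cons_cons]
      exact ⟨((h6 p).2 (Or.inl rfl)).symm, i3⟩

theorem elim_path (G : SimpleGraph V) (v : R) (x y : V) (hxy : x ≠ y)
    {S : Finset V} {c : V} {l : List V} (h : Tr G {x, y} S x c l y) (hxS : x ∉ S) (α β γ δ : R) :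
    (1 + v ^ 2) * FF G v x y S α β γ δ =
      GF v (l.length + 1) (FF G v x y (S ∪ l.toFinset)) α β γ δ := by
  obtain ⟨f1, f2, f3, f4, f5, f6⟩ := tr_facts _ _ h
  have e := tr_elim G {x, y} v x y (by simp) (by simp) α β γ δ x (by simp) h hxS
  have hx : x ∉ S ∪ l.toFinset := by
    simp only [Finset.mem_union, List.mem_toFinset, not_or]
    exact ⟨hxS, fun h => (f2 x h).2 (by simp)⟩
  have hy : y ∉ S ∪ l.toFinset := by
    simp only [Finset.mem_union, List.mem_toFinset, not_or]
    exact ⟨f5, fun h => (f2 y h).2 (by simp)⟩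
  rw [if_neg hxy.symm] at e
  unfold FF
  rw [e, Gv, ff_xx _ _ _ _ _ hxy hx, ff_yy _ _ _ _ _ hxy hy, ff_xy _ _ _ _ _ hxy hx hy,
    ff_yx _ _ _ _ _ hxy hx hy, ff_xxyy _ _ _ _ _ hxy hx hy]
  unfold GF FF
  ring

theorem elim_loopx (G : SimpleGraph V) (v : R) (x y : V) (hxy : x ≠ y)
    {S : Finset V} {c : V} {l : List V} (h : Tr G {x, y} S x c l x) (α β γ δ : R) :
    (1 + v ^ 2) * FF G v x y S α β γ δ =
      LX v (l.length + 1) (FF G v x y (S ∪ l.toFinset)) α β γ δ := by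
  obtain ⟨f1, f2, f3, f4, f5, f6⟩ := tr_facts _ _ h
  have e := tr_elim G {x, y} v x y (by simp) (by simp) α β γ δ x (by simp) h f5
  have hx : x ∉ S ∪ l.toFinset := by
    simp only [Finset.mem_union, List.mem_toFinset, not_or]
    exact ⟨f5, fun h => (f2 x h).2 (by simp)⟩
  rw [if_pos rfl] at e
  unfold FF
  rw [e, Lv, ff_xx _ _ _ _ _ hxy hx]
  unfold LX FF
  ring

theorem elim_loopy (G : SimpleGraph V) (v : R) (x y : V) (hxy : x ≠ y)
    {S : Finset V} {c : V} {l : List V} (h : Tr G {x, y} S y c l y) (α β γ δ : R) :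
    (1 + v ^ 2) * FF G v x y S α β γ δ =
      LY v (l.length + 1) (FF G v x y (S ∪ l.toFinset)) α β γ δ := by
  obtain ⟨f1, f2, f3, f4, f5, f6⟩ := tr_facts _ _ h
  have e := tr_elim G {x, y} v x y (by simp) (by simp) α β γ δ y (by simp) h f5
  have hy : y ∉ S ∪ l.toFinset := by
    simp only [Finset.mem_union, List.mem_toFinset, not_or]
    exact ⟨f5, fun h => (f2 y h).2 (by simp)⟩
  rw [if_pos rfl] at e
  unfold FF
  rw [e, Lv, ff_yy _ _ _ _ _ hxy hy]
  unfold LY FF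
  ring

theorem mat_isol (G : SimpleGraph V) (v : R) (x y : V) (S : Finset V) (α β γ δ : R) (z : V)
    (hzx : z ≠ x) (hzy : z ≠ y) (hz : z ∉ S) (hadj : ∀ u, u ∉ S → ¬ G.Adj z u) :
    (Mat G v x y S α β γ δ).permanent = (1 - v ^ 2) * FF G v x y (insert z S) α β γ δ ∧
    (rowTo (Mat G v x y S α β γ δ) z z).permanent = FF G v x y (insert z S) α β γ δ := by
  have h0 : ∀ j, j ≠ z → Mat G v x y S α β γ δ z j = 0 := by
    intro j hj
    by_cases hjS : j ∈ S
    · simp [Mat, hjS, hj.symm]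
    · simp [Mat, hzx, hzy, hj.symm, hadj j hjS]
  constructor
  · rw [per_double _ z, mat_kill]
    rw [Finset.sum_eq_zero]
    · simp [Mat, FF, hzx, hzy, hz]
    · intro i _
      refine Finset.sum_eq_zero fun j hj => ?_
      rw [h0 j (Finset.ne_of_mem_erase hj)]; ring
  · rw [per_double _ z, killV_rowTo_self, mat_kill]
    rw [Finset.sum_eq_zero]
    · simp [FF, rowTo_apply]
    · intro i _
      refine Finset.sum_eq_zero fun j hj => ?_
      simp [rowTo_apply, Finset.ne_of_mem_erase hj]

theorem elim_cycle (G : SimpleGraph V) (v : R) (x y : V) (z : V) (hzx : z ≠ x) (hzy : z ≠ y)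
    {S : Finset V} {c : V} {l : List V} (h : Tr G {x, y, z} S z c l z)
    (hadj : ∀ u, u ∉ S ∪ l.toFinset → ¬ G.Adj z u) (α β γ δ : R) :
    (1 + v ^ 2) * FF G v x y S α β γ δ =
      (1 + v ^ 2) * ((1 + 2 * v ^ (l.length + 1) + (-v ^ 2) ^ (l.length + 1)) *
        FF G v x y (insert z (S ∪ l.toFinset)) α β γ δ) := by
  obtain ⟨f1, f2, f3, f4, f5, f6⟩ := tr_facts _ _ h
  have e := tr_elim G {x, y, z} v x y (by simp) (by simp) α β γ δ z (by simp) h f5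
  have hz : z ∉ S ∪ l.toFinset := by
    simp only [Finset.mem_union, List.mem_toFinset, not_or]
    exact ⟨f5, fun h => (f2 z h).2 (by simp)⟩
  rw [if_pos rfl] at e
  obtain ⟨g1, g2⟩ := mat_isol G v x y _ α β γ δ z hzx hzy hz hadj
  conv_lhs => unfold FF
  rw [e, Lv, g1, g2]
  ring

theorem ff_end (G : SimpleGraph V) (v : R) (x y : V) (hxy : x ≠ y) (S : Finset V)
    (hS : ∀ u, u ∉ S ↔ u = x ∨ u = y) (α β γ δ : R) :
    FF G v x y S α β γ δ = α * β + γ * δ := by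
  have hx : x ∉ S := (hS x).2 (Or.inl rfl)
  have hy : y ∉ S := (hS y).2 (Or.inr rfl)
  have hK : Mat G v x y (insert x (insert y S)) α β γ δ = 1 := by
    ext i j
    have : i ∈ insert x (insert y S) := by
      by_contra h
      simp only [Finset.mem_insert, not_or] at h
      rcases (hS i).1 h.2.2 with h' | h'
      · exact h.1 h'
      · exact h.2.1 h'
    simp only [Mat, this, true_or, if_true, Matrix.one_apply]
  have hp : ∀ i, i ≠ y → i ≠ x → i ∈ S := by
    intro i h1 h2
    by_contra h
    rcases (hS i).1 h with h' | h' <;> contradiction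
  have hr : (rowTo (Mat G v x y (insert y S) α β γ δ) x x).permanent = 1 := by
    rw [per_double _ x, killV_rowTo_self, mat_kill, hK, Finset.sum_eq_zero]
    · simp [rowTo_apply]
    · intro i _
      refine Finset.sum_eq_zero fun j hj => ?_
      simp [rowTo_apply, Finset.ne_of_mem_erase hj]
  have hm : (Mat G v x y (insert y S) α β γ δ).permanent = α := by
    rw [per_double _ x, mat_kill, hK, Finset.sum_eq_zero]
    · simp [Mat, hx, hxy]
    · intro i _
      refine Finset.sum_eq_zero fun j hj => ?_
      have hj := Finset.ne_of_mem_erase hj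
      have : j ∈ insert y S := by
        by_cases h : j = y
        · simp [h]
        · simp [hp j h hj]
      rw [show Mat G v x y (insert y S) α β γ δ x j = 0 by
        simp only [Mat, this, or_true, if_true, if_neg hj.symm]]
      ring
  unfold FF
  rw [per_pend _ y x hxy, mat_kill, hr, hm]
  · simp [Mat, hx, hy, hxy, hxy.symm]; ring
  · intro i h1 h2; simp [Mat, hp i h1 h2, h1]
  · intro i h1 h2; simp [Mat, hp i h1 h2, h1.symm]

theorem tr_count (G : SimpleGraph V) (H : Finset V) {S : Finset V} {p c : V} {l : List V} {e : V}
    (h : Tr G H S p c l e) (u : V) (hu : u ∈ H) :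
    (l.toFinset.filter (fun w => G.Adj u w)).card =
      (if u = p then 1 else 0) + (if u = e then 1 else 0) := by
  induction h with
  | last S p c e h1 h2 h3 h4 h5 h6 =>
    have : G.Adj u c ↔ u = p ∨ u = e := by rw [G.adj_comm, h6]
    have hs : [c].toFinset = {c} := by ext; simp
    rw [hs, Finset.filter_singleton]
    by_cases hp : u = p
    · have h7 : u ≠ e := fun h => h5 (hp ▸ h)
      rw [if_pos (this.2 (Or.inl hp)), if_pos hp, if_neg h7, Finset.card_singleton]
    · by_cases he : u = e
      · rw [if_pos (this.2 (Or.inr he)), if_neg hp, if_pos he, Finset.card_singleton]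
      · have h7 : ¬ G.Adj u c := fun h => by rcases this.1 h with h | h <;> contradiction
        rw [if_neg h7, if_neg hp, if_neg he, Finset.card_empty]
  | step S p c n l e h1 h2 h3 h4 h5 h6 h7 ih =>
    have h8 : G.Adj u c ↔ u = p := by
      rw [G.adj_comm, h6]
      exact ⟨fun h => h.resolve_right (fun h => h3 (h ▸ hu)), Or.inl⟩
    have h9 : u ≠ c := fun h => h2 (h ▸ hu)
    have hcl : c ∉ l.toFinset := by
      intro h; exact ((tr_facts G H h7).2.1 c (by simpa using h)).1 (by simp)
    rw [if_neg h9] at ih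
    rw [List.toFinset_cons, Finset.filter_insert, h8]
    by_cases hp : u = p
    · rw [if_pos hp, if_pos hp, Finset.card_insert_of_notMem (by simp at hcl; simp [hcl]), ih]
      omega
    · rw [if_neg hp, if_neg hp, ih]

/-- No edge from alive non-hub vertices to removed vertices. -/
def Closed (G : SimpleGraph V) (H S : Finset V) : Prop :=
  ∀ u, u ∉ S → u ∉ H → ∀ z, G.Adj u z → z ∉ S

theorem tr_exists (G : SimpleGraph V) (H : Finset V)
    (hN : ∀ u, u ∉ H → ∃ a b, a ≠ b ∧ ∀ z, G.Adj u z ↔ z = a ∨ z = b) :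
    ∀ (n : ℕ) (S : Finset V) (p c : V), Sᶜ.card = n → c ∉ S → c ∉ H → (p ∈ S ∨ p ∈ H) →
      G.Adj c p → (∀ z, G.Adj c z → z ≠ p → z ∉ S) →
      (∀ u, u ∉ S → u ∉ H → u ≠ c → ∀ z, G.Adj u z → z ∉ S) →
      ∃ l e, Tr G H S p c l e ∧ Closed G H (S ∪ l.toFinset) := by
  intro n
  induction n with
  | zero =>
    intro S p c hS hc
    exfalso
    rw [Finset.card_eq_zero] at hS
    exact hc (by
      by_contra h
      have : c ∈ Sᶜ := by simp [h]
      rw [hS] at this; simp at this)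
  | succ n ih =>
    intro S p c hS hc hcH hp hcp h1 h2
    have : ∃ m, p ≠ m ∧ ∀ z, G.Adj c z ↔ z = p ∨ z = m := by
      obtain ⟨a, b, hab, h⟩ := hN c hcH
      rcases (h p).1 hcp with rfl | rfl
      · exact ⟨b, hab, h⟩
      · exact ⟨a, hab.symm, fun z => by rw [h, or_comm]⟩
    obtain ⟨m, hpm, hm⟩ := this
    have hcm : G.Adj c m := (hm m).2 (Or.inr rfl)
    have hmS : m ∉ S := h1 m hcm hpm.symm
    have hkey : ∀ u, u ∉ S → u ∉ H → u ≠ m → ¬ G.Adj u c := by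
      intro u hu1 hu2 hu3 hu4
      rcases (hm u).1 hu4.symm with h | h
      · subst h; rcases hp with h | h <;> contradiction
      · exact hu3 h
    by_cases hmH : m ∈ H
    · refine ⟨[c], m, Tr.last S p c m hc hcH hmH hmS hpm hm, ?_⟩
      intro u hu1 hu2 z hz hz2
      simp only [Finset.mem_union, List.mem_toFinset, List.mem_singleton, not_or] at hu1 hz2
      rcases hz2 with hz2 | hz2
      · exact h2 u hu1.1 hu2 hu1.2 z hz hz2
      · subst hz2
        exact hkey u hu1.1 hu2 (fun h => hu2 (h ▸ hmH)) hz
    · have hcard : (insert c S)ᶜ.card = n := by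
        rw [Finset.card_compl, Finset.card_insert_of_notMem hc]
        rw [Finset.card_compl] at hS
        omega
      have q1 : ∀ z, G.Adj m z → z ≠ c → z ∉ insert c S := by
        intro z hz hzc hzS
        rcases Finset.mem_insert.1 hzS with h | h
        · exact hzc h
        · exact h2 m hmS hmH hcm.ne.symm z hz h
      have q2 : ∀ u, u ∉ insert c S → u ∉ H → u ≠ m → ∀ z, G.Adj u z → z ∉ insert c S := by
        intro u hu1 hu2 hu3 z hz hzS
        simp only [Finset.mem_insert, not_or] at hu1
        rcases Finset.mem_insert.1 hzS with h | h
        · subst h; exact hkey u hu1.2 hu2 hu3 hz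
        · exact h2 u hu1.2 hu2 hu1.1 z hz h
      obtain ⟨l, e, ht, hcl⟩ := ih (insert c S) c m hcard (by simp [hmS, hcm.ne.symm]) hmH
        (by simp) hcm.symm q1 q2
      refine ⟨c :: l, e, Tr.step S p c m l e hc hcH hmH hmS hpm hm ht, ?_⟩
      have hU : S ∪ (c :: l).toFinset = insert c S ∪ l.toFinset := by
        ext; simp
      rw [hU]; exact hcl

theorem tr_exists_closed (G : SimpleGraph V) (H S : Finset V)
    (hN : ∀ u, u ∉ H → ∃ a b, a ≠ b ∧ ∀ z, G.Adj u z ↔ z = a ∨ z = b) (hS : Closed G H S)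
    (p c : V) (hp : p ∈ H) (hc : c ∉ S) (hcH : c ∉ H) (hpc : G.Adj p c) :
    ∃ l e, Tr G H S p c l e ∧ Closed G H (S ∪ l.toFinset) :=
  tr_exists G H hN _ S p c rfl hc hcH (Or.inr hp) hpc.symm
    (fun z hz _ => hS c hc hcH z hz) (fun u h1 h2 _ => hS u h1 h2)

end MatSec

section ClassifySec

variable {V : Type*} [Fintype V] {R : Type*} [CommRing R]

/-- number of alive non-hub neighbours -/
def dn (G : SimpleGraph V) (H S : Finset V) (h : V) : ℕ :=
  (Finset.univ.filter (fun u => G.Adj h u ∧ u ∉ S ∧ u ∉ H)).card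

theorem dn_drop (G : SimpleGraph V) (H : Finset V) {S : Finset V} {p c : V} {l : List V} {e : V}
    (ht : Tr G H S p c l e) (h : V) (hh : h ∈ H) :
    dn G H (S ∪ l.toFinset) h + ((if h = p then 1 else 0) + (if h = e then 1 else 0)) =
      dn G H S h := by
  rw [← tr_count G H ht h hh]
  obtain ⟨f1, f2, -⟩ := tr_facts _ _ ht
  unfold dn
  rw [← Finset.card_union_of_disjoint]
  · congr 1
    ext u
    simp only [Finset.mem_union, Finset.mem_filter, Finset.mem_univ, true_and, List.mem_toFinset]
    constructor
    · rintro (⟨a, b, c⟩ | ⟨a, b⟩)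
      · exact ⟨a, fun h => b (Or.inl h), c⟩
      · exact ⟨b, f2 u a⟩
    · rintro ⟨a, b, c⟩
      by_cases hu : u ∈ l
      · exact Or.inr ⟨hu, a⟩
      · exact Or.inl ⟨a, by tauto, c⟩
  · rw [Finset.disjoint_left]
    intro u hu hu2
    simp only [Finset.mem_union, Finset.mem_filter, Finset.mem_univ, true_and,
      List.mem_toFinset] at hu hu2
    exact hu.2.1 (Or.inr hu2.1)

theorem dn_pos (G : SimpleGraph V) (H S : Finset V) (h : V) (hp : 0 < dn G H S h) :
    ∃ u, G.Adj h u ∧ u ∉ S ∧ u ∉ H := by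
  obtain ⟨u, hu⟩ := Finset.card_pos.1 hp
  exact ⟨u, by simpa using hu⟩

theorem dn_zero (G : SimpleGraph V) (H S : Finset V) (h : V) (hp : dn G H S h = 0) :
    ∀ u, G.Adj h u → u ∉ S → u ∈ H := by
  intro u h1 h2
  by_contra h3
  have : u ∈ Finset.univ.filter (fun u => G.Adj h u ∧ u ∉ S ∧ u ∉ H) := by simp [h1, h2, h3]
  rw [Finset.card_eq_zero.1 hp] at this
  simp at this

/-- Cycle factor -/
def Cyc (v : R) (ks : List ℕ) : R := (ks.map (fun k => 1 + 2 * v ^ k + (-v ^ 2) ^ k)).prod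

theorem compl_card_union (S : Finset V) (l : List V) (h1 : l.Nodup) (h2 : ∀ u ∈ l, u ∉ S) :
    (S ∪ l.toFinset)ᶜ.card + l.length = Sᶜ.card := by
  have h3 : (S ∪ l.toFinset).card = S.card + l.length := by
    rw [Finset.card_union_of_disjoint, List.toFinset_card_of_nodup h1]
    rw [Finset.disjoint_right]
    intro u hu; exact h2 u (by simpa using hu)
  have h4 := Finset.card_le_univ (S ∪ l.toFinset)
  rw [Finset.card_compl, Finset.card_compl]
  omega

theorem cycles [IsDomain R] (v : R) (hv : 1 + v ^ 2 ≠ 0) (G : SimpleGraph V) (x y : V)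
    (hxy : x ≠ y)
    (hN : ∀ u, u ∉ ({x, y} : Finset V) → ∃ a b, a ≠ b ∧ ∀ z, G.Adj u z ↔ z = a ∨ z = b) :
    ∀ (n : ℕ) (S : Finset V), Sᶜ.card = n → x ∉ S → y ∉ S → Closed G {x, y} S →
      dn G {x, y} S x = 0 → dn G {x, y} S y = 0 →
      ∃ ks : List ℕ, (∀ k ∈ ks, 3 ≤ k) ∧ Sᶜ.card = 2 + ks.sum ∧
        ∀ α β γ δ, FF G v x y S α β γ δ = (α * β + γ * δ) * Cyc v ks := by
  intro n
  induction n using Nat.strong_induction_on with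
  | _ n ih =>
  intro S hn hx hy hcl hdx hdy
  by_cases hS : ∀ u, u ∉ S ↔ u = x ∨ u = y
  · refine ⟨[], by simp, ?_, ?_⟩
    · have : Sᶜ = {x, y} := by
        ext u; simp [hS u]
      rw [this, Finset.card_pair hxy]; simp
    · intro α β γ δ
      rw [ff_end G v x y hxy S hS]; simp [Cyc]
  · have : ∃ z, z ∉ S ∧ z ≠ x ∧ z ≠ y := by
      by_contra hcon
      push Not at hcon
      apply hS
      intro u
      constructor
      · intro hu
        by_cases h : u = x
        · exact Or.inl h
        · exact Or.inr (hcon u hu h)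
      · rintro (rfl | rfl) <;> assumption
    obtain ⟨z, hzS, hzx, hzy⟩ := this
    obtain ⟨a, b, hab, hz⟩ := hN z (by simp [hzx, hzy])
    have hza : G.Adj z a := (hz a).2 (Or.inl rfl)
    have hzb : G.Adj z b := (hz b).2 (Or.inr rfl)
    have haS : a ∉ S := hcl z hzS (by simp [hzx, hzy]) a hza
    have hnb : ∀ u, G.Adj z u → u ≠ x ∧ u ≠ y := by
      intro u hu
      constructor
      · rintro rfl
        have := dn_zero G _ S _ hdx z hu.symm hzS
        simp [hzx, hzy] at this
      · rintro rfl
        have := dn_zero G _ S _ hdy z hu.symm hzS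
        simp [hzx, hzy] at this
    have hcl' : Closed G {x, y, z} S := by
      intro u h1 h2 w hw
      exact hcl u h1 (by simp at h2 ⊢; tauto) w hw
    obtain ⟨l, e, ht, hcl2⟩ := tr_exists_closed G {x, y, z} S
      (fun u hu => hN u (by simp at hu ⊢; tauto)) hcl' z a (by simp) haS
      (by simp [(hnb a hza).1, (hnb a hza).2, hza.ne.symm]) hza
    obtain ⟨f1, f2, f3, f4, f5, f6⟩ := tr_facts _ _ ht
    have hle : ∀ h, h ∈ ({x, y, z} : Finset V) → dn G {x, y, z} S h ≤ dn G {x, y} S h := by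
      intro h _
      apply Finset.card_le_card
      intro u
      simp only [Finset.mem_filter, Finset.mem_univ, true_and, Finset.mem_insert,
        Finset.mem_singleton]
      tauto
    have hez : e = z := by
      have dx := dn_drop G _ ht x (by simp)
      have dy := dn_drop G _ ht y (by simp)
      have lx := hle x (by simp)
      have ly := hle y (by simp)
      rw [hdx] at lx
      rw [hdy] at ly
      simp only [Finset.mem_insert, Finset.mem_singleton] at f4
      rcases f4 with h | h | h
      · rw [if_pos h.symm] at dx; omega
      · rw [if_pos h.symm] at dy; omega
      · exact h
    subst hez
    have dz := dn_drop G _ ht e (by simp)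
    have dz2 : dn G {x, y, e} S e ≤ 2 := by
      have : dn G {x, y, e} S e ≤ ({a, b} : Finset V).card := by
        apply Finset.card_le_card
        intro u hu
        simp only [Finset.mem_filter, Finset.mem_univ, true_and] at hu
        simpa using (hz u).1 hu.1
      exact this.trans Finset.card_le_two
    simp only [if_true] at dz
    have dz0 : dn G {x, y, e} (S ∪ l.toFinset) e = 0 := by omega
    have hl2 : 2 ≤ l.length := by
      have := tr_count G _ ht e (by simp)
      simp only [if_true] at this
      have h2 := Finset.card_filter_le l.toFinset (fun w => G.Adj e w)
      have h3 := List.toFinset_card_le l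
      omega
    have hadj : ∀ u, u ∉ S ∪ l.toFinset → ¬ G.Adj e u := by
      intro u hu hadj
      have := dn_zero G _ _ _ dz0 u hadj hu
      simp [(hnb u hadj).1, (hnb u hadj).2, hadj.ne.symm] at this
    have heU : e ∉ S ∪ l.toFinset := by
      simp only [Finset.mem_union, List.mem_toFinset, not_or]
      exact ⟨f5, fun h => (f2 e h).2 (by simp)⟩
    have hcard := compl_card_union S l f1 (fun u hu => (f2 u hu).1)
    have hcard2 : (insert e (S ∪ l.toFinset))ᶜ.card + 1 = (S ∪ l.toFinset)ᶜ.card := by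
      rw [Finset.card_compl, Finset.card_compl, Finset.card_insert_of_notMem heU]
      have := Finset.card_lt_univ_of_notMem heU
      omega
    have hnotin : ∀ u, u = x ∨ u = y → u ∉ S → u ≠ e → u ∉ insert e (S ∪ l.toFinset) := by
      intro u hu h1 h2
      simp only [Finset.mem_insert, Finset.mem_union, List.mem_toFinset, not_or]
      exact ⟨h2, h1, fun h => (f2 u h).2 (by simp; tauto)⟩
    have hsub : ∀ h, dn G {x, y} (insert e (S ∪ l.toFinset)) h ≤ dn G {x, y} S h := by
      intro h
      apply Finset.card_le_card
      intro u
      simp only [Finset.mem_filter, Finset.mem_univ, true_and, Finset.mem_insert,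
        Finset.mem_union]
      tauto
    obtain ⟨ks, k1, k2, k3⟩ := ih _ (by omega) (insert e (S ∪ l.toFinset)) rfl
      (hnotin x (Or.inl rfl) hx hzx.symm) (hnotin y (Or.inr rfl) hy hzy.symm)
      (by
        intro u hu1 hu2 w hw hw2
        have hu3 : u ≠ e ∧ u ∉ S ∪ l.toFinset := by
          constructor
          · rintro rfl; simp at hu1
          · intro h; exact hu1 (Finset.mem_insert_of_mem h)
        rcases Finset.mem_insert.1 hw2 with h | h
        · subst h; exact hadj u hu3.2 hw.symm
        · exact hcl2 u hu3.2 (by simp at hu2 ⊢; tauto) w hw h)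
      (by have := hsub x; omega) (by have := hsub y; omega)
    refine ⟨(l.length + 1) :: ks, ?_, ?_, ?_⟩
    · intro k hk
      rcases List.mem_cons.1 hk with rfl | hk
      · omega
      · exact k1 k hk
    · rw [List.sum_cons]; omega
    · intro α β γ δ
      have := mul_left_cancel₀ hv (elim_cycle G v x y e hzx hzy ht hadj α β γ δ)
      rw [this, k3]
      simp only [Cyc, List.map_cons, List.prod_cons]
      ring

theorem GF_congr (v k : R) (a : ℕ) (F F' : R → R → R → R → R)
    (h : ∀ α β γ δ, k * F α β γ δ = F' α β γ δ) (α β γ δ : R) :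
    k * GF v a F α β γ δ = GF v a F' α β γ δ := by
  unfold GF; simp only [← h]; ring

theorem LX_congr (v k : R) (a : ℕ) (F F' : R → R → R → R → R)
    (h : ∀ α β γ δ, k * F α β γ δ = F' α β γ δ) (α β γ δ : R) :
    k * LX v a F α β γ δ = LX v a F' α β γ δ := by
  unfold LX; simp only [← h]; ring

theorem LY_congr (v k : R) (a : ℕ) (F F' : R → R → R → R → R)
    (h : ∀ α β γ δ, k * F α β γ δ = F' α β γ δ) (α β γ δ : R) :
    k * LY v a F α β γ δ = LY v a F' α β γ δ := by
  unfold LY; simp only [← h]; ring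

/-- closed form for theta graphs -/
def PT (v : R) (a b c : ℕ) : R :=
  (1 + 2 * v + 5 * v ^ 2 + 4 * v ^ 3 + 4 * v ^ 4) +
  (-v ^ 2) ^ a * (-v ^ 2) ^ b * (-v ^ 2) ^ c * (-4 + 4 * v - 5 * v ^ 2 + 2 * v ^ 3 - v ^ 4) +
  (-v ^ 2 * (1 + v) ^ 2 * ((-v ^ 2) ^ a + (-v ^ 2) ^ b + (-v ^ 2) ^ c) +
   (1 - v) ^ 2 * ((-v ^ 2) ^ b * (-v ^ 2) ^ c + (-v ^ 2) ^ a * (-v ^ 2) ^ c +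
      (-v ^ 2) ^ a * (-v ^ 2) ^ b) +
   2 * (1 + v ^ 2) ^ 2 * ((1 - (-v ^ 2) ^ a) * (v ^ b * v ^ c) +
      (1 - (-v ^ 2) ^ b) * (v ^ a * v ^ c) + (1 - (-v ^ 2) ^ c) * (v ^ a * v ^ b)))

/-- dumbbell factor -/
def UU (v : R) (a : ℕ) : R :=
  1 + v + 2 * v ^ 2 + 2 * (1 + v ^ 2) * v ^ a + (1 - v) * (-v ^ 2) ^ a

/-- dumbbell factor -/
def WW (v : R) (a : ℕ) : R :=
  v + v ^ 2 + 2 * (1 + v ^ 2) * v ^ a + (2 - v + v ^ 2) * (-v ^ 2) ^ a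

/-- closed form for dumbbells -/
def PD (v : R) (l m c : ℕ) : R := UU v l * UU v m - (-v ^ 2) ^ c * (WW v l * WW v m)

theorem closed_theta (v Q : R) (a b c : ℕ) :
    GF v a (GF v b (GF v c (fun α β γ δ => (α * β + γ * δ) * Q)))
      (1 + v - v ^ 2) (1 + v - v ^ 2) 0 0 = PT v a b c * Q := by
  unfold GF PT
  generalize (-v ^ 2) ^ a = A
  generalize (-v ^ 2) ^ b = B
  generalize (-v ^ 2) ^ c = C
  generalize v ^ a = A'
  generalize v ^ b = B'
  generalize v ^ c = C'
  ring

theorem closed_theta1 (v Q : R) (b c : ℕ) :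
    (1 + v ^ 2) * (GF v b (GF v c (fun α β γ δ => (α * β + γ * δ) * Q)))
      (1 + v - v ^ 2) (1 + v - v ^ 2) v v = PT v 1 b c * Q := by
  unfold GF PT
  generalize (-v ^ 2) ^ b = B
  generalize (-v ^ 2) ^ c = C
  generalize v ^ b = B'
  generalize v ^ c = C'
  ring

theorem closed_dumb1 (v Q : R) (l m c : ℕ) :
    GF v c (LX v l (LY v m (fun α β γ δ => (α * β + γ * δ) * Q)))
      (1 + v - v ^ 2) (1 + v - v ^ 2) 0 0 = PD v l m c * Q := by
  unfold GF LX LY PD UU WW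
  generalize (-v ^ 2) ^ l = A
  generalize (-v ^ 2) ^ m = B
  generalize (-v ^ 2) ^ c = C
  generalize v ^ l = A'
  generalize v ^ m = B'
  generalize v ^ c = C'
  ring

theorem closed_dumb2 (v Q : R) (l m c : ℕ) :
    LX v l (GF v c (LY v m (fun α β γ δ => (α * β + γ * δ) * Q)))
      (1 + v - v ^ 2) (1 + v - v ^ 2) 0 0 = PD v l m c * Q := by
  unfold GF LX LY PD UU WW
  generalize (-v ^ 2) ^ l = A
  generalize (-v ^ 2) ^ m = B
  generalize (-v ^ 2) ^ c = C
  generalize v ^ l = A'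
  generalize v ^ m = B'
  generalize v ^ c = C'
  ring

theorem closed_dumb3 (v Q : R) (l m : ℕ) :
    (1 + v ^ 2) * LX v l (LY v m (fun α β γ δ => (α * β + γ * δ) * Q))
      (1 + v - v ^ 2) (1 + v - v ^ 2) v v = PD v l m 1 * Q := by
  unfold LX LY PD UU WW
  generalize (-v ^ 2) ^ l = A
  generalize (-v ^ 2) ^ m = B
  generalize v ^ l = A'
  generalize v ^ m = B'
  ring

end ClassifySec

section ClassifySec2

variable {V : Type*} [Fintype V] {R : Type*} [CommRing R]

/-- Three internally disjoint chains from `x` to `y`. -/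
structure ThetaData (G : SimpleGraph V) (x y : V) (l1 l2 l3 : List V) : Prop where
  c1 : List.IsChain G.Adj (x :: (l1 ++ [y]))
  c2 : List.IsChain G.Adj (x :: (l2 ++ [y]))
  c3 : List.IsChain G.Adj (x :: (l3 ++ [y]))
  nd : (l1 ++ l2 ++ l3).Nodup
  nx : x ∉ l1 ++ l2 ++ l3
  ny : y ∉ l1 ++ l2 ++ l3

theorem tr_loop_len (G : SimpleGraph V) (H : Finset V) {S : Finset V} {p c : V} {l : List V}
    (ht : Tr G H S p c l p) : 2 ≤ l.length := by
  have := tr_count G _ ht p (tr_facts _ _ ht).2.2.2.1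
  simp only [if_true] at this
  have h2 := Finset.card_filter_le l.toFinset (fun w => G.Adj p w)
  have h3 := List.toFinset_card_le l
  omega

theorem trace_hub (G : SimpleGraph V) (x y : V) (hxy : x ≠ y)
    (hN : ∀ u, u ∉ ({x, y} : Finset V) → ∃ a b, a ≠ b ∧ ∀ z, G.Adj u z ↔ z = a ∨ z = b)
    (S : Finset V) (hcl : Closed G {x, y} S) (hx : x ∉ S) (hy : y ∉ S)
    (p : V) (hp : p ∈ ({x, y} : Finset V))
    (hd : 0 < dn G {x, y} S p) :
    ∃ c l e, Tr G {x, y} S p c l e ∧ Closed G {x, y} (S ∪ l.toFinset) ∧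
      x ∉ S ∪ l.toFinset ∧ y ∉ S ∪ l.toFinset ∧
      (S ∪ l.toFinset)ᶜ.card + l.length = Sᶜ.card ∧
      dn G {x, y} (S ∪ l.toFinset) x + ((if x = p then 1 else 0) + (if x = e then 1 else 0)) =
        dn G {x, y} S x ∧
      dn G {x, y} (S ∪ l.toFinset) y + ((if y = p then 1 else 0) + (if y = e then 1 else 0)) =
        dn G {x, y} S y ∧ (e = x ∨ e = y) := by
  obtain ⟨c, h1, h2, h3⟩ := dn_pos G _ _ _ hd
  obtain ⟨l, e, ht, hc⟩ := tr_exists_closed G {x, y} S hN hcl p c hp h2 h3 h1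
  obtain ⟨f1, f2, f3, f4, f5, f6⟩ := tr_facts _ _ ht
  refine ⟨c, l, e, ht, hc, ?_, ?_, compl_card_union S l f1 (fun u hu => (f2 u hu).1),
    dn_drop G _ ht x (by simp), dn_drop G _ ht y (by simp), by simpa using f4⟩
  · simp only [Finset.mem_union, List.mem_toFinset, not_or]
    exact ⟨hx, fun h => (f2 x h).2 (by simp)⟩
  · simp only [Finset.mem_union, List.mem_toFinset, not_or]
    exact ⟨hy, fun h => (f2 y h).2 (by simp)⟩

theorem thetaData_mk (G : SimpleGraph V) (x y : V) (l1 l2 l3 : List V)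
    (h1 : List.IsChain G.Adj (x :: (l1 ++ [y])))
    (h2 : List.IsChain G.Adj (x :: (l2 ++ [y])))
    (h3 : List.IsChain G.Adj (x :: (l3 ++ [y])))
    (n1 : l1.Nodup) (n2 : l2.Nodup) (n3 : l3.Nodup)
    (d1 : ∀ u ∈ l1, u ∉ ({x, y} : Finset V)) (d2 : ∀ u ∈ l2, u ∉ ({x, y} : Finset V) ∧ u ∉ l1)
    (d3 : ∀ u ∈ l3, u ∉ ({x, y} : Finset V) ∧ u ∉ l1 ∧ u ∉ l2) :
    ThetaData G x y l1 l2 l3 := by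
  refine ⟨h1, h2, h3, ?_, ?_, ?_⟩
  · rw [List.nodup_append, List.nodup_append]
    refine ⟨⟨n1, n2, ?_⟩, n3, ?_⟩
    · rintro a ha b hb rfl; exact (d2 a hb).2 ha
    · rintro a ha b hb rfl
      rcases List.mem_append.1 ha with ha | ha
      · exact (d3 a hb).2.1 ha
      · exact (d3 a hb).2.2 ha
  · intro h
    simp only [List.mem_append] at h
    rcases h with (h | h) | h
    · exact d1 x h (by simp)
    · exact (d2 x h).1 (by simp)
    · exact (d3 x h).1 (by simp)
  · intro h
    simp only [List.mem_append] at h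
    rcases h with (h | h) | h
    · exact d1 y h (by simp)
    · exact (d2 y h).1 (by simp)
    · exact (d3 y h).1 (by simp)

/-- Outcome of the classification. -/
def Outcome (G : SimpleGraph V) (x y : V) (v F0 : R) : Prop :=
  ∃ ks : List ℕ, (∀ k ∈ ks, 3 ≤ k) ∧
    ((∃ l1 l2 l3, ThetaData G x y l1 l2 l3 ∧ l2 ≠ [] ∧ l3 ≠ [] ∧
        Fintype.card V = 2 + l1.length + l2.length + l3.length + ks.sum ∧
        (1 + v ^ 2) ^ 3 * F0 = PT v (l1.length + 1) (l2.length + 1) (l3.length + 1) * Cyc v ks) ∨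
     (∃ l m c, 3 ≤ l ∧ 3 ≤ m ∧ 1 ≤ c ∧ Fintype.card V + 1 = l + m + c + ks.sum ∧
        (1 + v ^ 2) ^ 3 * F0 = PD v l m c * Cyc v ks))

theorem classify [IsDomain R] (v : R) (hv : 1 + v ^ 2 ≠ 0) (G : SimpleGraph V) (x y : V)
    (hxy : x ≠ y)
    (hN : ∀ u, u ∉ ({x, y} : Finset V) → ∃ a b, a ≠ b ∧ ∀ z, G.Adj u z ↔ z = a ∨ z = b)
    (hdx : dn G {x, y} ∅ x + (if G.Adj x y then 1 else 0) = 3)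
    (hdy : dn G {x, y} ∅ y + (if G.Adj x y then 1 else 0) = 3) :
    Outcome G x y v (FF G v x y ∅ (1 + v - v ^ 2) (1 + v - v ^ 2)
      (if G.Adj x y then v else 0) (if G.Adj x y then v else 0)) := by
  have hcl0 : Closed G {x, y} ∅ := by intro u _ _ z _; simp
  have hcy := cycles v hv G x y hxy hN
  have hT := trace_hub G x y hxy hN
  have hcard : (∅ : Finset V)ᶜ.card = Fintype.card V := by simp
  by_cases hadj : G.Adj x y
  · simp only [if_pos hadj] at hdx hdy ⊢
    obtain ⟨c1, l1, e1, t1, k1, x1, y1, n1, dx1, dy1, he1⟩ :=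
      hT ∅ hcl0 (by simp) (by simp) x (by simp) (by omega)
    obtain ⟨f1, f2, f3, f4, f5, f6⟩ := tr_facts _ _ t1
    rcases he1 with rfl | rfl
    · -- loop at x
      simp only [if_true, if_neg hxy.symm] at dx1 dy1
      obtain ⟨c2, l2, e2, t2, k2, x2, y2, n2, dx2, dy2, he2⟩ :=
        hT _ k1 x1 y1 y (by simp) (by omega)
      rcases he2 with rfl | rfl
      · simp only [if_true] at dx2; omega
      simp only [if_true, if_neg hxy] at dx2 dy2
      obtain ⟨ks, h1, h2, h3⟩ := hcy _ _ rfl x2 y2 k2 (by omega) (by omega)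
      have := tr_loop_len _ _ t1
      have := tr_loop_len _ _ t2
      refine ⟨ks, h1, Or.inr ⟨l1.length + 1, l2.length + 1, 1, by omega, by omega, by omega,
        by omega, ?_⟩⟩
      rw [← closed_dumb3, ← (funext fun a => funext fun b => funext fun c => funext fun d =>
        h3 a b c d),
        ← LX_congr v (1 + v ^ 2) _ _ _ (fun a b c d => elim_loopy G v _ _ hxy t2 a b c d),
        ← elim_loopx G v _ _ hxy t1]
      ring
    · -- path
      simp only [if_true, if_neg hxy.symm, if_neg hxy] at dx1 dy1
      obtain ⟨c2, l2, e2, t2, k2, x2, y2, n2, dx2, dy2, he2⟩ :=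
        hT _ k1 x1 y1 x (by simp) (by omega)
      rcases he2 with rfl | rfl
      · simp only [if_true] at dx2; omega
      simp only [if_true, if_neg hxy.symm, if_neg hxy] at dx2 dy2
      obtain ⟨g1, g2, g3, g4, g5, g6⟩ := tr_facts _ _ t2
      obtain ⟨ks, h1, h2, h3⟩ := hcy _ _ rfl x2 y2 k2 (by omega) (by omega)
      refine ⟨ks, h1, Or.inl ⟨[], l1, l2, ?_, f6, g6, by simp only [List.length_nil]; omega, ?_⟩⟩
      · refine thetaData_mk _ _ _ _ _ _ (by simp [hadj]) f3 g3 (by simp) f1 g1 (by simp)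
          (fun u hu => ⟨(f2 u hu).2, by simp⟩) (fun u hu => ⟨(g2 u hu).2, by simp, fun h => ?_⟩)
        exact (g2 u hu).1 (by simp [h])
      · rw [List.length_nil, zero_add, ← closed_theta1, ← (funext fun a => funext fun b =>
          funext fun c => funext fun d => h3 a b c d),
          ← GF_congr v (1 + v ^ 2) _ _ _ (fun a b c d => elim_path G v _ _ hxy t2 x1 a b c d),
          ← elim_path G v _ _ hxy t1 (by simp)]
        ring
  · simp only [if_neg hadj] at hdx hdy ⊢
    obtain ⟨c1, l1, e1, t1, k1, x1, y1, n1, dx1, dy1, he1⟩ :=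
      hT ∅ hcl0 (by simp) (by simp) x (by simp) (by omega)
    obtain ⟨f1, f2, f3, f4, f5, f6⟩ := tr_facts _ _ t1
    rcases he1 with rfl | rfl
    · -- loop at x
      simp only [if_true, if_neg hxy.symm] at dx1 dy1
      obtain ⟨c2, l2, e2, t2, k2, x2, y2, n2, dx2, dy2, he2⟩ :=
        hT _ k1 x1 y1 _ (by simp) (show 0 < dn _ _ _ e1 by omega)
      rcases he2 with rfl | rfl
      · simp only [if_true] at dx2; omega
      simp only [if_true, if_neg hxy.symm, if_neg hxy] at dx2 dy2
      obtain ⟨c3, l3, e3, t3, k3, x3, y3, n3, dx3, dy3, he3⟩ :=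
        hT _ k2 x2 y2 _ (by simp) (show 0 < dn _ _ _ e2 by omega)
      rcases he3 with rfl | rfl
      · simp only [if_true] at dx3; omega
      simp only [if_true, if_neg hxy.symm, if_neg hxy] at dx3 dy3
      obtain ⟨ks, h1, h2, h3⟩ := hcy _ _ rfl x3 y3 k3 (by omega) (by omega)
      have := tr_loop_len _ _ t1
      have := tr_loop_len _ _ t3
      refine ⟨ks, h1, Or.inr ⟨l1.length + 1, l3.length + 1, l2.length + 1, by omega, by omega,
        by omega, by omega, ?_⟩⟩
      rw [← closed_dumb2, ← (funext fun a => funext fun b => funext fun c => funext fun d =>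
        h3 a b c d),
        ← LX_congr v (1 + v ^ 2) _ _ _ (fun a b c d =>
          GF_congr v (1 + v ^ 2) _ _ _ (fun a b c d => elim_loopy G v _ _ hxy t3 a b c d) a b c d),
        ← LX_congr v (1 + v ^ 2) _ _ _ (fun a b c d => elim_path G v _ _ hxy t2 x1 a b c d),
        ← elim_loopx G v _ _ hxy t1]
      ring
    · simp only [if_true, if_neg hxy.symm, if_neg hxy] at dx1 dy1
      obtain ⟨c2, l2, e2, t2, k2, x2, y2, n2, dx2, dy2, he2⟩ :=
        hT _ k1 x1 y1 x (by simp) (by omega)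
      obtain ⟨g1, g2, g3, g4, g5, g6⟩ := tr_facts _ _ t2
      rcases he2 with rfl | rfl
      · simp only [if_true, if_neg hxy.symm] at dx2 dy2
        obtain ⟨c3, l3, e3, t3, k3, x3, y3, n3, dx3, dy3, he3⟩ :=
          hT _ k2 x2 y2 _ (by simp) (show 0 < dn _ _ _ e1 by omega)
        rcases he3 with rfl | rfl
        · simp only [if_true] at dx3; omega
        simp only [if_true, if_neg hxy] at dx3 dy3
        obtain ⟨ks, h1, h2, h3⟩ := hcy _ _ rfl x3 y3 k3 (by omega) (by omega)
        have := tr_loop_len _ _ t2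
        have := tr_loop_len _ _ t3
        refine ⟨ks, h1, Or.inr ⟨l2.length + 1, l3.length + 1, l1.length + 1, by omega, by omega,
          by omega, by omega, ?_⟩⟩
        rw [← closed_dumb1, ← (funext fun a => funext fun b => funext fun c => funext fun d =>
          h3 a b c d),
          ← GF_congr v (1 + v ^ 2) _ _ _ (fun a b c d =>
            LX_congr v (1 + v ^ 2) _ _ _ (fun a b c d => elim_loopy G v _ _ hxy t3 a b c d)
              a b c d),
          ← GF_congr v (1 + v ^ 2) _ _ _ (fun a b c d => elim_loopx G v _ _ hxy t2 a b c d),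
          ← elim_path G v _ _ hxy t1 (by simp)]
        ring
      · simp only [if_true, if_neg hxy.symm, if_neg hxy] at dx2 dy2
        obtain ⟨c3, l3, e3, t3, k3, x3, y3, n3, dx3, dy3, he3⟩ :=
          hT _ k2 x2 y2 x (by simp) (by omega)
        rcases he3 with rfl | rfl
        · simp only [if_true] at dx3; omega
        simp only [if_true, if_neg hxy.symm, if_neg hxy] at dx3 dy3
        obtain ⟨i1, i2, i3, i4, i5, i6⟩ := tr_facts _ _ t3
        obtain ⟨ks, h1, h2, h3⟩ := hcy _ _ rfl x3 y3 k3 (by omega) (by omega)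
        refine ⟨ks, h1, Or.inl ⟨l1, l2, l3, ?_, g6, i6, by omega, ?_⟩⟩
        · refine thetaData_mk _ _ _ _ _ _ f3 g3 i3 f1 g1 i1 (fun u hu => (f2 u hu).2)
            (fun u hu => ⟨(g2 u hu).2, fun h => ?_⟩)
            (fun u hu => ⟨(i2 u hu).2, fun h => ?_, fun h => ?_⟩)
          · exact (g2 u hu).1 (by simp [h])
          · exact (i2 u hu).1 (by simp [h])
          · exact (i2 u hu).1 (by simp [h])
        · rw [← closed_theta, ← (funext fun a => funext fun b =>
            funext fun c => funext fun d => h3 a b c d),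
            ← GF_congr v (1 + v ^ 2) _ _ _ (fun a b c d =>
              GF_congr v (1 + v ^ 2) _ _ _ (fun a b c d => elim_path G v _ _ hxy t3 x2 a b c d)
              a b c d),
            ← GF_congr v (1 + v ^ 2) _ _ _ (fun a b c d => elim_path G v _ _ hxy t2 x1 a b c d),
            ← elim_path G v _ _ hxy t1 (by simp)]
          ring

end ClassifySec2

section ThetaSide

theorem theta_adj (p q r : ℕ) (i j : Fin (p + q + r + 2)) : (thetaGraph p q r).Adj i j ↔
    i.val ≠ j.val ∧ (((p = 0 ∧ i.val = 0 ∧ j.val = 1) ∨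
    (0 < p ∧ i.val = 0 ∧ j.val = 2) ∨
    (2 ≤ i.val ∧ i.val + 1 = j.val ∧ j.val < p + 2) ∨
    (0 < p ∧ i.val = p + 1 ∧ j.val = 1) ∨
    (q = 0 ∧ i.val = 0 ∧ j.val = 1) ∨
    (0 < q ∧ i.val = 0 ∧ j.val = p + 2) ∨
    (p + 2 ≤ i.val ∧ i.val + 1 = j.val ∧ j.val < p + q + 2) ∨
    (0 < q ∧ i.val = p + q + 1 ∧ j.val = 1) ∨
    (r = 0 ∧ i.val = 0 ∧ j.val = 1) ∨
    (0 < r ∧ i.val = 0 ∧ j.val = p + q + 2) ∨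
    (p + q + 2 ≤ i.val ∧ i.val + 1 = j.val) ∨
    (0 < r ∧ i.val = p + q + r + 1 ∧ j.val = 1)) ∨
    ((p = 0 ∧ j.val = 0 ∧ i.val = 1) ∨
    (0 < p ∧ j.val = 0 ∧ i.val = 2) ∨
    (2 ≤ j.val ∧ j.val + 1 = i.val ∧ i.val < p + 2) ∨
    (0 < p ∧ j.val = p + 1 ∧ i.val = 1) ∨
    (q = 0 ∧ j.val = 0 ∧ i.val = 1) ∨
    (0 < q ∧ j.val = 0 ∧ i.val = p + 2) ∨
    (p + 2 ≤ j.val ∧ j.val + 1 = i.val ∧ i.val < p + q + 2) ∨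
    (0 < q ∧ j.val = p + q + 1 ∧ i.val = 1) ∨
    (r = 0 ∧ j.val = 0 ∧ i.val = 1) ∨
    (0 < r ∧ j.val = 0 ∧ i.val = p + q + 2) ∨
    (p + q + 2 ≤ j.val ∧ j.val + 1 = i.val) ∨
    (0 < r ∧ j.val = p + q + r + 1 ∧ i.val = 1))) := by
  unfold thetaGraph
  rw [SimpleGraph.fromRel_adj, ← Fin.val_ne_iff]

theorem theta_hub_adj (p q r : ℕ) (h0 : (0 < p ∧ 0 < q) ∨ (0 < p ∧ 0 < r) ∨ (0 < q ∧ 0 < r))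
    (i j : Fin (p + q + r + 2)) (hi : i.val = 0) (hj : j.val = 1) :
    (thetaGraph p q r).Adj i j ↔ p = 0 ∨ q = 0 ∨ r = 0 := by
  rw [theta_adj]
  constructor
  · rintro ⟨h, (h | h | h | h | h | h | h | h | h | h | h | h) |
      (h | h | h | h | h | h | h | h | h | h | h | h)⟩ <;> omega
  · rintro (h | h | h)
    · exact ⟨by omega, Or.inl (Or.inl ⟨h, hi, hj⟩)⟩
    · exact ⟨by omega, Or.inl (Or.inr (Or.inr (Or.inr (Or.inr (Or.inl ⟨h, hi, hj⟩)))))⟩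
    · exact ⟨by omega, Or.inl (Or.inr (Or.inr (Or.inr (Or.inr (Or.inr (Or.inr (Or.inr (Or.inr
        (Or.inl ⟨h, hi, hj⟩)))))))))⟩

theorem theta_seg_adj (p q r o k : ℕ)
    (hok : (o = 2 ∧ k = p) ∨ (o = p + 2 ∧ k = q) ∨ (o = p + q + 2 ∧ k = r))
    (i z : Fin (p + q + r + 2)) (h1 : o ≤ i.val) (h2 : i.val < o + k) :
    (thetaGraph p q r).Adj i z ↔
      ((i.val = o ∧ z.val = 0) ∨ (o < i.val ∧ z.val + 1 = i.val)) ∨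
      ((i.val + 1 = o + k ∧ z.val = 1) ∨ (i.val + 1 < o + k ∧ z.val = i.val + 1)) := by
  rw [theta_adj]
  have hiL := i.isLt
  have hzL := z.isLt
  generalize i.val = a at *
  generalize z.val = b at *
  constructor
  · rintro ⟨h, (h | h | h | h | h | h | h | h | h | h | h | h) |
      (h | h | h | h | h | h | h | h | h | h | h | h)⟩ <;> omega
  · intro h
    rcases hok with ⟨rfl, rfl⟩ | ⟨rfl, rfl⟩ | ⟨rfl, rfl⟩ <;> rcases h with (h | h) | (h | h) <;>
    first
    | exact ⟨by omega, Or.inl (Or.inl ⟨by omega, by omega, by omega⟩)⟩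
    | exact ⟨by omega, Or.inl (Or.inr (Or.inl ⟨by omega, by omega, by omega⟩))⟩
    | exact ⟨by omega, Or.inl (Or.inr (Or.inr (Or.inl ⟨by omega, by omega, by omega⟩)))⟩
    | exact ⟨by omega, Or.inl (Or.inr (Or.inr (Or.inr (Or.inl ⟨by omega, by omega, by omega⟩))))⟩
    | exact ⟨by omega, Or.inl (Or.inr (Or.inr (Or.inr (Or.inr (Or.inl ⟨by omega, by omega, by omega⟩)))))⟩
    | exact ⟨by omega, Or.inl (Or.inr (Or.inr (Or.inr (Or.inr (Or.inr (Or.inl ⟨by omega, by omega, by omega⟩))))))⟩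
    | exact ⟨by omega, Or.inl (Or.inr (Or.inr (Or.inr (Or.inr (Or.inr (Or.inr (Or.inl ⟨by omega, by omega, by omega⟩)))))))⟩
    | exact ⟨by omega, Or.inl (Or.inr (Or.inr (Or.inr (Or.inr (Or.inr (Or.inr (Or.inr (Or.inl ⟨by omega, by omega, by omega⟩))))))))⟩
    | exact ⟨by omega, Or.inl (Or.inr (Or.inr (Or.inr (Or.inr (Or.inr (Or.inr (Or.inr (Or.inr (Or.inl ⟨by omega, by omega, by omega⟩)))))))))⟩
    | exact ⟨by omega, Or.inl (Or.inr (Or.inr (Or.inr (Or.inr (Or.inr (Or.inr (Or.inr (Or.inr (Or.inr (Or.inl ⟨by omega, by omega, by omega⟩))))))))))⟩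
    | exact ⟨by omega, Or.inl (Or.inr (Or.inr (Or.inr (Or.inr (Or.inr (Or.inr (Or.inr (Or.inr (Or.inr (Or.inr (Or.inl ⟨by omega, by omega⟩)))))))))))⟩
    | exact ⟨by omega, Or.inl (Or.inr (Or.inr (Or.inr (Or.inr (Or.inr (Or.inr (Or.inr (Or.inr (Or.inr (Or.inr (Or.inr (⟨by omega, by omega, by omega⟩))))))))))))⟩
    | exact ⟨by omega, Or.inr (Or.inl ⟨by omega, by omega, by omega⟩)⟩
    | exact ⟨by omega, Or.inr (Or.inr (Or.inl ⟨by omega, by omega, by omega⟩))⟩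
    | exact ⟨by omega, Or.inr (Or.inr (Or.inr (Or.inl ⟨by omega, by omega, by omega⟩)))⟩
    | exact ⟨by omega, Or.inr (Or.inr (Or.inr (Or.inr (Or.inl ⟨by omega, by omega, by omega⟩))))⟩
    | exact ⟨by omega, Or.inr (Or.inr (Or.inr (Or.inr (Or.inr (Or.inl ⟨by omega, by omega, by omega⟩)))))⟩
    | exact ⟨by omega, Or.inr (Or.inr (Or.inr (Or.inr (Or.inr (Or.inr (Or.inl ⟨by omega, by omega, by omega⟩))))))⟩
    | exact ⟨by omega, Or.inr (Or.inr (Or.inr (Or.inr (Or.inr (Or.inr (Or.inr (Or.inl ⟨by omega, by omega, by omega⟩)))))))⟩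
    | exact ⟨by omega, Or.inr (Or.inr (Or.inr (Or.inr (Or.inr (Or.inr (Or.inr (Or.inr (Or.inl ⟨by omega, by omega, by omega⟩))))))))⟩
    | exact ⟨by omega, Or.inr (Or.inr (Or.inr (Or.inr (Or.inr (Or.inr (Or.inr (Or.inr (Or.inr (Or.inl ⟨by omega, by omega, by omega⟩)))))))))⟩
    | exact ⟨by omega, Or.inr (Or.inr (Or.inr (Or.inr (Or.inr (Or.inr (Or.inr (Or.inr (Or.inr (Or.inr (Or.inl ⟨by omega, by omega, by omega⟩))))))))))⟩
    | exact ⟨by omega, Or.inr (Or.inr (Or.inr (Or.inr (Or.inr (Or.inr (Or.inr (Or.inr (Or.inr (Or.inr (Or.inr (Or.inl ⟨by omega, by omega⟩)))))))))))⟩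
    | exact ⟨by omega, Or.inr (Or.inr (Or.inr (Or.inr (Or.inr (Or.inr (Or.inr (Or.inr (Or.inr (Or.inr (Or.inr (Or.inr (⟨by omega, by omega, by omega⟩))))))))))))⟩

end ThetaSide

section ThetaSide2

variable {V : Type*} [Fintype V] {R : Type*} [CommRing R]

theorem tr_of_fun (G : SimpleGraph V) (H : Finset V) : ∀ (k : ℕ) (S : Finset V) (c : ℕ → V),
    (∀ i j, i ≤ k + 2 → j ≤ k + 2 → c i = c j → i = j) →
    (∀ i, 1 ≤ i → i ≤ k + 1 → c i ∉ S ∧ c i ∉ H ∧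
      ∀ z, G.Adj (c i) z ↔ z = c (i - 1) ∨ z = c (i + 1)) →
    c (k + 2) ∈ H → c (k + 2) ∉ S →
    ∃ l, Tr G H S (c 0) (c 1) l (c (k + 2)) ∧ l.length = k + 1 ∧
      ∀ u, u ∈ l ↔ ∃ i, 1 ≤ i ∧ i ≤ k + 1 ∧ u = c i := by
  intro k
  induction k with
  | zero =>
    intro S c hinj h1 h2 h3
    obtain ⟨a1, a2, a3⟩ := h1 1 le_rfl le_rfl
    refine ⟨[c 1], Tr.last S (c 0) (c 1) (c 2) a1 a2 h2 h3
      (fun h => by have := hinj 0 2 (by omega) (by omega) h; omega) a3, rfl, ?_⟩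
    intro u
    rw [List.mem_singleton]
    constructor
    · intro h; exact ⟨1, by omega, by omega, h⟩
    · rintro ⟨i, i1, i2, h⟩
      have : i = 1 := by omega
      rw [h, this]
  | succ k ih =>
    intro S c hinj h1 h2 h3
    obtain ⟨a1, a2, a3⟩ := h1 1 le_rfl (by omega)
    obtain ⟨b1, b2, b3⟩ := h1 2 (by omega) (by omega)
    obtain ⟨l, t, hl, hm⟩ := ih (insert (c 1) S) (fun i => c (i + 1))
      (fun i j hi hj h => by
        have := hinj (i + 1) (j + 1) (by omega) (by omega) h; omega)
      (by
        intro i i1 i2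
        obtain ⟨d1, d2, d3⟩ := h1 (i + 1) (by omega) (by omega)
        refine ⟨?_, d2, ?_⟩
        · simp only [Finset.mem_insert, not_or]
          exact ⟨fun h => by have := hinj (i + 1) 1 (by omega) (by omega) h; omega, d1⟩
        · intro z
          rw [d3 z]
          have : i + 1 - 1 = i - 1 + 1 := by omega
          rw [this]) h2
      (by
        simp only [Finset.mem_insert, not_or]
        exact ⟨fun h => by have := hinj (k + 2 + 1) 1 (by omega) (by omega) h; omega, h3⟩)
    refine ⟨c 1 :: l, Tr.step S (c 0) (c 1) (c 2) l _ a1 a2 b2 b1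
      (fun h => by have := hinj 0 2 (by omega) (by omega) h; omega) a3 t, by simp [hl], ?_⟩
    intro u
    rw [List.mem_cons, hm]
    constructor
    · rintro (h | ⟨i, i1, i2, h⟩)
      · exact ⟨1, by omega, by omega, h⟩
      · exact ⟨i + 1, by omega, by omega, h⟩
    · rintro ⟨i, i1, i2, h⟩
      by_cases hi : i = 1
      · left; rw [h, hi]
      · right
        refine ⟨i - 1, by omega, by omega, ?_⟩
        have : i - 1 + 1 = i := by omega
        simp only [this]; exact h

theorem theta_tr (p q r o k : ℕ) (G : SimpleGraph V) (e : V ≃ Fin (p + q + r + 2))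
    (hG : ∀ u w, G.Adj u w ↔ (thetaGraph p q r).Adj (e u) (e w))
    (x y : V) (hx : (e x).val = 0) (hy : (e y).val = 1)
    (hok : (o = 2 ∧ k = p) ∨ (o = p + 2 ∧ k = q) ∨ (o = p + q + 2 ∧ k = r)) (hk : 0 < k)
    (S : Finset V)
    (hS : ∀ u : V, o ≤ (e u).val → (e u).val < o + k → u ∉ S)
    (h1S : y ∉ S) :
    ∃ c l, Tr G {x, y} S x c l y ∧
      l.length = k ∧ ∀ u, u ∈ l ↔ o ≤ (e u).val ∧ (e u).val < o + k := by
  obtain ⟨m, rfl⟩ : ∃ m, k = m + 1 := ⟨k - 1, by omega⟩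
  have hlt : o + (m + 1) ≤ p + q + r + 2 := by omega
  have heq : ∀ u w : V, u = w ↔ (e u).val = (e w).val := by
    intro u w
    rw [← Fin.ext_iff, e.injective.eq_iff]
  let c : ℕ → V := fun i =>
    if h : 1 ≤ i ∧ i ≤ m + 1 then e.symm ⟨o + i - 1, by omega⟩
    else if i = 0 then x else y
  have c0 : c 0 = x := by simp [c]
  have cl : c (m + 2) = y := by simp [c]
  have cm : ∀ i, 1 ≤ i → i ≤ m + 1 → (e (c i)).val = o + i - 1 := by
    intro i h1 h2; simp [c, h1, h2]
  have v0 : (e (c 0)).val = 0 := by rw [c0]; exact hx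
  have vl : (e (c (m + 2))).val = 1 := by rw [cl]; exact hy
  have ho : 2 ≤ o := by omega
  have key := tr_of_fun G {x, y} m S c
    (by
      intro i j hi hj h
      have h := (heq _ _).1 h
      have e : ∀ i, i ≤ m + 2 → (e (c i)).val = if i = 0 then 0 else if i = m + 2 then 1
          else o + i - 1 := by
        intro i hi
        split_ifs with h1 h2
        · rw [h1, v0]
        · rw [h2, vl]
        · exact cm i (by omega) (by omega)
      rw [e i hi, e j hj] at h
      split_ifs at h <;> omega)
    (by
      intro i i1 i2
      have ci := cm i i1 i2
      refine ⟨hS _ (by omega) (by omega), ?_, ?_⟩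
      · simp only [Finset.mem_insert, Finset.mem_singleton, not_or]
        constructor <;> intro h <;> rw [h] at ci <;> omega
      · intro z
        rw [hG, theta_seg_adj p q r o (m + 1) hok (e (c i)) (e z) (by omega) (by omega), ci,
          heq, heq]
        have e1 : (e (c (i - 1))).val = if i = 1 then 0 else o + i - 2 := by
          split_ifs with h
          · rw [h]; exact v0
          · rw [cm _ (by omega) (by omega)]; omega
        have e2 : (e (c (i + 1))).val = if i = m + 1 then 1 else o + i := by
          split_ifs with h
          · rw [h]; exact vl
          · rw [cm _ (by omega) (by omega)]; omega
        rw [e1, e2]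
        split_ifs <;> omega)
    (by rw [cl]; simp) (by rw [cl]; exact h1S)
  obtain ⟨l, t, hl, hm⟩ := key
  rw [c0, cl] at t
  refine ⟨c 1, l, t, hl, ?_⟩
  intro u
  rw [hm]
  constructor
  · rintro ⟨i, i1, i2, h⟩
    rw [h, cm i i1 i2]; omega
  · rintro ⟨h1, h2⟩
    refine ⟨(e u).val - o + 1, by omega, by omega, ?_⟩
    rw [heq, cm _ (by omega) (by omega)]; omega

theorem dn_empty (G : SimpleGraph V) (H S : Finset V) (h : V) (hS : ∀ u, u ∉ S → u ∈ H) :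
    dn G H S h = 0 := by
  unfold dn
  rw [Finset.card_eq_zero, Finset.filter_eq_empty_iff]
  rintro u - ⟨-, h1, h2⟩
  exact h2 (hS u h1)

theorem form3 (v : R) (G : SimpleGraph V) (x y : V) (hxy : x ≠ y) (hadj : ¬ G.Adj x y)
    {c1 c2 c3 : V} {l1 l2 l3 : List V} (t1 : Tr G {x, y} ∅ x c1 l1 y)
    (t2 : Tr G {x, y} (∅ ∪ l1.toFinset) x c2 l2 y)
    (t3 : Tr G {x, y} (∅ ∪ l1.toFinset ∪ l2.toFinset) x c3 l3 y)
    (hS : ∀ u, u ∉ ∅ ∪ l1.toFinset ∪ l2.toFinset ∪ l3.toFinset ↔ u = x ∨ u = y) :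
    (1 + v ^ 2) ^ 3 * FF G v x y ∅ (1 + v - v ^ 2) (1 + v - v ^ 2)
      (if G.Adj x y then v else 0) (if G.Adj x y then v else 0) =
      PT v (l1.length + 1) (l2.length + 1) (l3.length + 1) ∧
    dn G {x, y} ∅ x + (if G.Adj x y then 1 else 0) = 3 ∧
    dn G {x, y} ∅ y + (if G.Adj x y then 1 else 0) = 3 := by
  have hx := (hS x).2 (Or.inl rfl)
  have hy := (hS y).2 (Or.inr rfl)
  have hx1 : x ∉ ∅ ∪ l1.toFinset ∪ l2.toFinset := fun h => hx (Finset.mem_union_left _ h)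
  have hx2 : x ∉ ∅ ∪ l1.toFinset := fun h => hx1 (Finset.mem_union_left _ h)
  have dx1 := dn_drop G _ t1 x (by simp)
  have dy1 := dn_drop G _ t1 y (by simp)
  have dx2 := dn_drop G _ t2 x (by simp)
  have dy2 := dn_drop G _ t2 y (by simp)
  have dx3 := dn_drop G _ t3 x (by simp)
  have dy3 := dn_drop G _ t3 y (by simp)
  rw [dn_empty _ _ _ _ (fun u hu => by simpa using (hS u).1 hu)] at dx3 dy3
  simp only [if_true, if_neg hxy, if_neg hxy.symm] at dx1 dx2 dx3 dy1 dy2 dy3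
  refine ⟨?_, by rw [if_neg hadj]; omega, by rw [if_neg hadj]; omega⟩
  simp only [if_neg hadj]
  rw [← mul_one (PT v _ _ _), ← closed_theta]
  have h3 : FF G v x y (∅ ∪ l1.toFinset ∪ l2.toFinset ∪ l3.toFinset) =
      fun α β γ δ => (α * β + γ * δ) * 1 := by
    funext a b c d
    rw [ff_end G v x y hxy _ hS, mul_one]
  rw [← h3, ← GF_congr v (1 + v ^ 2) _ _ _ (fun a b c d =>
      GF_congr v (1 + v ^ 2) _ _ _ (fun a b c d => elim_path G v _ _ hxy t3 hx1 a b c d) a b c d),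
      ← GF_congr v (1 + v ^ 2) _ _ _ (fun a b c d => elim_path G v _ _ hxy t2 hx2 a b c d),
      ← elim_path G v _ _ hxy t1 (by simp)]
  ring

theorem form2 (v : R) (G : SimpleGraph V) (x y : V) (hxy : x ≠ y) (hadj : G.Adj x y)
    {c1 c2 : V} {l1 l2 : List V} (t1 : Tr G {x, y} ∅ x c1 l1 y)
    (t2 : Tr G {x, y} (∅ ∪ l1.toFinset) x c2 l2 y)
    (hS : ∀ u, u ∉ ∅ ∪ l1.toFinset ∪ l2.toFinset ↔ u = x ∨ u = y) :
    (1 + v ^ 2) ^ 3 * FF G v x y ∅ (1 + v - v ^ 2) (1 + v - v ^ 2)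
      (if G.Adj x y then v else 0) (if G.Adj x y then v else 0) =
      PT v 1 (l1.length + 1) (l2.length + 1) ∧
    dn G {x, y} ∅ x + (if G.Adj x y then 1 else 0) = 3 ∧
    dn G {x, y} ∅ y + (if G.Adj x y then 1 else 0) = 3 := by
  have hx := (hS x).2 (Or.inl rfl)
  have hy := (hS y).2 (Or.inr rfl)
  have hx2 : x ∉ ∅ ∪ l1.toFinset := fun h => hx (Finset.mem_union_left _ h)
  have dx1 := dn_drop G _ t1 x (by simp)
  have dy1 := dn_drop G _ t1 y (by simp)
  have dx2 := dn_drop G _ t2 x (by simp)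
  have dy2 := dn_drop G _ t2 y (by simp)
  rw [dn_empty _ _ _ _ (fun u hu => by simpa using (hS u).1 hu)] at dx2 dy2
  simp only [if_true, if_neg hxy, if_neg hxy.symm] at dx1 dx2 dy1 dy2
  refine ⟨?_, by rw [if_pos hadj]; omega, by rw [if_pos hadj]; omega⟩
  simp only [if_pos hadj]
  rw [← mul_one (PT v _ _ _), ← closed_theta1]
  have h3 : FF G v x y (∅ ∪ l1.toFinset ∪ l2.toFinset) =
      fun α β γ δ => (α * β + γ * δ) * 1 := by
    funext a b c d
    rw [ff_end G v x y hxy _ hS, mul_one]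
  rw [← h3, ← GF_congr v (1 + v ^ 2) _ _ _ (fun a b c d => elim_path G v _ _ hxy t2 hx2 a b c d),
      ← elim_path G v _ _ hxy t1 (by simp)]
  ring

theorem PT_swap12 (v : R) (a b c : ℕ) : PT v a b c = PT v b a c := by
  unfold PT; ring

theorem PT_swap23 (v : R) (a b c : ℕ) : PT v a b c = PT v a c b := by
  unfold PT; ring

theorem theta_form (p q r : ℕ) (h0 : (0 < p ∧ 0 < q) ∨ (0 < p ∧ 0 < r) ∨ (0 < q ∧ 0 < r)) (v : R)
    (G : SimpleGraph V) (e : V ≃ Fin (p + q + r + 2))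
    (hG : ∀ u w, G.Adj u w ↔ (thetaGraph p q r).Adj (e u) (e w))
    (x y : V) (hx : (e x).val = 0) (hy : (e y).val = 1) :
    (1 + v ^ 2) ^ 3 * FF G v x y ∅ (1 + v - v ^ 2) (1 + v - v ^ 2)
      (if G.Adj x y then v else 0) (if G.Adj x y then v else 0) =
      PT v (p + 1) (q + 1) (r + 1) ∧
    dn G {x, y} ∅ x + (if G.Adj x y then 1 else 0) = 3 ∧
    dn G {x, y} ∅ y + (if G.Adj x y then 1 else 0) = 3 := by
  have heq : ∀ u w : V, u = w ↔ (e u).val = (e w).val := by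
    intro u w
    rw [← Fin.ext_iff, e.injective.eq_iff]
  have hne : x ≠ y := by
    intro h; have := (heq _ _).1 h; omega
  have hA := (hG x y).trans (theta_hub_adj p q r h0 (e x) (e y) hx hy)
  have T := fun o k => theta_tr p q r o k G e hG x y hx hy
  by_cases hp : p = 0
  · obtain ⟨c1, l1, t1, n1, m1⟩ := T (p + 2) q (by omega) (by omega) ∅ (by simp) (by simp)
    obtain ⟨c2, l2, t2, n2, m2⟩ := T (p + q + 2) r (by omega) (by omega) (∅ ∪ l1.toFinset)
      (by intro u h1 h2; simp [m1]; omega) (by simp [m1, hy])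
    have := form2 v _ _ _ hne (hA.2 (by omega)) t1 t2
      (by
        intro u
        have := (e u).isLt
        simp only [Finset.mem_union, List.mem_toFinset, m1, m2, Finset.notMem_empty, heq u x,
          heq u y, hx, hy, false_or]
        omega)
    rw [n1, n2] at this
    subst hp
    exact this
  by_cases hq : q = 0
  · obtain ⟨c1, l1, t1, n1, m1⟩ := T 2 p (by omega) (by omega) ∅ (by simp) (by simp)
    obtain ⟨c2, l2, t2, n2, m2⟩ := T (p + q + 2) r (by omega) (by omega) (∅ ∪ l1.toFinset)
      (by intro u h1 h2; simp [m1]; omega) (by simp [m1, hy])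
    have := form2 v _ _ _ hne (hA.2 (by omega)) t1 t2
      (by
        intro u
        have := (e u).isLt
        simp only [Finset.mem_union, List.mem_toFinset, m1, m2, Finset.notMem_empty, heq u x,
          heq u y, hx, hy, false_or]
        omega)
    rw [n1, n2] at this
    subst hq
    rw [PT_swap12]
    exact this
  by_cases hr : r = 0
  · obtain ⟨c1, l1, t1, n1, m1⟩ := T 2 p (by omega) (by omega) ∅ (by simp) (by simp)
    obtain ⟨c2, l2, t2, n2, m2⟩ := T (p + 2) q (by omega) (by omega) (∅ ∪ l1.toFinset)
      (by intro u h1 h2; simp [m1]; omega) (by simp [m1, hy])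
    have := form2 v _ _ _ hne (hA.2 (by omega)) t1 t2
      (by
        intro u
        have := (e u).isLt
        simp only [Finset.mem_union, List.mem_toFinset, m1, m2, Finset.notMem_empty, heq u x,
          heq u y, hx, hy, false_or]
        omega)
    rw [n1, n2] at this
    subst hr
    rw [PT_swap23, PT_swap12]
    exact this
  · obtain ⟨c1, l1, t1, n1, m1⟩ := T 2 p (by omega) (by omega) ∅ (by simp) (by simp)
    obtain ⟨c2, l2, t2, n2, m2⟩ := T (p + 2) q (by omega) (by omega) (∅ ∪ l1.toFinset)
      (by intro u h1 h2; simp [m1]; omega) (by simp [m1, hy])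
    obtain ⟨c3, l3, t3, n3, m3⟩ := T (p + q + 2) r (by omega) (by omega)
      (∅ ∪ l1.toFinset ∪ l2.toFinset)
      (by intro u h1 h2; simp [m1, m2]; omega) (by simp [m1, m2, hy])
    have := form3 v _ _ _ hne (fun h => by have := hA.1 h; omega) t1 t2 t3
      (by
        intro u
        have := (e u).isLt
        simp only [Finset.mem_union, List.mem_toFinset, m1, m2, m3, Finset.notMem_empty,
          heq u x, heq u y, hx, hy, false_or]
        omega)
    rw [n1, n2, n3] at this
    exact this

theorem theta_nbr (p q r : ℕ) (G : SimpleGraph V) (e : V ≃ Fin (p + q + r + 2))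
    (hG : ∀ u w, G.Adj u w ↔ (thetaGraph p q r).Adj (e u) (e w))
    (x y : V) (hx : (e x).val = 0) (hy : (e y).val = 1) (u : V) (hu : u ∉ ({x, y} : Finset V)) :
    ∃ a b, a ≠ b ∧ ∀ z, G.Adj u z ↔ z = a ∨ z = b := by
  have heq : ∀ u w : V, u = w ↔ (e u).val = (e w).val := by
    intro u w
    rw [← Fin.ext_iff, e.injective.eq_iff]
  have hL := (e u).isLt
  have h2 : 2 ≤ (e u).val := by
    simp only [Finset.mem_insert, Finset.mem_singleton, not_or, heq u x, heq u y, hx, hy] at hu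
    omega
  have : ∃ o k, ((o = 2 ∧ k = p) ∨ (o = p + 2 ∧ k = q) ∨ (o = p + q + 2 ∧ k = r)) ∧
      o ≤ (e u).val ∧ (e u).val < o + k := by
    by_cases h : (e u).val < p + 2
    · exact ⟨2, p, by omega, by omega, by omega⟩
    · by_cases h : (e u).val < p + q + 2
      · exact ⟨p + 2, q, by omega, by omega, by omega⟩
      · exact ⟨p + q + 2, r, by omega, by omega, by omega⟩
  obtain ⟨o, k, hok, h3, h4⟩ := this
  have B : ∀ z : V, G.Adj u z ↔ _ := fun z =>
    (hG u z).trans (theta_seg_adj p q r o k hok (e u) (e z) h3 h4)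
  have ho : o + k ≤ p + q + r + 2 := by omega
  have ho2 : 2 ≤ o := by omega
  clear hok
  have b1 : (if (e u).val = o then 0 else (e u).val - 1) < p + q + r + 2 := by
    split_ifs <;> omega
  have b2 : (if (e u).val + 1 = o + k then 1 else (e u).val + 1) < p + q + r + 2 := by
    split_ifs <;> omega
  refine ⟨e.symm ⟨_, b1⟩, e.symm ⟨_, b2⟩, ?_, ?_⟩
  · rw [Ne, heq, e.apply_symm_apply, e.apply_symm_apply]; simp only; clear B; intro h; split_ifs at h <;> omega
  · intro z
    rw [B z, heq z, heq z, e.apply_symm_apply, e.apply_symm_apply]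
    simp only
    split_ifs <;> omega

end ThetaSide2

section DegStep

variable {V : Type*} [Fintype V]

theorem prodX_coeff (d : V → ℚ) (s : Finset V) :
    (X ^ 2 * ∏ i ∈ s, (X - C (d i))).coeff (s.card + 2) = 1 ∧
    (X ^ 2 * ∏ i ∈ s, (X - C (d i))).coeff (s.card + 1) = - ∑ i ∈ s, d i ∧
    2 * (X ^ 2 * ∏ i ∈ s, (X - C (d i))).coeff (s.card) =
      (∑ i ∈ s, d i) ^ 2 - ∑ i ∈ s, d i ^ 2 := by
  have hN : ∀ s : Finset V, (X ^ 2 * ∏ i ∈ s, (X - C (d i))).natDegree = s.card + 2 := by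
    intro s
    rw [Polynomial.Monic.natDegree_mul (monic_X_pow 2) (monic_prod_of_monic _ _
      (fun i _ => monic_X_sub_C _)), natDegree_X_pow, natDegree_prod_of_monic _ _
      (fun i _ => monic_X_sub_C _)]
    simp [add_comm]
  induction s using Finset.induction_on with
  | empty => simp [coeff_X_pow]
  | insert a s ha ih =>
    obtain ⟨h1, h2, h3⟩ := ih
    have hz : (X ^ 2 * ∏ i ∈ s, (X - C (d i))).coeff (s.card + 1 + 2) = 0 :=
      coeff_eq_zero_of_natDegree_lt (by rw [hN]; omega)
    rw [Finset.prod_insert ha, Finset.card_insert_of_notMem ha, Finset.sum_insert ha,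
      Finset.sum_insert ha]
    have e : X ^ 2 * ((X - C (d a)) * ∏ i ∈ s, (X - C (d i))) =
      (X ^ 2 * ∏ i ∈ s, (X - C (d i))) * X - C (d a) * (X ^ 2 * ∏ i ∈ s, (X - C (d i))) := by ring
    rw [e]
    generalize (X ^ 2 * ∏ i ∈ s, (X - C (d i))) = P at *
    simp only [coeff_sub, coeff_C_mul]
    refine ⟨?_, ?_, ?_⟩
    · rw [show s.card + 1 + 2 = (s.card + 2) + 1 by ring, coeff_mul_X]
      rw [show s.card + 1 + 2 = (s.card + 2) + 1 by ring] at hz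
      rw [h1, hz]; ring
    · rw [coeff_mul_X, show s.card + 1 + 1 = s.card + 2 by ring, h1, h2]; ring
    · rw [coeff_mul_X, h2]; linear_combination h3

/-- entry matrix -/
def NN (G : SimpleGraph V) (i j : V) : ℚ[X] :=
  if i = j then X - C (G.degree i : ℚ) else -C (if G.Adj i j then 1 else 0)

theorem qPerm_eq (G : SimpleGraph V) :
    qPermPoly G = ∑ σ : Equiv.Perm V, ∏ i, NN G (σ i) i := by
  unfold qPermPoly Matrix.permanent
  refine Finset.sum_congr rfl (fun σ _ => Finset.prod_congr rfl (fun i _ => ?_))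
  unfold NN signlessLapMatrix
  simp only [Matrix.sub_apply, Matrix.diagonal_apply, Matrix.map_apply, Matrix.add_apply,
    SimpleGraph.degMatrix, SimpleGraph.adjMatrix_apply]
  by_cases h : σ i = i
  · simp [h]
  · simp [h]

theorem NN_natDegree (G : SimpleGraph V) (i j : V) :
    (NN G i j).natDegree ≤ if i = j then 1 else 0 := by
  unfold NN
  split_ifs
  · exact (natDegree_X_sub_C _).le
  all_goals rw [natDegree_neg, natDegree_C]

theorem prodNN_natDegree (G : SimpleGraph V) (σ : Equiv.Perm V) :
    (∏ i, NN G (σ i) i).natDegree + σ.support.card ≤ Fintype.card V := by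
  have h := natDegree_prod_le (Finset.univ) (fun i => NN G (σ i) i)
  have h2 : ∑ i, (NN G (σ i) i).natDegree ≤ ∑ i, if σ i = i then 1 else 0 :=
    Finset.sum_le_sum (fun i _ => NN_natDegree G _ _)
  have h3 : (∑ i, if σ i = i then 1 else 0) + σ.support.card = Fintype.card V := by
    rw [← Finset.card_filter, Equiv.Perm.support, Finset.card_filter_add_card_filter_not]
    rfl
  omega

theorem swapNN_coeff (G : SimpleGraph V) (x y : V) (hxy : x ≠ y) :
    (X ^ 2 * ∏ i, NN G (Equiv.swap x y i) i).coeff (Fintype.card V) =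
      if G.Adj x y then 1 else 0 := by
  have hy : y ∈ Finset.univ.erase x := by simp [hxy.symm]
  have hc : Fintype.card V = ((Finset.univ.erase x).erase y).card + 2 := by
    have h1 := Finset.card_erase_add_one (Finset.mem_univ x)
    have h2 := Finset.card_erase_add_one hy
    rw [Finset.card_univ] at h1
    omega
  rw [← Finset.mul_prod_erase _ _ (Finset.mem_univ x), ← Finset.mul_prod_erase _ _ hy]
  have : ∏ i ∈ (Finset.univ.erase x).erase y, NN G (Equiv.swap x y i) i =
      ∏ i ∈ (Finset.univ.erase x).erase y, (X - C (G.degree i : ℚ)) := by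
    refine Finset.prod_congr rfl (fun i hi => ?_)
    simp only [Finset.mem_erase, Finset.mem_univ, and_true] at hi
    rw [Equiv.swap_apply_of_ne_of_ne hi.2 hi.1, NN, if_pos rfl]
  rw [this, Equiv.swap_apply_left, Equiv.swap_apply_right]
  have e : X ^ 2 * (NN G y x * (NN G x y *
      ∏ i ∈ (Finset.univ.erase x).erase y, (X - C (G.degree i : ℚ)))) =
      C (if G.Adj x y then 1 else 0) * (X ^ 2 *
      ∏ i ∈ (Finset.univ.erase x).erase y, (X - C (G.degree i : ℚ))) := by
    unfold NN
    rw [if_neg hxy, if_neg hxy.symm, G.adj_comm y x]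
    split_ifs <;> simp
  rw [e, coeff_C_mul, hc, (prodX_coeff _ _).1, mul_one]

theorem swap_sum (f : Equiv.Perm V → ℚ) :
    2 * ∑ σ ∈ Finset.univ.filter (fun σ : Equiv.Perm V => σ.support.card = 2), f σ =
      ∑ x, ∑ y ∈ Finset.univ.erase x, f (Equiv.swap x y) := by
  have h1 : ∀ x : V, ∑ y ∈ Finset.univ.erase x, f (Equiv.swap x y) =
      ∑ σ ∈ Finset.univ.filter (fun σ : Equiv.Perm V => σ.support.card = 2),
        if x ∈ σ.support then f σ else 0 := by
    intro x
    rw [← Finset.sum_filter]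
    refine Finset.sum_bij' (fun y _ => Equiv.swap x y) (fun σ _ => σ x) ?_ ?_ ?_ ?_ ?_
    · intro y hy
      have hy : y ≠ x := by simpa using hy
      rw [Finset.mem_filter, Finset.mem_filter]
      exact ⟨⟨Finset.mem_univ _, Equiv.Perm.card_support_swap hy.symm⟩, by simp [hy]⟩
    · intro σ hσ
      simp only [Finset.mem_filter, Equiv.Perm.mem_support] at hσ
      simp [hσ.2]
    · intro y hy; simp
    · intro σ hσ
      simp only [Finset.mem_filter, Finset.mem_univ, true_and] at hσ
      obtain ⟨a, b, hab, rfl⟩ := Equiv.Perm.card_support_eq_two.1 hσ.1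
      have := hσ.2
      rw [Equiv.Perm.support_swap hab] at this
      simp only [Finset.mem_insert, Finset.mem_singleton] at this
      rcases this with rfl | rfl
      · rw [Equiv.swap_apply_left]
      · rw [Equiv.swap_apply_right, Equiv.swap_comm]
    · intro y hy; rfl
  rw [Finset.sum_congr rfl (fun x _ => h1 x), Finset.sum_comm, Finset.mul_sum]
  refine Finset.sum_congr rfl (fun σ hσ => ?_)
  rw [← Finset.sum_filter, Finset.sum_const, Finset.filter_mem_eq_inter, Finset.univ_inter,
    (Finset.mem_filter.1 hσ).2]
  simp

theorem qPerm_facts (G : SimpleGraph V) :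
    (qPermPoly G).natDegree = Fintype.card V ∧
    (X ^ 2 * qPermPoly G).coeff (Fintype.card V + 1) = - ∑ i, (G.degree i : ℚ) ∧
    2 * (X ^ 2 * qPermPoly G).coeff (Fintype.card V) =
      (∑ i, (G.degree i : ℚ)) ^ 2 - ∑ i, (G.degree i : ℚ) ^ 2 + ∑ i, (G.degree i : ℚ) := by
  have P := prodX_coeff (fun i => (G.degree i : ℚ)) Finset.univ
  have h1 : ∏ i, NN G ((1 : Equiv.Perm V) i) i = ∏ i, (X - C (G.degree i : ℚ)) := by
    refine Finset.prod_congr rfl (fun i _ => ?_)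
    rw [Equiv.Perm.one_apply, NN, if_pos rfl]
  rw [← h1, Finset.card_univ] at P
  have D : ∀ σ : Equiv.Perm V, (X ^ 2 * ∏ i, NN G (σ i) i).natDegree + σ.support.card ≤
      Fintype.card V + 2 := by
    intro σ
    have a1 := prodNN_natDegree G σ
    have a2 := natDegree_mul_le (p := X ^ 2) (q := ∏ i, NN G (σ i) i)
    rw [natDegree_X_pow] at a2
    omega
  have S2 : ∀ σ : Equiv.Perm V, σ ≠ 1 → 2 ≤ σ.support.card := fun σ h =>
    Equiv.Perm.two_le_card_support_of_ne_one h
  have E : X ^ 2 * qPermPoly G = ∑ σ : Equiv.Perm V, X ^ 2 * ∏ i, NN G (σ i) i := by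
    rw [qPerm_eq, Finset.mul_sum]
  have C1 : ∀ m, Fintype.card V < m → (X ^ 2 * qPermPoly G).coeff m =
      (X ^ 2 * ∏ i, NN G ((1 : Equiv.Perm V) i) i).coeff m := by
    intro m hm
    rw [E, finsetSum_coeff]
    refine Finset.sum_eq_single _ (fun σ _ hσ => ?_) (by simp)
    have := D σ; have := S2 σ hσ
    exact coeff_eq_zero_of_natDegree_lt (by omega)
  refine ⟨?_, ?_, ?_⟩
  · refine natDegree_eq_of_le_of_coeff_ne_zero ?_ ?_
    · rw [qPerm_eq]
      refine natDegree_sum_le_of_forall_le _ _ (fun σ _ => ?_)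
      have := prodNN_natDegree G σ
      omega
    · have := C1 (Fintype.card V + 2) (by omega)
      rw [P.1, mul_comm, coeff_mul_X_pow] at this
      rw [this]; exact one_ne_zero
  · rw [C1 _ (by omega), P.2.1]
  · rw [E, finsetSum_coeff, ← Finset.add_sum_erase _ _ (Finset.mem_univ (1 : Equiv.Perm V)),
      mul_add, P.2.2]
    congr 1
    have : ∑ σ ∈ Finset.univ.erase (1 : Equiv.Perm V),
        (X ^ 2 * ∏ i, NN G (σ i) i).coeff (Fintype.card V) =
        ∑ σ ∈ Finset.univ.filter (fun σ : Equiv.Perm V => σ.support.card = 2),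
        (X ^ 2 * ∏ i, NN G (σ i) i).coeff (Fintype.card V) := by
      symm
      refine Finset.sum_subset ?_ ?_
      · intro σ hσ
        simp only [Finset.mem_filter, Finset.mem_univ, true_and] at hσ
        simp only [Finset.mem_erase, Finset.mem_univ, and_true]
        rintro rfl
        simp at hσ
      · intro σ h1 h2
        simp only [Finset.mem_erase, Finset.mem_univ, and_true] at h1
        simp only [Finset.mem_filter, Finset.mem_univ, true_and] at h2
        have := D σ; have := S2 σ h1
        exact coeff_eq_zero_of_natDegree_lt (by omega)
    rw [this, swap_sum]
    refine Finset.sum_congr rfl (fun x _ => ?_)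
    rw [Finset.sum_congr rfl (fun y hy => swapNN_coeff G x y
      (Finset.ne_of_mem_erase hy).symm), ← Finset.sum_filter, Finset.sum_const,
      nsmul_eq_mul, mul_one]
    congr 1
    rw [← SimpleGraph.card_neighborFinset_eq_degree]
    congr 1
    ext y
    simp only [Finset.mem_filter, Finset.mem_erase, Finset.mem_univ, and_true,
      SimpleGraph.mem_neighborFinset]
    exact ⟨fun h => h.2, fun h => ⟨h.ne.symm, h⟩⟩

/-- degree in terms of `dn` -/
theorem degree_hub (G : SimpleGraph V) (x y : V) :
    G.degree x = dn G {x, y} ∅ x + (if G.Adj x y then 1 else 0) := by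
  rw [← SimpleGraph.card_neighborFinset_eq_degree]
  have : G.neighborFinset x = (Finset.univ.filter (fun u => G.Adj x u ∧ u ∉ (∅ : Finset V) ∧
      u ∉ ({x, y} : Finset V))) ∪ (if G.Adj x y then {y} else ∅) := by
    ext u
    simp only [SimpleGraph.mem_neighborFinset, Finset.mem_union, Finset.mem_filter,
      Finset.mem_univ, true_and, Finset.notMem_empty, not_false_eq_true, Finset.mem_insert,
      Finset.mem_singleton, not_or]
    by_cases h : u = y
    · subst h
      split_ifs with h2 <;> simp [h2]
    · have : u ∉ (if G.Adj x y then {y} else (∅ : Finset V)) := by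
        split_ifs <;> simp [h]
      simp only [this, or_false, h, not_false_eq_true, and_true]
      exact ⟨fun h => ⟨h, h.ne.symm⟩, fun h => h.1⟩
  rw [this, Finset.card_union_of_disjoint]
  · unfold dn
    congr 1
    split_ifs <;> simp
  · split_ifs <;> simp

theorem degree_two (G : SimpleGraph V) (u a b : V) (hab : a ≠ b)
    (h : ∀ z, G.Adj u z ↔ z = a ∨ z = b) : G.degree u = 2 := by
  rw [← SimpleGraph.card_neighborFinset_eq_degree, Finset.card_eq_two]
  refine ⟨a, b, hab, ?_⟩
  ext z
  simp [h]

theorem of_degree_two (G : SimpleGraph V) (u : V) (h : G.degree u = 2) :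
    ∃ a b, a ≠ b ∧ ∀ z, G.Adj u z ↔ z = a ∨ z = b := by
  rw [← SimpleGraph.card_neighborFinset_eq_degree, Finset.card_eq_two] at h
  obtain ⟨a, b, hab, h⟩ := h
  refine ⟨a, b, hab, fun z => ?_⟩
  rw [← SimpleGraph.mem_neighborFinset, h]
  simp

/-- A graph with all degrees `2` except two vertices of degree `3`. -/
def Bi (G : SimpleGraph V) (x y : V) : Prop :=
  x ≠ y ∧ G.degree x = 3 ∧ G.degree y = 3 ∧ ∀ u, u ≠ x → u ≠ y → G.degree u = 2

theorem bi_sums (G : SimpleGraph V) (x y : V) (h : Bi G x y) (f : ℕ → ℚ) :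
    ∑ i, f (G.degree i) = (Fintype.card V - 2) * f 2 + 2 * f 3 := by
  obtain ⟨hxy, h1, h2, h3⟩ := h
  have hy : y ∈ Finset.univ.erase x := by simp [hxy.symm]
  have hc : Fintype.card V = ((Finset.univ.erase x).erase y).card + 2 := by
    have h1 := Finset.card_erase_add_one (Finset.mem_univ x)
    have h2 := Finset.card_erase_add_one hy
    rw [Finset.card_univ] at h1
    omega
  rw [← Finset.add_sum_erase _ _ (Finset.mem_univ x), ← Finset.add_sum_erase _ _ hy, h1, h2,
    Finset.sum_congr rfl (g := fun _ => f 2), Finset.sum_const, hc, nsmul_eq_mul]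
  · push_cast; ring
  · intro u hu
    simp only [Finset.mem_erase, Finset.mem_univ, and_true] at hu
    rw [h3 u hu.2 hu.1]

theorem bi_transfer {W : Type*} [Fintype W] (G : SimpleGraph V) (H : SimpleGraph W) (x y : W)
    (h : Bi H x y) (hq : qPermPoly G = qPermPoly H) :
    Fintype.card V = Fintype.card W ∧ ∃ a b, Bi G a b := by
  obtain ⟨a1, a2, a3⟩ := qPerm_facts G
  obtain ⟨b1, b2, b3⟩ := qPerm_facts H
  have hc : Fintype.card V = Fintype.card W := by rw [← a1, ← b1, hq]
  refine ⟨hc, ?_⟩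
  rw [hq, hc] at a2 a3
  have s1 := bi_sums H x y h (fun d => (d : ℚ))
  have s2 := bi_sums H x y h (fun d => (d : ℚ) ^ 2)
  have t1 : ∑ i, (G.degree i : ℚ) = ∑ i, (H.degree i : ℚ) := by linarith
  have t2 : ∑ i, (G.degree i : ℚ) ^ 2 = ∑ i, (H.degree i : ℚ) ^ 2 := by
    rw [t1] at a3; linarith
  push_cast at s1 s2
  have z : ∑ i, ((G.degree i : ℚ) - 2) * ((G.degree i : ℚ) - 3) = 0 := by
    have : ∀ i, ((G.degree i : ℚ) - 2) * ((G.degree i : ℚ) - 3) =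
      (G.degree i : ℚ) ^ 2 - 5 * (G.degree i : ℚ) + 6 := fun i => by ring
    rw [Finset.sum_congr rfl (fun i _ => this i), Finset.sum_add_distrib, Finset.sum_sub_distrib,
      ← Finset.mul_sum, t1, t2, s1, s2, Finset.sum_const, Finset.card_univ, nsmul_eq_mul, hc]
    ring
  have nn : ∀ d : ℕ, 0 ≤ ((d : ℚ) - 2) * ((d : ℚ) - 3) := by
    intro d
    rcases Nat.lt_or_ge d 3 with h | h
    · interval_cases d <;> norm_num
    · have : (3 : ℚ) ≤ d := by exact_mod_cast h
      nlinarith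
  have z2 : ∀ i, G.degree i = 2 ∨ G.degree i = 3 := by
    intro i
    have := (Finset.sum_eq_zero_iff_of_nonneg (fun i _ => nn (G.degree i))).1 z i (Finset.mem_univ i)
    rcases mul_eq_zero.1 this with h | h
    · left; have : (G.degree i : ℚ) = 2 := by linarith
      exact_mod_cast this
    · right; have : (G.degree i : ℚ) = 3 := by linarith
      exact_mod_cast this
  have cnt : (Finset.univ.filter (fun i => G.degree i = 3)).card = 2 := by
    have e : ∀ i, (G.degree i : ℚ) = 2 + if G.degree i = 3 then 1 else 0 := by
      intro i
      rcases z2 i with h | h <;> rw [h] <;> norm_num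
    rw [Finset.sum_congr rfl (fun i _ => e i), Finset.sum_add_distrib, Finset.sum_const,
      Finset.card_univ, nsmul_eq_mul, ← Finset.sum_filter, Finset.sum_const, nsmul_eq_mul, s1, hc]
      at t1
    have : ((Finset.univ.filter (fun i => G.degree i = 3)).card : ℚ) = 2 := by linarith
    exact_mod_cast this
  obtain ⟨a, b, hab, hs⟩ := Finset.card_eq_two.1 cnt
  have hm : ∀ u, G.degree u = 3 ↔ u = a ∨ u = b := by
    intro u
    have : u ∈ Finset.univ.filter (fun i => G.degree i = 3) ↔ u ∈ ({a, b} : Finset V) := by rw [hs]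
    simpa using this
  refine ⟨a, b, hab, (hm a).2 (Or.inl rfl), (hm b).2 (Or.inr rfl), ?_⟩
  intro u h1 h2
  rcases z2 u with h | h
  · exact h
  · rcases (hm u).1 h with h | h <;> contradiction

end DegStep

section PolyStep

variable {V : Type*} [Fintype V]

/-- The transformed polynomial. -/
def HF {R : Type*} [CommRing R] (G : SimpleGraph V) (x y : V) (v : R) : R :=
  FF G v x y ∅ (1 + v - v ^ 2) (1 + v - v ^ 2)
      (if G.Adj x y then v else 0) (if G.Adj x y then v else 0)

theorem HF_map {R S : Type*} [CommRing R] [CommRing S] (f : R →+* S) (G : SimpleGraph V) (x y : V)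
    (v : R) : f (HF G x y v) = HF G x y (f v) := by
  unfold HF FF
  rw [← per_map]
  congr 1
  ext i j
  simp only [Matrix.map_apply, Mat]
  split_ifs <;> simp

theorem HF_eval (G : SimpleGraph V) (x y : V) (h : Bi G x y) (t : ℚ) (ht : t ≠ 0) :
    HF G x y t = (-t) ^ Fintype.card V * (qPermPoly G).eval (2 + t - t⁻¹) := by
  obtain ⟨hxy, h1, h2, h3⟩ := h
  unfold HF FF qPermPoly
  rw [← coe_evalRingHom, ← per_map, ← Matrix.permanent_smul]
  congr 1
  ext i j
  simp only [Matrix.smul_apply, Matrix.map_apply, Matrix.sub_apply, Matrix.diagonal_apply,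
    signlessLapMatrix, Matrix.add_apply, SimpleGraph.degMatrix, SimpleGraph.adjMatrix_apply, Mat,
    Finset.notMem_empty, or_self, if_false, smul_eq_mul, coe_evalRingHom]
  by_cases hij : i = j
  · subst hij
    have e : (-t) * ((2 + t - t⁻¹) - (G.degree i : ℚ)) = 1 - t ^ 2 + t * (G.degree i - 2 : ℚ) := by
      field_simp; ring
    have : eval (2 + t - t⁻¹) ((if i = i then X else 0) - C ((if i = i then (G.degree i : ℚ) else 0)
        + if G.Adj i i then 1 else 0)) = (2 + t - t⁻¹) - (G.degree i : ℚ) := by simp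
    rw [this, e]
    by_cases hx : i = x
    · subst hx; simp [h1]; ring
    · by_cases hy : i = y
      · subst hy; simp [h2, hx]; ring
      · simp [hx, hy, h3 i hx hy]
  · have : eval (2 + t - t⁻¹) ((if i = j then X else 0) - C ((if i = j then (G.degree i : ℚ) else 0)
        + if G.Adj i j then 1 else 0)) = if G.Adj i j then -1 else 0 := by
      split_ifs <;> simp
    rw [this]
    by_cases hx : i = x <;> by_cases hy : i = y <;> by_cases hx' : j = x <;> by_cases hy' : j = y
    all_goals simp_all [G.adj_comm]

theorem HF_transfer {W : Type*} [Fintype W] (G : SimpleGraph V) (H : SimpleGraph W) (x y : V)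
    (x' y' : W) (hG : Bi G x y) (hH : Bi H x' y') (hc : Fintype.card V = Fintype.card W)
    (hq : qPermPoly G = qPermPoly H) :
    HF G x y (X : ℤ[X]) = HF H x' y' (X : ℤ[X]) := by
  apply map_injective (Int.castRingHom ℚ) Int.cast_injective
  apply eq_of_infinite_eval_eq
  refine Set.Infinite.mono (s := {0}ᶜ) ?_ (Set.Finite.infinite_compl (Set.finite_singleton _))
  intro t ht
  have ht : t ≠ 0 := ht
  have e1 := HF_map (eval₂RingHom (Int.castRingHom ℚ) t) G x y X
  have e2 := HF_map (eval₂RingHom (Int.castRingHom ℚ) t) H x' y' X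
  simp only [coe_eval₂RingHom, eval₂_X] at e1 e2
  rw [Set.mem_setOf_eq, eval_map, eval_map, e1, e2, HF_eval G x y hG t ht, HF_eval H x' y' hH t ht,
    hc, hq]

end PolyStep

/-! Jets at 1 with respect to the Euler operator. -/

def EU (P : ℤ[X]) : ℤ[X] := X * derivative P

lemma EU_mul (P Q : ℤ[X]) : EU (P * Q) = EU P * Q + P * EU Q := by
  simp only [EU, derivative_mul]; ring
lemma EU_add (P Q : ℤ[X]) : EU (P + Q) = EU P + EU Q := by
  simp only [EU, derivative_add]; ring

def J0 (P : ℤ[X]) : ℤ := P.eval 1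
def J1 (P : ℤ[X]) : ℤ := (EU P).eval 1
def J2 (P : ℤ[X]) : ℤ := (EU (EU P)).eval 1
def J3 (P : ℤ[X]) : ℤ := (EU (EU (EU P))).eval 1

lemma EU_neg (P : ℤ[X]) : EU (-P) = - EU P := by
  simp only [EU, derivative_neg]; ring
lemma EU_sub (P Q : ℤ[X]) : EU (P - Q) = EU P - EU Q := by
  simp only [EU, derivative_sub]; ring
lemma EU_Xpow (n : ℕ) : EU (X ^ n) = (n : ℤ[X]) * X ^ n := by
  rcases n with _ | n
  · simp [EU]
  · simp only [EU, derivative_X_pow, Nat.add_sub_cancel, C_eq_natCast]; ring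
lemma EU_nat (n : ℕ) : EU (n : ℤ[X]) = 0 := by simp [EU]

lemma J0_add (P Q) : J0 (P + Q) = J0 P + J0 Q := by simp [J0]
lemma J1_add (P Q) : J1 (P + Q) = J1 P + J1 Q := by simp [J1, EU_add]
lemma J2_add (P Q) : J2 (P + Q) = J2 P + J2 Q := by simp [J2, EU_add]
lemma J3_add (P Q) : J3 (P + Q) = J3 P + J3 Q := by simp [J3, EU_add]
lemma J0_sub (P Q) : J0 (P - Q) = J0 P - J0 Q := by simp [J0]
lemma J1_sub (P Q) : J1 (P - Q) = J1 P - J1 Q := by simp [J1, EU_sub]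
lemma J2_sub (P Q) : J2 (P - Q) = J2 P - J2 Q := by simp [J2, EU_sub]
lemma J3_sub (P Q) : J3 (P - Q) = J3 P - J3 Q := by simp [J3, EU_sub]
lemma J0_neg (P) : J0 (-P) = -J0 P := by simp [J0]
lemma J1_neg (P) : J1 (-P) = -J1 P := by simp [J1, EU_neg]
lemma J2_neg (P) : J2 (-P) = -J2 P := by simp [J2, EU_neg]
lemma J3_neg (P) : J3 (-P) = -J3 P := by simp [J3, EU_neg]
lemma J0_mul (P Q) : J0 (P * Q) = J0 P * J0 Q := by simp [J0]
lemma J1_mul (P Q) : J1 (P * Q) = J1 P * J0 Q + J0 P * J1 Q := by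
  simp [J0, J1, EU_mul]
lemma J2_mul (P Q) : J2 (P * Q) = J2 P * J0 Q + 2 * (J1 P * J1 Q) + J0 P * J2 Q := by
  simp [J0, J1, J2, EU_mul, EU_add]; ring
lemma J3_mul (P Q) : J3 (P * Q) =
    J3 P * J0 Q + 3 * (J2 P * J1 Q) + 3 * (J1 P * J2 Q) + J0 P * J3 Q := by
  simp [J0, J1, J2, J3, EU_mul, EU_add]; ring
lemma J0_Xpow (n : ℕ) : J0 (X ^ n) = 1 := by simp [J0]
lemma J1_Xpow (n : ℕ) : J1 (X ^ n) = n := by simp [J1, EU_Xpow]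
lemma J2_Xpow (n : ℕ) : J2 (X ^ n) = n ^ 2 := by
  simp [J2, EU_Xpow, EU_mul, EU_nat]; ring
lemma J3_Xpow (n : ℕ) : J3 (X ^ n) = n ^ 3 := by
  simp [J3, EU_Xpow, EU_mul, EU_nat]; ring
lemma J0_X : J0 X = 1 := by simp [J0]
lemma J1_X : J1 X = 1 := by simp [J1, EU]
lemma J2_X : J2 X = 1 := by simp [J2, EU]
lemma J3_X : J3 X = 1 := by simp [J3, EU]
lemma J0_one : J0 1 = 1 := by simp [J0]
lemma J1_one : J1 1 = 0 := by simp [J1, EU]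
lemma J2_one : J2 1 = 0 := by simp [J2, EU]
lemma J3_one : J3 1 = 0 := by simp [J3, EU]
lemma J0_num (n : ℕ) [n.AtLeastTwo] : J0 (no_index (OfNat.ofNat n)) = OfNat.ofNat n := by
  simp [J0]
lemma J1_num (n : ℕ) [n.AtLeastTwo] : J1 (no_index (OfNat.ofNat n)) = 0 := by
  simp [J1, EU]
lemma J2_num (n : ℕ) [n.AtLeastTwo] : J2 (no_index (OfNat.ofNat n)) = 0 := by
  simp [J2, EU]
lemma J3_num (n : ℕ) [n.AtLeastTwo] : J3 (no_index (OfNat.ofNat n)) = 0 := by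
  simp [J3, EU]

/-- The jet of `P` at `1`, packaged. -/
def Jet (P : ℤ[X]) (p0 p1 p2 p3 : ℤ) : Prop := J0 P = p0 ∧ J1 P = p1 ∧ J2 P = p2 ∧ J3 P = p3

lemma npow_even (a : ℕ) (h : Even a) : (-X ^ 2 : ℤ[X]) ^ a = X ^ (2 * a) := by
  rw [h.neg_pow, ← pow_mul]
lemma npow_odd (a : ℕ) (h : Odd a) : (-X ^ 2 : ℤ[X]) ^ a = - X ^ (2 * a) := by
  rw [h.neg_pow, ← pow_mul]

lemma jet_PT0 (a b c : ℕ) (ha : Even a) (hb : Even b) (hc : Even c) :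
    J0 (PT X a b c) = 0 ∧ J1 (PT X a b c) = -32 * (a + b + c) ∧
    J2 (PT X a b c) = 2 * (-64 * (a + b + c) - 32 * (a^2 + b^2 + c^2) - 48 * (a*b+b*c+a*c)) ∧
    J3 (PT X a b c) = -576 * (a + b + c) - 384 * (a^2 + b^2 + c^2) - 128 * (a^3+b^3+c^3)
      - 480 * (a*b+b*c+a*c) - 240 * (a^2*b+a^2*c+b^2*a+b^2*c+c^2*a+c^2*b) - 480 * (a*b*c) := by
  unfold PT
  simp only [npow_even, ha, hb, hc]
  refine ⟨?_, ?_, ?_, ?_⟩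
  · simp [J0]; try ring
  · simp only [pow_two (1 + X : ℤ[X]), pow_two (1 - X : ℤ[X]), pow_two (1 + X ^ 2 : ℤ[X]),
      J0_add, J1_add, J0_sub, J1_sub, J0_neg, J1_neg, J0_mul, J1_mul, J0_Xpow, J1_Xpow, J0_X, J1_X,
      J0_one, J1_one, J0_num, J1_num]
    push_cast; ring
  · simp only [pow_two (1 + X : ℤ[X]), pow_two (1 - X : ℤ[X]), pow_two (1 + X ^ 2 : ℤ[X]),
      J0_add, J1_add, J0_sub, J1_sub, J0_neg, J1_neg, J0_mul, J1_mul, J0_Xpow, J1_Xpow, J0_X, J1_X,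
      J0_one, J1_one, J0_num, J1_num, J2_add, J2_sub, J2_neg, J2_mul, J2_Xpow, J2_X, J2_one, J2_num]
    push_cast; ring
  · simp only [pow_two (1 + X : ℤ[X]), pow_two (1 - X : ℤ[X]), pow_two (1 + X ^ 2 : ℤ[X]),
      J0_add, J1_add, J0_sub, J1_sub, J0_neg, J1_neg, J0_mul, J1_mul, J0_Xpow, J1_Xpow, J0_X, J1_X,
      J0_one, J1_one, J0_num, J1_num, J2_add, J2_sub, J2_neg, J2_mul, J2_Xpow, J2_X, J2_one, J2_num,
      J3_add, J3_sub, J3_neg, J3_mul, J3_Xpow, J3_X, J3_one, J3_num]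
    push_cast; ring

set_option linter.unusedSimpArgs false
lemma jet_PT1 (a b c : ℕ) (ha : Odd a) (hb : Even b) (hc : Even c) :
    J0 (PT X a b c) = (32) ∧
    J1 (PT X a b c) = (64) + (32)*(a:ℤ) ∧
    J2 (PT X a b c) = (192) + (-32)*(c:ℤ) + (-32)*(b:ℤ) + (128)*(a:ℤ) + (-16)*(c:ℤ)^2 + (-16)*(b:ℤ)^2 + (32)*(a:ℤ)*(c:ℤ) + (32)*(a:ℤ)*(b:ℤ) + (64)*(a:ℤ)^2 := by
  unfold PT
  simp only [npow_even, npow_odd, ha, hb, hc]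
  refine ⟨?_, ?_, ?_⟩
  · simp only [pow_two (1 + X : ℤ[X]), pow_two (1 - X : ℤ[X]), pow_two (1 + X ^ 2 : ℤ[X]),
      J0_add, J0_sub, J0_neg, J0_mul, J0_Xpow, J0_X, J0_one, J0_num]
    push_cast; try ring
  · simp only [pow_two (1 + X : ℤ[X]), pow_two (1 - X : ℤ[X]), pow_two (1 + X ^ 2 : ℤ[X]),
      J0_add, J0_sub, J0_neg, J0_mul, J0_Xpow, J0_X, J0_one, J0_num,
      J1_add, J1_sub, J1_neg, J1_mul, J1_Xpow, J1_X, J1_one, J1_num]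
    push_cast; try ring
  · simp only [pow_two (1 + X : ℤ[X]), pow_two (1 - X : ℤ[X]), pow_two (1 + X ^ 2 : ℤ[X]),
      J0_add, J0_sub, J0_neg, J0_mul, J0_Xpow, J0_X, J0_one, J0_num,
      J1_add, J1_sub, J1_neg, J1_mul, J1_Xpow, J1_X, J1_one, J1_num,
      J2_add, J2_sub, J2_neg, J2_mul, J2_Xpow, J2_X, J2_one, J2_num]
    push_cast; try ring

lemma jet_PT2 (a b c : ℕ) (ha : Odd a) (hb : Odd b) (hc : Even c) :
    J0 (PT X a b c) = (48) ∧
    J1 (PT X a b c) = (112) + (32)*(b:ℤ) + (32)*(a:ℤ) ∧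
    J2 (PT X a b c) = (336) + (160)*(b:ℤ) + (160)*(a:ℤ) + (-32)*(c:ℤ)^2 + (48)*(b:ℤ)^2 + (32)*(a:ℤ)*(b:ℤ) + (48)*(a:ℤ)^2 ∧
    J3 (PT X a b c) = (1120) + (-48)*(c:ℤ) + (720)*(b:ℤ) + (720)*(a:ℤ) + (-192)*(c:ℤ)^2 + (96)*(b:ℤ)*(c:ℤ) + (384)*(b:ℤ)^2 + (96)*(a:ℤ)*(c:ℤ) + (288)*(a:ℤ)*(b:ℤ) + (384)*(a:ℤ)^2 + (-96)*(c:ℤ)^3 + (-96)*(b:ℤ)*(c:ℤ)^2 + (80)*(b:ℤ)^3 + (-96)*(a:ℤ)*(c:ℤ)^2 + (-96)*(a:ℤ)*(b:ℤ)*(c:ℤ) + (48)*(a:ℤ)*(b:ℤ)^2 + (48)*(a:ℤ)^2*(b:ℤ) + (80)*(a:ℤ)^3 := by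
  unfold PT
  simp only [npow_even, npow_odd, ha, hb, hc]
  refine ⟨?_, ?_, ?_, ?_⟩
  · simp only [pow_two (1 + X : ℤ[X]), pow_two (1 - X : ℤ[X]), pow_two (1 + X ^ 2 : ℤ[X]),
      J0_add, J0_sub, J0_neg, J0_mul, J0_Xpow, J0_X, J0_one, J0_num]
    push_cast; try ring
  · simp only [pow_two (1 + X : ℤ[X]), pow_two (1 - X : ℤ[X]), pow_two (1 + X ^ 2 : ℤ[X]),
      J0_add, J0_sub, J0_neg, J0_mul, J0_Xpow, J0_X, J0_one, J0_num,
      J1_add, J1_sub, J1_neg, J1_mul, J1_Xpow, J1_X, J1_one, J1_num]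
    push_cast; try ring
  · simp only [pow_two (1 + X : ℤ[X]), pow_two (1 - X : ℤ[X]), pow_two (1 + X ^ 2 : ℤ[X]),
      J0_add, J0_sub, J0_neg, J0_mul, J0_Xpow, J0_X, J0_one, J0_num,
      J1_add, J1_sub, J1_neg, J1_mul, J1_Xpow, J1_X, J1_one, J1_num,
      J2_add, J2_sub, J2_neg, J2_mul, J2_Xpow, J2_X, J2_one, J2_num]
    push_cast; try ring
  · simp only [pow_two (1 + X : ℤ[X]), pow_two (1 - X : ℤ[X]), pow_two (1 + X ^ 2 : ℤ[X]),
      J0_add, J0_sub, J0_neg, J0_mul, J0_Xpow, J0_X, J0_one, J0_num,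
      J1_add, J1_sub, J1_neg, J1_mul, J1_Xpow, J1_X, J1_one, J1_num,
      J2_add, J2_sub, J2_neg, J2_mul, J2_Xpow, J2_X, J2_one, J2_num,
      J3_add, J3_sub, J3_neg, J3_mul, J3_Xpow, J3_X, J3_one, J3_num]
    push_cast; try ring

lemma jet_PT3 (a b c : ℕ) (ha : Odd a) (hb : Odd b) (hc : Odd c) :
    J0 (PT X a b c) = (80) ∧
    J1 (PT X a b c) = (176) + (64)*(c:ℤ) + (64)*(b:ℤ) + (64)*(a:ℤ) ∧
    J2 (PT X a b c) = (544) + (256)*(c:ℤ) + (256)*(b:ℤ) + (256)*(a:ℤ) + (96)*(c:ℤ)^2 + (128)*(b:ℤ)*(c:ℤ) + (96)*(b:ℤ)^2 + (128)*(a:ℤ)*(c:ℤ) + (128)*(a:ℤ)*(b:ℤ) + (96)*(a:ℤ)^2 ∧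
    J3 (PT X a b c) = (1808) + (1200)*(c:ℤ) + (1200)*(b:ℤ) + (1200)*(a:ℤ) + (576)*(c:ℤ)^2 + (672)*(b:ℤ)*(c:ℤ) + (576)*(b:ℤ)^2 + (672)*(a:ℤ)*(c:ℤ) + (672)*(a:ℤ)*(b:ℤ) + (576)*(a:ℤ)^2 + (160)*(c:ℤ)^3 + (288)*(b:ℤ)*(c:ℤ)^2 + (288)*(b:ℤ)^2*(c:ℤ) + (160)*(b:ℤ)^3 + (288)*(a:ℤ)*(c:ℤ)^2 + (480)*(a:ℤ)*(b:ℤ)*(c:ℤ) + (288)*(a:ℤ)*(b:ℤ)^2 + (288)*(a:ℤ)^2*(c:ℤ) + (288)*(a:ℤ)^2*(b:ℤ) + (160)*(a:ℤ)^3 := by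
  unfold PT
  simp only [npow_even, npow_odd, ha, hb, hc]
  refine ⟨?_, ?_, ?_, ?_⟩
  · simp only [pow_two (1 + X : ℤ[X]), pow_two (1 - X : ℤ[X]), pow_two (1 + X ^ 2 : ℤ[X]),
      J0_add, J0_sub, J0_neg, J0_mul, J0_Xpow, J0_X, J0_one, J0_num]
    push_cast; try ring
  · simp only [pow_two (1 + X : ℤ[X]), pow_two (1 - X : ℤ[X]), pow_two (1 + X ^ 2 : ℤ[X]),
      J0_add, J0_sub, J0_neg, J0_mul, J0_Xpow, J0_X, J0_one, J0_num,
      J1_add, J1_sub, J1_neg, J1_mul, J1_Xpow, J1_X, J1_one, J1_num]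
    push_cast; try ring
  · simp only [pow_two (1 + X : ℤ[X]), pow_two (1 - X : ℤ[X]), pow_two (1 + X ^ 2 : ℤ[X]),
      J0_add, J0_sub, J0_neg, J0_mul, J0_Xpow, J0_X, J0_one, J0_num,
      J1_add, J1_sub, J1_neg, J1_mul, J1_Xpow, J1_X, J1_one, J1_num,
      J2_add, J2_sub, J2_neg, J2_mul, J2_Xpow, J2_X, J2_one, J2_num]
    push_cast; try ring
  · simp only [pow_two (1 + X : ℤ[X]), pow_two (1 - X : ℤ[X]), pow_two (1 + X ^ 2 : ℤ[X]),
      J0_add, J0_sub, J0_neg, J0_mul, J0_Xpow, J0_X, J0_one, J0_num,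
      J1_add, J1_sub, J1_neg, J1_mul, J1_Xpow, J1_X, J1_one, J1_num,
      J2_add, J2_sub, J2_neg, J2_mul, J2_Xpow, J2_X, J2_one, J2_num,
      J3_add, J3_sub, J3_neg, J3_mul, J3_Xpow, J3_X, J3_one, J3_num]
    push_cast; try ring

lemma jet_PD1 (l m d : ℕ) (hl : Odd l) (hm : Even m) (hd : Even d) :
    J0 (PD X l m d) = (32) ∧
    J1 (PD X l m d) = (64) + (-64)*(d:ℤ) + (32)*(l:ℤ) ∧
    J2 (PD X l m d) = (192) + (-320)*(d:ℤ) + (-32)*(m:ℤ) + (128)*(l:ℤ) + (-128)*(d:ℤ)^2 + (-128)*(m:ℤ)*(d:ℤ) + (-16)*(m:ℤ)^2 + (32)*(l:ℤ)*(m:ℤ) + (64)*(l:ℤ)^2 := by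
  unfold PD UU WW
  simp only [npow_even, npow_odd, hl, hm, hd]
  refine ⟨?_, ?_, ?_⟩
  · simp only [pow_two (1 + X : ℤ[X]), pow_two (1 - X : ℤ[X]), pow_two (1 + X ^ 2 : ℤ[X]),
      J0_add, J0_sub, J0_neg, J0_mul, J0_Xpow, J0_X, J0_one, J0_num]
    push_cast; try ring
  · simp only [pow_two (1 + X : ℤ[X]), pow_two (1 - X : ℤ[X]), pow_two (1 + X ^ 2 : ℤ[X]),
      J0_add, J0_sub, J0_neg, J0_mul, J0_Xpow, J0_X, J0_one, J0_num,
      J1_add, J1_sub, J1_neg, J1_mul, J1_Xpow, J1_X, J1_one, J1_num]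
    push_cast; try ring
  · simp only [pow_two (1 + X : ℤ[X]), pow_two (1 - X : ℤ[X]), pow_two (1 + X ^ 2 : ℤ[X]),
      J0_add, J0_sub, J0_neg, J0_mul, J0_Xpow, J0_X, J0_one, J0_num,
      J1_add, J1_sub, J1_neg, J1_mul, J1_Xpow, J1_X, J1_one, J1_num,
      J2_add, J2_sub, J2_neg, J2_mul, J2_Xpow, J2_X, J2_one, J2_num]
    push_cast; try ring

lemma jet_PD2 (l m d : ℕ) (hl : Odd l) (hm : Odd m) (hd : Even d) :
    J0 (PD X l m d) = (48) ∧
    J1 (PD X l m d) = (112) + (-32)*(d:ℤ) + (32)*(m:ℤ) + (32)*(l:ℤ) ∧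
    J2 (PD X l m d) = (336) + (-192)*(d:ℤ) + (160)*(m:ℤ) + (160)*(l:ℤ) + (-64)*(d:ℤ)^2 + (48)*(m:ℤ)^2 + (32)*(l:ℤ)*(m:ℤ) + (48)*(l:ℤ)^2 ∧
    J3 (PD X l m d) = (1120) + (-912)*(d:ℤ) + (720)*(m:ℤ) + (720)*(l:ℤ) + (-576)*(d:ℤ)^2 + (-96)*(m:ℤ)*(d:ℤ) + (384)*(m:ℤ)^2 + (-96)*(l:ℤ)*(d:ℤ) + (288)*(l:ℤ)*(m:ℤ) + (384)*(l:ℤ)^2 + (-128)*(d:ℤ)^3 + (96)*(m:ℤ)^2*(d:ℤ) + (80)*(m:ℤ)^3 + (48)*(l:ℤ)*(m:ℤ)^2 + (96)*(l:ℤ)^2*(d:ℤ) + (48)*(l:ℤ)^2*(m:ℤ) + (80)*(l:ℤ)^3 := by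
  unfold PD UU WW
  simp only [npow_even, npow_odd, hl, hm, hd]
  refine ⟨?_, ?_, ?_, ?_⟩
  · simp only [pow_two (1 + X : ℤ[X]), pow_two (1 - X : ℤ[X]), pow_two (1 + X ^ 2 : ℤ[X]),
      J0_add, J0_sub, J0_neg, J0_mul, J0_Xpow, J0_X, J0_one, J0_num]
    push_cast; try ring
  · simp only [pow_two (1 + X : ℤ[X]), pow_two (1 - X : ℤ[X]), pow_two (1 + X ^ 2 : ℤ[X]),
      J0_add, J0_sub, J0_neg, J0_mul, J0_Xpow, J0_X, J0_one, J0_num,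
      J1_add, J1_sub, J1_neg, J1_mul, J1_Xpow, J1_X, J1_one, J1_num]
    push_cast; try ring
  · simp only [pow_two (1 + X : ℤ[X]), pow_two (1 - X : ℤ[X]), pow_two (1 + X ^ 2 : ℤ[X]),
      J0_add, J0_sub, J0_neg, J0_mul, J0_Xpow, J0_X, J0_one, J0_num,
      J1_add, J1_sub, J1_neg, J1_mul, J1_Xpow, J1_X, J1_one, J1_num,
      J2_add, J2_sub, J2_neg, J2_mul, J2_Xpow, J2_X, J2_one, J2_num]
    push_cast; try ring
  · simp only [pow_two (1 + X : ℤ[X]), pow_two (1 - X : ℤ[X]), pow_two (1 + X ^ 2 : ℤ[X]),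
      J0_add, J0_sub, J0_neg, J0_mul, J0_Xpow, J0_X, J0_one, J0_num,
      J1_add, J1_sub, J1_neg, J1_mul, J1_Xpow, J1_X, J1_one, J1_num,
      J2_add, J2_sub, J2_neg, J2_mul, J2_Xpow, J2_X, J2_one, J2_num,
      J3_add, J3_sub, J3_neg, J3_mul, J3_Xpow, J3_X, J3_one, J3_num]
    push_cast; try ring

lemma jet_PD3 (l m d : ℕ) (hl : Odd l) (hm : Odd m) (hd : Odd d) :
    J0 (PD X l m d) = (80) ∧
    J1 (PD X l m d) = (208) + (32)*(d:ℤ) + (32)*(m:ℤ) + (32)*(l:ℤ) := by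
  unfold PD UU WW
  simp only [npow_even, npow_odd, hl, hm, hd]
  refine ⟨?_, ?_⟩
  · simp only [pow_two (1 + X : ℤ[X]), pow_two (1 - X : ℤ[X]), pow_two (1 + X ^ 2 : ℤ[X]),
      J0_add, J0_sub, J0_neg, J0_mul, J0_Xpow, J0_X, J0_one, J0_num]
    push_cast; try ring
  · simp only [pow_two (1 + X : ℤ[X]), pow_two (1 - X : ℤ[X]), pow_two (1 + X ^ 2 : ℤ[X]),
      J0_add, J0_sub, J0_neg, J0_mul, J0_Xpow, J0_X, J0_one, J0_num,
      J1_add, J1_sub, J1_neg, J1_mul, J1_Xpow, J1_X, J1_one, J1_num]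
    push_cast; try ring

lemma jet_PD0 (l m d : ℕ) (hl : Even l) (hm : Even m) (hd : Even d) :
    J0 (PD X l m d) = 0 ∧
    J1 (PD X l m d) = (-128)*(d:ℤ) + (-32)*(m:ℤ) + (-32)*(l:ℤ) := by
  unfold PD UU WW
  simp only [npow_even, npow_odd, hl, hm, hd]
  refine ⟨?_, ?_⟩
  · simp only [pow_two (1 + X : ℤ[X]), pow_two (1 - X : ℤ[X]), pow_two (1 + X ^ 2 : ℤ[X]),
      J0_add, J0_sub, J0_neg, J0_mul, J0_Xpow, J0_X, J0_one, J0_num]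
    push_cast; try ring
  · simp only [pow_two (1 + X : ℤ[X]), pow_two (1 - X : ℤ[X]), pow_two (1 + X ^ 2 : ℤ[X]),
      J0_add, J0_sub, J0_neg, J0_mul, J0_Xpow, J0_X, J0_one, J0_num,
      J1_add, J1_sub, J1_neg, J1_mul, J1_Xpow, J1_X, J1_one, J1_num]
    push_cast; try ring

lemma jet_PD4 (l m d : ℕ) (hl : Even l) (hm : Even m) (hd : Odd d) :
    J0 (PD X l m d) = (128) := by
  unfold PD UU WW
  simp only [npow_even, npow_odd, hl, hm, hd]
  · simp only [pow_two (1 + X : ℤ[X]), pow_two (1 - X : ℤ[X]), pow_two (1 + X ^ 2 : ℤ[X]),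
      J0_add, J0_sub, J0_neg, J0_mul, J0_Xpow, J0_X, J0_one, J0_num]
    push_cast; try ring

lemma jet_PD5 (l m d : ℕ) (hl : Odd l) (hm : Even m) (hd : Odd d) :
    J0 (PD X l m d) = (96) := by
  unfold PD UU WW
  simp only [npow_even, npow_odd, hl, hm, hd]
  · simp only [pow_two (1 + X : ℤ[X]), pow_two (1 - X : ℤ[X]), pow_two (1 + X ^ 2 : ℤ[X]),
      J0_add, J0_sub, J0_neg, J0_mul, J0_Xpow, J0_X, J0_one, J0_num]
    push_cast; try ring

lemma PD_swap {R : Type*} [CommRing R] (v : R) (l m d : ℕ) : PD v l m d = PD v m l d := by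
  unfold PD; ring

/-- Multisets of size three, elementary form. -/
def Sam (a b c a' b' c' : ℕ) : Prop := ({a, b, c} : Multiset ℕ) = {a', b', c'}

lemma Sam_refl (a b c) : Sam a b c a b c := rfl
lemma Sam_swap12 (a b c) : Sam a b c b a c := by
  unfold Sam; exact Multiset.cons_swap a b {c}
lemma Sam_swap23 (a b c) : Sam a b c a c b := by
  unfold Sam; exact congrArg (Multiset.cons a) (Multiset.cons_swap b c 0)
lemma Sam_trans {a b c a' b' c' a'' b'' c''} (h : Sam a b c a' b' c')
    (h' : Sam a' b' c' a'' b'' c'') : Sam a b c a'' b'' c'' := Eq.trans h h'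
lemma Sam_symm {a b c a' b' c'} (h : Sam a b c a' b' c') : Sam a' b' c' a b c := Eq.symm h

lemma two_eq (b c b' c' : ℕ) (h1 : b + c = b' + c') (h2 : (b:ℤ) * c = b' * c') :
    (b = b' ∧ c = c') ∨ (b = c' ∧ c = b') := by
  have h1' : (b:ℤ) + c = b' + c' := by exact_mod_cast h1
  have : ((b:ℤ) - b') * (b - c') = 0 := by linear_combination (b:ℤ) * h1' - h2
  rcases mul_eq_zero.1 this with h | h
  · left; omega
  · right; omega

lemma Sam_of_sym (a b c a' b' c' : ℕ) (h1 : a + b + c = a' + b' + c')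
    (h2 : (a:ℤ)*b+b*c+a*c = a'*b'+b'*c'+a'*c') (h3 : (a:ℤ)*b*c = a'*b'*c') :
    Sam a b c a' b' c' := by
  have h1' : (a:ℤ) + b + c = a' + b' + c' := by exact_mod_cast h1
  have key : ((a:ℤ) - a') * ((a - b') * (a - c')) = 0 := by
    linear_combination (a:ℤ)^2 * h1' - (a:ℤ) * h2 + h3
  have aux : ∀ x y z : ℕ, x + y + z = a + b + c →
      (x:ℤ)*y+y*z+x*z = (a:ℤ)*b+b*c+a*c → a = x → Sam a b c x y z := by
    intro x y z e1 e2 e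
    subst e
    have e1' : (y:ℤ) + z = b + c := by omega
    rcases two_eq b c y z (by omega) (by linear_combination (a:ℤ) * e1' - e2) with ⟨rfl, rfl⟩ | ⟨rfl, rfl⟩
    · exact Sam_refl _ _ _
    · exact Sam_swap23 _ _ _
  rcases mul_eq_zero.1 key with h | h
  · exact aux a' b' c' h1.symm h2.symm (by omega)
  rcases mul_eq_zero.1 h with h | h
  · exact Sam_trans (aux b' a' c' (by omega) (by linear_combination -h2) (by omega)) (Sam_swap12 _ _ _)
  · exact Sam_trans (Sam_trans (aux c' a' b' (by omega) (by linear_combination -h2) (by omega))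
      (Sam_swap12 _ _ _)) (Sam_swap23 _ _ _)

/-- Parity types. -/
def Ty (j : ℕ) (a b c : ℕ) : Prop :=
  (j = 0 ∧ Even a ∧ Even b ∧ Even c) ∨ (j = 1 ∧ Odd a ∧ Even b ∧ Even c) ∨
  (j = 2 ∧ Odd a ∧ Odd b ∧ Even c) ∨ (j = 3 ∧ Odd a ∧ Odd b ∧ Odd c) ∨
  (j = 4 ∧ Even a ∧ Even b ∧ Odd c) ∨ (j = 5 ∧ Odd a ∧ Even b ∧ Odd c)

lemma PT_norm (a b c : ℕ) : ∃ a1 b1 c1 j, Sam a b c a1 b1 c1 ∧ a1 + b1 + c1 = a + b + c ∧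
    (1 ≤ a → 1 ≤ b → 1 ≤ c → 1 ≤ a1 ∧ 1 ≤ b1 ∧ 1 ≤ c1) ∧
    (PT X a b c : ℤ[X]) = PT X a1 b1 c1 ∧ Ty j a1 b1 c1 ∧ j < 4 := by
  have key : ∃ a1 b1 c1 j, Sam a b c a1 b1 c1 ∧ a1 + b1 + c1 = a + b + c ∧
    (1 ≤ a → 1 ≤ b → 1 ≤ c → 1 ≤ a1 ∧ 1 ≤ b1 ∧ 1 ≤ c1) ∧
    (PT X a b c : ℤ[X]) = PT X a1 b1 c1 ∧
      ((j = 0 ∧ Even a1 ∧ Even b1 ∧ Even c1) ∨ (j = 1 ∧ Odd a1 ∧ Even b1 ∧ Even c1) ∨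
      (j = 2 ∧ Odd a1 ∧ Odd b1 ∧ Even c1) ∨ (j = 3 ∧ Odd a1 ∧ Odd b1 ∧ Odd c1)) := by
    rcases Nat.even_or_odd a with ha | ha <;> rcases Nat.even_or_odd b with hb | hb <;>
      rcases Nat.even_or_odd c with hc | hc
    · exact ⟨a, b, c, 0, Sam_refl _ _ _, rfl, by omega, rfl, Or.inl ⟨rfl, ha, hb, hc⟩⟩
    · exact ⟨c, a, b, 1, Sam_trans (Sam_swap23 _ _ _) (Sam_swap12 _ _ _), by omega, by omega,
        by rw [PT_swap23, PT_swap12], Or.inr (Or.inl ⟨rfl, hc, ha, hb⟩)⟩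
    · exact ⟨b, a, c, 1, Sam_swap12 _ _ _, by omega, by omega, by rw [PT_swap12], Or.inr (Or.inl ⟨rfl, hb, ha, hc⟩)⟩
    · exact ⟨b, c, a, 2, Sam_trans (Sam_swap12 _ _ _) (Sam_swap23 _ _ _), by omega, by omega,
        by rw [PT_swap12, PT_swap23], Or.inr (Or.inr (Or.inl ⟨rfl, hb, hc, ha⟩))⟩
    · exact ⟨a, b, c, 1, Sam_refl _ _ _, rfl, by omega, rfl, Or.inr (Or.inl ⟨rfl, ha, hb, hc⟩)⟩
    · exact ⟨a, c, b, 2, Sam_swap23 _ _ _, by omega, by omega, by rw [PT_swap23], Or.inr (Or.inr (Or.inl ⟨rfl, ha, hc, hb⟩))⟩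
    · exact ⟨a, b, c, 2, Sam_refl _ _ _, rfl, by omega, rfl, Or.inr (Or.inr (Or.inl ⟨rfl, ha, hb, hc⟩))⟩
    · exact ⟨a, b, c, 3, Sam_refl _ _ _, rfl, by omega, rfl, Or.inr (Or.inr (Or.inr (⟨rfl, ha, hb, hc⟩)))⟩
  obtain ⟨a1, b1, c1, j, h1, h2, h3, h4, h5⟩ := key
  exact ⟨a1, b1, c1, j, h1, h2, h3, h4, by
    unfold Ty
    rcases h5 with h | h | h | h
    · exact Or.inl h
    · exact Or.inr (Or.inl h)
    · exact Or.inr (Or.inr (Or.inl h))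
    · exact Or.inr (Or.inr (Or.inr (Or.inl h))), by omega⟩

lemma PD_norm (l m d : ℕ) : ∃ l1 m1 j, l1 + m1 = l + m ∧
    (3 ≤ l → 3 ≤ m → 3 ≤ l1 ∧ 3 ≤ m1) ∧
    (PD X l m d : ℤ[X]) = PD X l1 m1 d ∧ Ty j l1 m1 d := by
  rcases Nat.even_or_odd l with ha | ha <;> rcases Nat.even_or_odd m with hb | hb <;>
      rcases Nat.even_or_odd d with hc | hc
  · exact ⟨l, m, 0, rfl, by omega, rfl, Or.inl ⟨rfl, ha, hb, hc⟩⟩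
  · exact ⟨l, m, 4, rfl, by omega, rfl, Or.inr (Or.inr (Or.inr (Or.inr (Or.inl ⟨rfl, ha, hb, hc⟩))))⟩
  · exact ⟨m, l, 1, by omega, by omega, PD_swap _ _ _ _, Or.inr (Or.inl ⟨rfl, hb, ha, hc⟩)⟩
  · exact ⟨m, l, 5, by omega, by omega, PD_swap _ _ _ _, Or.inr (Or.inr (Or.inr (Or.inr (Or.inr (⟨rfl, hb, ha, hc⟩)))))⟩
  · exact ⟨l, m, 1, rfl, by omega, rfl, Or.inr (Or.inl ⟨rfl, ha, hb, hc⟩)⟩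
  · exact ⟨l, m, 5, rfl, by omega, rfl, Or.inr (Or.inr (Or.inr (Or.inr (Or.inr (⟨rfl, ha, hb, hc⟩)))))⟩
  · exact ⟨l, m, 2, rfl, by omega, rfl, Or.inr (Or.inr (Or.inl ⟨rfl, ha, hb, hc⟩))⟩
  · exact ⟨l, m, 3, rfl, by omega, rfl, Or.inr (Or.inr (Or.inr (Or.inl ⟨rfl, ha, hb, hc⟩)))⟩

/-- the value at one, by type -/
def Vl (j : ℕ) : ℤ := if j = 0 then 0 else if j = 1 then 32 else if j = 2 then 48 else
  if j = 3 then 80 else if j = 4 then 128 else 96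

lemma J0_PT (j a b c) (h : Ty j a b c) (hj : j < 4) : J0 (PT X a b c) = Vl j := by
  rcases h with ⟨rfl, h1, h2, h3⟩ | ⟨rfl, h1, h2, h3⟩ | ⟨rfl, h1, h2, h3⟩ | ⟨rfl, h1, h2, h3⟩ | ⟨rfl, h1, h2, h3⟩ | ⟨rfl, h1, h2, h3⟩
  · rw [(jet_PT0 a b c h1 h2 h3).1]; rfl
  · rw [(jet_PT1 a b c h1 h2 h3).1]; rfl
  · rw [(jet_PT2 a b c h1 h2 h3).1]; rfl
  · rw [(jet_PT3 a b c h1 h2 h3).1]; rfl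
  · omega
  · omega

lemma J0_PD (j l m d) (h : Ty j l m d) : J0 (PD X l m d) = Vl j := by
  rcases h with ⟨rfl, h1, h2, h3⟩ | ⟨rfl, h1, h2, h3⟩ | ⟨rfl, h1, h2, h3⟩ | ⟨rfl, h1, h2, h3⟩ | ⟨rfl, h1, h2, h3⟩ | ⟨rfl, h1, h2, h3⟩
  · rw [(jet_PD0 l m d h1 h2 h3).1]; rfl
  · rw [(jet_PD1 l m d h1 h2 h3).1]; rfl
  · rw [(jet_PD2 l m d h1 h2 h3).1]; rfl
  · rw [(jet_PD3 l m d h1 h2 h3).1]; rfl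
  · rw [(jet_PD4 l m d h1 h2 h3)]; rfl
  · rw [(jet_PD5 l m d h1 h2 h3)]; rfl

lemma J0_Cyc (ks : List ℕ) : ks = [] ∨ 2 ≤ J0 (Cyc X ks) := by
  have h1 : ∀ ks : List ℕ, 1 ≤ J0 (Cyc X ks) ∧ (ks ≠ [] → 2 ≤ J0 (Cyc X ks)) := by
    intro ks
    induction ks with
    | nil => simp [Cyc, J0]
    | cons k ks ih =>
      have e : Cyc (X : ℤ[X]) (k :: ks) = (1 + 2 * X ^ k + (-X ^ 2) ^ k) * Cyc X ks := by
        simp [Cyc]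
      have h2 : 2 ≤ J0 ((1 : ℤ[X]) + 2 * X ^ k + (-X ^ 2) ^ k) := by
        rcases Nat.even_or_odd k with h | h
        · rw [npow_even k h]; simp [J0]
        · rw [npow_odd k h]; simp [J0]
      rw [e, J0_mul]
      have : 2 * 1 ≤ J0 ((1 : ℤ[X]) + 2 * X ^ k + (-X ^ 2) ^ k) * J0 (Cyc X ks) := by
        apply mul_le_mul h2 ih.1 (by norm_num) (by linarith)
      exact ⟨by linarith, fun _ => by linarith⟩
  by_cases h : ks = []
  · exact Or.inl h
  · exact Or.inr ((h1 ks).2 h)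

lemma Ty_lt {j a b c} (h : Ty j a b c) : j < 6 := by unfold Ty at h; omega

lemma Vl_nil (j j' : ℕ) (h : Vl j = Vl j') (hj : j < 6) (hj' : j' < 6) : j = j' := by
  unfold Vl at h; interval_cases j <;> interval_cases j' <;> simp_all

lemma Vl_cons (j j' : ℕ) (n : ℤ) (hn : 2 ≤ n) (h : Vl j = Vl j' * n) (hj : j < 4) (hj' : j' < 6) :
    j = 0 ∧ j' = 0 := by
  unfold Vl at h; interval_cases j <;> interval_cases j' <;> simp at h <;> omega

lemma arith1_nil (j a b c a' b' c' : ℕ) (h1 : Ty j a b c) (h2 : Ty j a' b' c') (hj : j < 4)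
    (hs : a + b + c = a' + b' + c') (h : (PT X a b c : ℤ[X]) = PT X a' b' c') :
    Sam a b c a' b' c' := by
  have hs' : (a:ℤ) + b + c = a' + b' + c' := by exact_mod_cast hs
  unfold Ty at h1 h2
  have hj' : j = 0 ∨ j = 1 ∨ j = 2 ∨ j = 3 := by omega
  rcases hj' with rfl | rfl | rfl | rfl
  · simp at h1 h2
    obtain ⟨x1, x2, x3⟩ := h1
    obtain ⟨y1, y2, y3⟩ := h2
    obtain ⟨-, -, p2, p3⟩ := jet_PT0 a b c x1 x2 x3
    obtain ⟨-, -, q2, q3⟩ := jet_PT0 a' b' c' y1 y2 y3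
    rw [h] at p2 p3
    have e2 : (a:ℤ)*b+b*c+a*c = a'*b'+b'*c'+a'*c' := by
      have := p2.symm.trans q2
      have hN2 : ((a:ℤ)+b+c)^2 = (a'+b'+c')^2 := by rw [hs']
      linarith
    refine Sam_of_sym _ _ _ _ _ _ hs e2 ?_
    have := p3.symm.trans q3
    have hN2 : ((a:ℤ)+b+c)^2 = (a'+b'+c')^2 := by rw [hs']
    have hN3 : ((a:ℤ)+b+c)^3 = (a'+b'+c')^3 := by rw [hs']
    have hN4 : ((a:ℤ)+b+c)*(a*b+b*c+a*c) = (a'+b'+c')*(a'*b'+b'*c'+a'*c') := by rw [hs', e2]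
    linarith
  · simp at h1 h2
    obtain ⟨x1, x2, x3⟩ := h1
    obtain ⟨y1, y2, y3⟩ := h2
    obtain ⟨-, p1, p2⟩ := jet_PT1 a b c x1 x2 x3
    obtain ⟨-, q1, q2⟩ := jet_PT1 a' b' c' y1 y2 y3
    rw [h] at p1 p2
    have e1 : a = a' := by omega
    subst e1
    have e2 : (b:ℤ) + c = b' + c' := by omega
    have := p2.symm.trans q2
    rcases two_eq b c b' c' (by omega) (by
      have hN2 : ((b:ℤ)+c)^2 = (b'+c')^2 := by rw [e2]
      have hN3 : (a:ℤ)*(b+c) = a*(b'+c') := by rw [e2]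
      linarith) with ⟨rfl, rfl⟩ | ⟨rfl, rfl⟩
    · exact Sam_refl _ _ _
    · exact Sam_swap23 _ _ _
  · simp at h1 h2
    obtain ⟨x1, x2, x3⟩ := h1
    obtain ⟨y1, y2, y3⟩ := h2
    obtain ⟨-, p1, p2, -⟩ := jet_PT2 a b c x1 x2 x3
    obtain ⟨-, q1, q2, -⟩ := jet_PT2 a' b' c' y1 y2 y3
    rw [h] at p1 p2
    have e1 : c = c' := by omega
    subst e1
    have e2 : (a:ℤ) + b = a' + b' := by omega
    have := p2.symm.trans q2
    rcases two_eq a b a' b' (by omega) (by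
      have hN2 : ((a:ℤ)+b)^2 = (a'+b')^2 := by rw [e2]
      linarith) with ⟨rfl, rfl⟩ | ⟨rfl, rfl⟩
    · exact Sam_refl _ _ _
    · exact Sam_swap12 _ _ _
  · simp at h1 h2
    obtain ⟨x1, x2, x3⟩ := h1
    obtain ⟨y1, y2, y3⟩ := h2
    obtain ⟨-, -, p2, p3⟩ := jet_PT3 a b c x1 x2 x3
    obtain ⟨-, -, q2, q3⟩ := jet_PT3 a' b' c' y1 y2 y3
    rw [h] at p2 p3
    have hN2 : ((a:ℤ)+b+c)^2 = (a'+b'+c')^2 := by rw [hs']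
    have hN3 : ((a:ℤ)+b+c)^3 = (a'+b'+c')^3 := by rw [hs']
    have e2 : (a:ℤ)*b+b*c+a*c = a'*b'+b'*c'+a'*c' := by
      have := p2.symm.trans q2
      linarith
    refine Sam_of_sym _ _ _ _ _ _ hs e2 ?_
    have := p3.symm.trans q3
    have hN4 : ((a:ℤ)+b+c)*(a*b+b*c+a*c) = (a'+b'+c')*(a'*b'+b'*c'+a'*c') := by rw [hs', e2]
    linarith

lemma PT_char2 (v : (ZMod 2)[X]) (a b c : ℕ) : PT v a b c =
    (1 + v ^ 2) * (1 + (v ^ (2 * a + 2) + v ^ (2 * b + 2) + v ^ (2 * c + 2)) +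
      (v ^ (2 * b + 2 * c) + v ^ (2 * a + 2 * c) + v ^ (2 * a + 2 * b)) +
      v ^ (2 * a + 2 * b + 2 * c + 2)) := by
  have h2 : (2 : (ZMod 2)[X]) = 0 := CharTwo.two_eq_zero
  unfold PT
  simp only [CharTwo.neg_eq, CharTwo.sub_eq_add]
  have e : ∀ n, (v ^ 2) ^ n = v ^ (2 * n) := fun n => by rw [pow_mul]
  simp only [e, pow_add]
  generalize v ^ (2 * a) = A
  generalize v ^ (2 * b) = B
  generalize v ^ (2 * c) = C
  generalize v ^ a = A'
  generalize v ^ b = B'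
  generalize v ^ c = C'
  linear_combination (v + 2 * v ^ 2 + 2 * v ^ 3 + 2 * v ^ 4 +
    A * B * C * (2 + 2 * v + 2 * v ^ 2 + v ^ 3) + v ^ 3 * (A + B + C) + v * (B * C + A * C + A * B)
    + (1 + v ^ 2) ^ 2 * ((1 + A) * (B' * C') + (1 + B) * (A' * C') + (1 + C) * (A' * B'))) * h2

lemma PD_char2 (v : (ZMod 2)[X]) (l m d : ℕ) : PD v l m d =
    (1 + v ^ 2) * ((1 + v ^ (2 * l)) * (1 + v ^ (2 * m)) * (1 + v ^ (2 * d + 2))) := by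
  have h2 : (2 : (ZMod 2)[X]) = 0 := CharTwo.two_eq_zero
  unfold PD UU WW
  simp only [CharTwo.neg_eq, CharTwo.sub_eq_add, h2, zero_mul, zero_add, add_zero]
  have e : ∀ n, (v ^ 2) ^ n = v ^ (2 * n) := fun n => by rw [pow_mul]
  simp only [e, pow_add]
  generalize v ^ (2 * l) = A
  generalize v ^ (2 * m) = B
  generalize v ^ (2 * d) = C
  linear_combination (v * (1 + A) * (1 + B) + C * v ^ 3 * (1 + A) * (1 + B)) * h2

lemma map_PT (a b c : ℕ) : (PT X a b c : ℤ[X]).map (Int.castRingHom (ZMod 2)) = PT X a b c := by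
  simp [PT, Polynomial.map_add, Polynomial.map_sub, Polynomial.map_mul, Polynomial.map_pow]
lemma map_PD (a b c : ℕ) : (PD X a b c : ℤ[X]).map (Int.castRingHom (ZMod 2)) = PD X a b c := by
  simp [PD, UU, WW, Polynomial.map_add, Polynomial.map_sub, Polynomial.map_mul, Polynomial.map_pow]

lemma arith2_mod2 (a b c l m d : ℕ) (h : (PT X a b c : ℤ[X]) = PD X l m d)
    (hd : 1 ≤ d) (ha : a ≠ d) (hb : d < b) (hc : d < c) (hl : 2 * d + 1 ≤ l) (hm : m ≠ d + 1)
    (hm0 : 1 ≤ m) (ha0 : 1 ≤ a) : False := by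
  have h := congrArg (Polynomial.map (Int.castRingHom (ZMod 2))) h
  rw [map_PT, map_PD, PT_char2, PD_char2] at h
  have hne : (1 + X ^ 2 : (ZMod 2)[X]) ≠ 0 := by
    intro h
    have := congrArg (fun p => p.coeff 0) h
    simp [coeff_X_pow] at this
  have h := mul_left_cancel₀ hne h
  have e : ((1 + X ^ (2 * l)) * (1 + X ^ (2 * m)) * (1 + X ^ (2 * d + 2)) : (ZMod 2)[X]) =
      1 + X ^ (2 * l) + X ^ (2 * m) + X ^ (2 * l + 2 * m) + X ^ (2 * d + 2) +
        X ^ (2 * l + 2 * d + 2) + X ^ (2 * m + 2 * d + 2) + X ^ (2 * l + 2 * m + 2 * d + 2) := by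
    ring
  rw [e] at h
  have h := congrArg (fun p => p.coeff (2 * d + 2)) h
  simp only [coeff_add, coeff_X_pow, coeff_one] at h
  simp only [show ¬ (2 * d + 2 = 0) by omega, show ¬ (2 * d + 2 = 2 * a + 2) by omega,
    show ¬ (2 * d + 2 = 2 * b + 2) by omega, show ¬ (2 * d + 2 = 2 * c + 2) by omega,
    show ¬ (2 * d + 2 = 2 * b + 2 * c) by omega, show ¬ (2 * d + 2 = 2 * a + 2 * b + 2 * c + 2) by omega,
    show ¬ (2 * d + 2 = 2 * l) by omega, show ¬ (2 * d + 2 = 2 * m) by omega,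
    show ¬ (2 * d + 2 = 2 * l + 2 * m) by omega, show ¬ (2 * d + 2 = 2 * l + 2 * d + 2) by omega,
    show ¬ (2 * d + 2 = 2 * m + 2 * d + 2) by omega,
    show ¬ (2 * d + 2 = 2 * l + 2 * m + 2 * d + 2) by omega, if_false] at h
  by_cases h1 : 2 * d + 2 = 2 * a + 2 * c
  · omega
  by_cases h2 : 2 * d + 2 = 2 * a + 2 * b
  · omega
  simp [h1, h2] at h

lemma arith2_nil (j a b c l m d : ℕ) (h1 : Ty j a b c) (h2 : Ty j l m d) (hj : j < 4)
    (ha : 1 ≤ a) (hb : 1 ≤ b) (hc : 1 ≤ c) (hl : 3 ≤ l) (hm : 3 ≤ m) (hd : 1 ≤ d)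
    (hs : a + b + c = l + m + d) (h : (PT X a b c : ℤ[X]) = PD X l m d) :
    False := by
  have hs' : (a:ℤ) + b + c = l + m + d := by exact_mod_cast hs
  unfold Ty at h1 h2
  have hj' : j = 0 ∨ j = 1 ∨ j = 2 ∨ j = 3 := by omega
  rcases hj' with rfl | rfl | rfl | rfl
  · simp at h1 h2
    obtain ⟨x1, x2, x3⟩ := h1
    obtain ⟨y1, y2, y3⟩ := h2
    have p1 := (jet_PT0 a b c x1 x2 x3).2.1
    have q1 := (jet_PD0 l m d y1 y2 y3).2
    rw [h] at p1
    omega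
  · simp at h1 h2
    obtain ⟨x1, x2, x3⟩ := h1
    obtain ⟨y1, y2, y3⟩ := h2
    obtain ⟨-, p1, p2⟩ := jet_PT1 a b c x1 x2 x3
    obtain ⟨-, q1, q2⟩ := jet_PD1 l m d y1 y2 y3
    rw [h] at p1 p2
    have e1 : (a:ℤ) = l - 2 * d := by omega
    have e2 : (c:ℤ) = m + 3 * d - b := by omega
    have e3 := p2.symm.trans q2
    rw [e1, e2] at e3
    have key : 2 * (((b:ℤ) - d) * (c - d)) = d * (2 - 7 * d + 10 * l) := by
      rw [e2]
      linarith
    have hpos : 0 < ((b:ℤ) - d) * (c - d) := by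
      have : 0 < (d:ℤ) * (2 - 7 * d + 10 * l) := by
        apply mul_pos <;> omega
      linarith
    have : (d:ℤ) < b ∧ (d:ℤ) < c := by
      rcases pos_and_pos_or_neg_and_neg_of_mul_pos hpos with ⟨u, w⟩ | ⟨u, w⟩ <;> constructor <;> omega
    obtain ⟨k1, k1e⟩ := x1
    obtain ⟨k2, k2e⟩ := y2
    obtain ⟨k3, k3e⟩ := y3
    exact arith2_mod2 a b c l m d h hd (by omega) (by omega) (by omega) (by omega) (by omega) (by omega) ha
  · simp at h1 h2
    obtain ⟨x1, x2, x3⟩ := h1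
    obtain ⟨y1, y2, y3⟩ := h2
    obtain ⟨-, p1, p2, p3⟩ := jet_PT2 a b c x1 x2 x3
    obtain ⟨-, q1, q2, q3⟩ := jet_PD2 l m d y1 y2 y3
    rw [h] at p1 p2 p3
    have e1 : (c:ℤ) = 2 * d := by omega
    have e2 : (b:ℤ) = l + m - d - a := by omega
    have e3 := p2.symm.trans q2
    have e4 := p3.symm.trans q3
    rw [e1, e2] at e3 e4
    have key : 12 * ((d:ℤ) * (-24 + 20 * d + 24 * (l + m) - 56 * d ^ 2 - 16 * (l + m) * d
        - 8 * (l + m) ^ 2 + 32 * (l * m))) = 0 := by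
      linear_combination 2 * e4 - (15 + 3 * (2 * d) + 6 * (l + m - d)) * e3
    have hd2 : (2:ℤ) ≤ d := by obtain ⟨k, hk⟩ := y3; omega
    have : (-24 + 20 * d + 24 * (l + m) - 56 * d ^ 2 - 16 * (l + m) * d
        - 8 * (l + m) ^ 2 + 32 * (l * m) : ℤ) = 0 := by
      rcases mul_eq_zero.1 ((mul_eq_zero.1 key).resolve_left (by norm_num)) with h | h
      · omega
      · exact h
    have hsd : (2:ℤ) * (l + m) ≤ d * (l + m) := mul_le_mul_of_nonneg_right hd2 (by positivity)
    have hdd : (2:ℤ) * d ≤ d * d := mul_le_mul_of_nonneg_right hd2 (by positivity)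
    have hlm := sq_nonneg ((l:ℤ) - m)
    clear key e3 e4 p1 p2 p3 q1 q2 q3
    have hl' : (0:ℤ) ≤ l := by positivity
    have hm' : (0:ℤ) ≤ m := by positivity
    linarith
  · simp at h1 h2
    obtain ⟨x1, x2, x3⟩ := h1
    obtain ⟨y1, y2, y3⟩ := h2
    have p1 := (jet_PT3 a b c x1 x2 x3).2.1
    have q1 := (jet_PD3 l m d y1 y2 y3).2
    rw [h] at p1
    omega

lemma Cyc_low (t : ℕ) (ht : 1 ≤ t) (ks : List ℕ) (h3 : ∀ k ∈ ks, 3 ≤ k) (h2 : ∀ k ∈ ks, 2 * t ≤ k) :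
    ∃ N R : ℤ[X], Cyc (X : ℤ[X]) ks = 1 + 2 * X ^ (2 * t) * N + X ^ (2 * t + 4) * R ∧
      (∀ i, 0 ≤ N.coeff i) ∧ ((∃ k ∈ ks, k / 2 = t) → 1 ≤ N.coeff 0 + N.coeff 1) ∧
      (t = 1 → ∃ M, N = X * M) := by
  induction ks with
  | nil => exact ⟨0, 0, by simp [Cyc], by simp, by simp, fun _ => ⟨0, by simp⟩⟩
  | cons k ks ih =>
    obtain ⟨N, R, e, hN, hc, hM⟩ := ih (fun k hk => h3 k (by simp [hk])) (fun k hk => h2 k (by simp [hk]))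
    have hk3 := h3 k (by simp)
    have hk2 := h2 k (by simp)
    obtain ⟨s, rfl⟩ := Nat.exists_eq_add_of_le hk2
    have e' : Cyc (X : ℤ[X]) ((2 * t + s) :: ks) =
        (1 + 2 * X ^ (2 * t + s) + (-X ^ 2) ^ (2 * t + s)) * Cyc X ks := by
      simp [Cyc]
    have d1 : (X : ℤ[X]) ^ (2 * t + 4) ∣ (-X ^ 2) ^ (2 * t + s) := by
      rw [neg_pow, ← pow_mul]
      exact Dvd.dvd.mul_left (pow_dvd_pow _ (by omega)) _
    have d2 : (X : ℤ[X]) ^ (2 * t + 4) ∣ X ^ (2 * t + s) * X ^ (2 * t) * N := by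
      by_cases h : t = 1
      · obtain ⟨M, rfl⟩ := hM h
        have : (X : ℤ[X]) ^ (2 * t + s) * X ^ (2 * t) * (X * M) = X ^ (4 * t + s + 1) * M := by ring
        rw [this]
        exact Dvd.dvd.mul_right (pow_dvd_pow _ (by omega)) _
      · rw [← pow_add]
        exact Dvd.dvd.mul_right (pow_dvd_pow _ (by omega)) _
    obtain ⟨E, hE⟩ := d1
    obtain ⟨F, hF⟩ := d2
    refine ⟨N + X ^ s, E * (1 + 2 * X ^ (2 * t) * N) + 4 * F +
      (1 + 2 * X ^ (2 * t + s) + (-X ^ 2) ^ (2 * t + s)) * R, ?_, ?_, ?_, ?_⟩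
    · rw [e', e]
      have : (X : ℤ[X]) ^ (2 * t + s) = X ^ (2 * t) * X ^ s := by ring
      linear_combination (1 + 2 * X ^ (2 * t) * N) * hE + 4 * hF + 2 * this
    · intro i
      rw [coeff_add, coeff_X_pow]
      have := hN i
      split_ifs <;> omega
    · rintro ⟨k', hk', hk''⟩
      have n0 := hN 0
      have n1 := hN 1
      rw [coeff_add, coeff_add, coeff_X_pow, coeff_X_pow]
      rcases List.mem_cons.1 hk' with rfl | hk'
      · have : s = 0 ∨ s = 1 := by omega
        rcases this with rfl | rfl <;> simp <;> omega
      · have := hc ⟨k', hk', hk''⟩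
        split_ifs <;> omega
    · intro h
      obtain ⟨M, rfl⟩ := hM h
      obtain ⟨s', rfl⟩ : ∃ s', s = s' + 1 := ⟨s - 1, by omega⟩
      exact ⟨M + X ^ s', by ring⟩

lemma PT_low (a b c : ℕ) (ha : 2 ≤ a) (hb : 2 ≤ b) (hc : 2 ≤ c) :
    ∃ S : ℤ[X], PT X a b c = (1 + 2 * X + 5 * X ^ 2 + 4 * X ^ 3) + X ^ 4 * S := by
  obtain ⟨a, rfl⟩ := Nat.exists_eq_add_of_le ha
  obtain ⟨b, rfl⟩ := Nat.exists_eq_add_of_le hb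
  obtain ⟨c, rfl⟩ := Nat.exists_eq_add_of_le hc
  unfold PT
  simp only [pow_add]
  generalize (-X ^ 2 : ℤ[X]) ^ a = A
  generalize (-X ^ 2 : ℤ[X]) ^ b = B
  generalize (-X ^ 2 : ℤ[X]) ^ c = C
  generalize (X : ℤ[X]) ^ a = A'
  generalize (X : ℤ[X]) ^ b = B'
  generalize (X : ℤ[X]) ^ c = C'
  refine ⟨4 + X^8*A*B*C*(-4+4*X-5*X^2+2*X^3-X^4) - X^2*(1+X)^2*(A+B+C)
    + (1-X)^2*X^4*(B*C+A*C+A*B) + 2*(1+X^2)^2*((1-X^4*A)*(B'*C')+(1-X^4*B)*(A'*C')+(1-X^4*C)*(A'*B')), ?_⟩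
  ring

lemma PD_low (l m d : ℕ) (ha : 4 ≤ l) (hb : 4 ≤ m) (hc : 2 ≤ d) :
    ∃ S : ℤ[X], PD X l m d = (1 + 2 * X + 5 * X ^ 2 + 4 * X ^ 3) + X ^ 4 * S := by
  obtain ⟨l, rfl⟩ := Nat.exists_eq_add_of_le ha
  obtain ⟨m, rfl⟩ := Nat.exists_eq_add_of_le hb
  obtain ⟨d, rfl⟩ := Nat.exists_eq_add_of_le hc
  unfold PD
  have hU : ∀ l, ∃ u : ℤ[X], UU X (4 + l) = 1 + X + 2 * X ^ 2 + X ^ 4 * u := by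
    intro l
    refine ⟨2 * (1 + X ^ 2) * X ^ l + (1 - X) * X ^ 4 * (-X ^ 2) ^ l, ?_⟩
    unfold UU; simp only [pow_add]; ring
  obtain ⟨u, hu⟩ := hU l
  obtain ⟨w, hw⟩ := hU m
  rw [hu, hw]
  refine ⟨4 + (1 + X + 2 * X ^ 2) * (u + w) + X ^ 4 * u * w - (-X ^ 2) ^ d * (WW X (4 + l) * WW X (4 + m)), ?_⟩
  rw [pow_add]
  ring

lemma PT_odd (a b c i : ℕ) (ha : Even a) (hb : Even b) (hc : Even c) :
    (PT X a b c : ℤ[X]).coeff (2 * i + 1) = 2 * (if i = 0 then 1 else 0) + 4 * (if i = 1 then 1 else 0)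
      - 2 * ((if i = a + 1 then 1 else 0) + (if i = b + 1 then 1 else 0) + (if i = c + 1 then 1 else 0))
      - 2 * ((if i = b + c then 1 else 0) + (if i = a + c then 1 else 0) + (if i = a + b then 1 else 0))
      + 4 * (if i = a + b + c then 1 else 0) + 2 * (if i = a + b + c + 1 then 1 else 0) := by
  obtain ⟨α, hα⟩ := ha
  obtain ⟨β, hβ⟩ := hb
  obtain ⟨γ, hγ⟩ := hc
  have e : (PT X a b c : ℤ[X]) = expand ℤ 2 ((1 + 5 * X + 4 * X ^ 2) + X ^ a * X ^ b * X ^ c * (-4 - 5 * X - X ^ 2)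
        - X * (1 + X) * (X ^ a + X ^ b + X ^ c) + (1 + X) * (X ^ b * X ^ c + X ^ a * X ^ c + X ^ a * X ^ b)
        + 2 * (1 + X) ^ 2 * ((1 - X ^ a) * (X ^ β * X ^ γ) + (1 - X ^ b) * (X ^ α * X ^ γ)
          + (1 - X ^ c) * (X ^ α * X ^ β)))
      + X * expand ℤ 2 (C 2 * X ^ 0 + C 4 * X ^ 1 - C 2 * (X ^ (a + 1) + X ^ (b + 1) + X ^ (c + 1))
        - C 2 * (X ^ (b + c) + X ^ (a + c) + X ^ (a + b)) + C 4 * X ^ (a + b + c) + C 2 * X ^ (a + b + c + 1)) := by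
    unfold PT
    rw [npow_even a ⟨α, hα⟩, npow_even b ⟨β, hβ⟩, npow_even c ⟨γ, hγ⟩]
    simp only [map_add, map_sub, map_mul, map_pow, expand_X, expand_C, map_one, map_neg, map_ofNat]
    have f : ∀ n, (X : ℤ[X]) ^ (2 * n) = (X ^ 2) ^ n := fun n => by rw [pow_mul]
    have ea : (X : ℤ[X]) ^ a = (X ^ 2) ^ α := by rw [hα, ← pow_mul]; congr 1; omega
    have eb : (X : ℤ[X]) ^ b = (X ^ 2) ^ β := by rw [hβ, ← pow_mul]; congr 1; omega
    have ec : (X : ℤ[X]) ^ c = (X ^ 2) ^ γ := by rw [hγ, ← pow_mul]; congr 1; omega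
    rw [f, f, f, ea, eb, ec]
    simp only [pow_add]
    generalize ((X : ℤ[X]) ^ 2) ^ a = A
    generalize ((X : ℤ[X]) ^ 2) ^ b = B
    generalize ((X : ℤ[X]) ^ 2) ^ c = C
    generalize ((X : ℤ[X]) ^ 2) ^ α = A'
    generalize ((X : ℤ[X]) ^ 2) ^ β = B'
    generalize ((X : ℤ[X]) ^ 2) ^ γ = C'
    ring
  rw [e, coeff_add, coeff_X_mul, coeff_expand (by norm_num), if_neg (by omega), mul_comm 2 i,
    coeff_expand_mul (by norm_num)]
  simp only [coeff_add, coeff_sub, coeff_C_mul, coeff_X_pow]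
  ring

lemma PT_odd_nonpos (a b c i : ℕ) (ha : Even a) (hb : Even b) (hc : Even c) (h2 : 2 ≤ i)
    (hN : i < a + b + c) : (PT X a b c : ℤ[X]).coeff (2 * i + 1) ≤ 0 := by
  rw [PT_odd a b c i ha hb hc, if_neg (show ¬ i = 0 by omega), if_neg (show ¬ i = 1 by omega),
    if_neg (show ¬ i = a + b + c by omega), if_neg (show ¬ i = a + b + c + 1 by omega)]
  have nn : ∀ (p : Prop) [Decidable p], (0:ℤ) ≤ if p then 1 else 0 := by
    intro p _; split_ifs <;> norm_num
  have h1 := nn (i = a + 1)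
  have h2 := nn (i = b + 1)
  have h3 := nn (i = c + 1)
  have h4 := nn (i = b + c)
  have h5 := nn (i = a + c)
  have h6 := nn (i = a + b)
  linarith

lemma PT_odd_ge (a b c i : ℕ) (ha : Even a) (hb : Even b) (hc : Even c) :
    -6 ≤ (PT X a b c : ℤ[X]).coeff (2 * i + 1) := by
  rw [PT_odd a b c i ha hb hc]
  have nn : ∀ (p : Prop) [Decidable p], ((0:ℤ) ≤ if p then 1 else 0) ∧ ((if p then 1 else 0) ≤ (1:ℤ)) := by
    intro p _; split_ifs <;> norm_num
  have h1 := nn (i = a + 1)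
  have h2 := nn (i = b + 1)
  have h3 := nn (i = c + 1)
  have h4 := nn (i = b + c)
  have h5 := nn (i = a + c)
  have h6 := nn (i = a + b)
  have h7 := nn (i = 0)
  have h8 := nn (i = 1)
  have h9 := nn (i = a + b + c)
  have h10 := nn (i = a + b + c + 1)
  obtain ⟨α, hα⟩ := ha
  obtain ⟨β, hβ⟩ := hb
  obtain ⟨γ, hγ⟩ := hc
  rcases Nat.even_or_odd i with ⟨s, hs⟩ | ⟨s, hs⟩
  · rw [if_neg (show ¬ i = a + 1 by omega), if_neg (show ¬ i = b + 1 by omega),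
      if_neg (show ¬ i = c + 1 by omega)]
    linarith
  · rw [if_neg (show ¬ i = b + c by omega), if_neg (show ¬ i = a + c by omega),
      if_neg (show ¬ i = a + b by omega)]
    linarith

lemma coeff3 (P S N : ℤ[X]) (h : P = (1 + 2 * X + 5 * X ^ 2 + 4 * X ^ 3) + X ^ 4 * S) :
    (P * N).coeff 1 = N.coeff 1 + 2 * N.coeff 0 ∧
    (P * N).coeff 3 = N.coeff 3 + 2 * N.coeff 2 + 5 * N.coeff 1 + 4 * N.coeff 0 := by
  have e : P * N = N + C 2 * (N * X) + C 5 * (N * X ^ 2) + C 4 * (N * X ^ 3) + (S * N) * X ^ 4 := by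
    rw [h]; simp only [map_ofNat]; ring
  rw [e]
  simp [coeff_mul_X_pow', coeff_mul_X]

lemma coeff_Cyc (P S Cy N R : ℤ[X]) (t : ℕ) (h : P = (1 + 2 * X + 5 * X ^ 2 + 4 * X ^ 3) + X ^ 4 * S)
    (hC : Cy = 1 + 2 * X ^ (2 * t) * N + X ^ (2 * t + 4) * R) :
    (P * Cy).coeff (2 * t + 1) = P.coeff (2 * t + 1) + 2 * (N.coeff 1 + 2 * N.coeff 0) ∧
    (P * Cy).coeff (2 * (t + 1) + 1) = P.coeff (2 * (t + 1) + 1) +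
      2 * (N.coeff 3 + 2 * N.coeff 2 + 5 * N.coeff 1 + 4 * N.coeff 0) := by
  have e : P * Cy = P + C 2 * ((P * N) * X ^ (2 * t)) + (P * R) * X ^ (2 * t + 4) := by
    rw [hC]; simp only [map_ofNat]; ring
  obtain ⟨e1, e3⟩ := coeff3 P S N h
  rw [e]
  constructor
  · rw [coeff_add, coeff_add, coeff_C_mul, coeff_mul_X_pow', coeff_mul_X_pow', if_pos (by omega),
      if_neg (by omega), show 2 * t + 1 - 2 * t = 1 by omega, e1, add_zero]
  · rw [coeff_add, coeff_add, coeff_C_mul, coeff_mul_X_pow', coeff_mul_X_pow', if_pos (by omega),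
      if_neg (by omega), show 2 * (t + 1) + 1 - 2 * t = 3 by omega, e3, add_zero]

lemma list_min (ks : List ℕ) (h : ks ≠ []) : ∃ k ∈ ks, ∀ k' ∈ ks, k ≤ k' := by
  obtain ⟨k, hk, hm⟩ := ks.toFinset.exists_min_image id (by
    obtain ⟨x, hx⟩ := List.exists_mem_of_ne_nil ks h
    exact ⟨x, by simpa using hx⟩)
  exact ⟨k, by simpa using hk, fun k' hk' => hm k' (by simpa using hk')⟩

lemma arith1_cons (a b c a' b' c' : ℕ) (ks : List ℕ) (hks : ks ≠ []) (h3 : ∀ k ∈ ks, 3 ≤ k)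
    (h1 : Even a ∧ Even b ∧ Even c) (h2 : Even a' ∧ Even b' ∧ Even c')
    (p : 1 ≤ a' ∧ 1 ≤ b' ∧ 1 ≤ c')
    (hs : a + b + c = a' + b' + c' + ks.sum) (h : (PT X a b c : ℤ[X]) = PT X a' b' c' * Cyc X ks) :
    False := by
  obtain ⟨k, hk, hmin⟩ := list_min ks hks
  have hk3 := h3 k hk
  obtain ⟨N, R, eC, hN, hc, -⟩ := Cyc_low (k / 2) (by omega) ks h3 (fun k' hk' => by
    have := hmin k' hk'; omega)
  obtain ⟨S, hS⟩ := PT_low a' b' c' (by obtain ⟨x, hx⟩ := h2.1; omega)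
    (by obtain ⟨x, hx⟩ := h2.2.1; omega) (by obtain ⟨x, hx⟩ := h2.2.2; omega)
  have e3 := (coeff_Cyc _ S _ N R _ hS eC).2
  rw [← h] at e3
  have hsum : k ≤ ks.sum := List.le_sum_of_mem hk
  have u := PT_odd_nonpos a b c (k / 2 + 1) h1.1 h1.2.1 h1.2.2 (by omega) (by omega)
  have w := PT_odd_ge a' b' c' (k / 2 + 1) h2.1 h2.2.1 h2.2.2
  have := hc ⟨k, hk, rfl⟩
  have := hN 0
  have := hN 1
  have := hN 2
  have := hN 3
  omega

lemma PD_odd (l m d t : ℕ) (hl : Even l) (hm : Even m) (hd : Even d) (hl4 : 4 ≤ l) (hm4 : 4 ≤ m)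
    (hd2 : 2 ≤ d) (ht : 1 ≤ t) (htl : 2 * t ≤ l) (htm : 2 * t ≤ m) :
    (PD X l m d : ℤ[X]).coeff (2 * t + 1) = 4 * (if t = 1 then 1 else 0) + 2 * (if 2 * t = l then 1 else 0)
      + 2 * (if 2 * t = m then 1 else 0) - 2 * (if t = d + 1 then 1 else 0) ∧
    (PD X l m d : ℤ[X]).coeff (2 * (t + 1) + 1) =
      2 * ((if 2 * t = l then 1 else 0) + (if 2 * t + 2 = l then 1 else 0))
      + 2 * ((if 2 * t = m then 1 else 0) + (if 2 * t + 2 = m then 1 else 0))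
      - 2 * (if t = d then 1 else 0) := by
  have e : ∃ R : ℤ[X], PD X l m d = (1 + 2 * X + 5 * X ^ 2 + 4 * X ^ 3 + 4 * X ^ 4)
      + 2 * (1 + X + 3 * X ^ 2 + X ^ 3 + 2 * X ^ 4) * (X ^ l + X ^ m)
      - X ^ (2 * d + 2) * (1 + 2 * X + X ^ 2) + R * X ^ (2 * t + 4) := by
    have hU : ∀ l, 4 ≤ l → Even l → 2 * t ≤ l → (∃ u : ℤ[X], UU X l = 1 + X + 2 * X ^ 2 + 2 * (1 + X ^ 2) * X ^ l +
        u * X ^ (2 * t + 4)) ∧ (∃ u : ℤ[X], WW X l = X + X ^ 2 + X ^ (2 * t) * u) := by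
      intro l h4 he hl
      obtain ⟨s, rfl⟩ := Nat.exists_eq_add_of_le hl
      unfold UU WW
      rw [npow_even _ he]
      constructor
      · have : (X : ℤ[X]) ^ (2 * (2 * t + s)) = X ^ (2 * (2 * t + s) - (2 * t + 4)) * X ^ (2 * t + 4) := by
          rw [← pow_add]; congr 1; omega
        exact ⟨(1 - X) * X ^ (2 * (2 * t + s) - (2 * t + 4)), by rw [this]; ring⟩
      · exact ⟨2 * (1 + X ^ 2) * X ^ s + (2 - X + X ^ 2) * X ^ (2 * t + 2 * s), by ring⟩
    obtain ⟨⟨u1, hu1⟩, ⟨w1, hw1⟩⟩ := hU l hl4 hl htl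
    obtain ⟨⟨u2, hu2⟩, ⟨w2, hw2⟩⟩ := hU m hm4 hm htm
    have hLM : (X : ℤ[X]) ^ l * X ^ m = X ^ (l + m - (2 * t + 4)) * X ^ (2 * t + 4) := by
      rw [← pow_add, ← pow_add]; congr 1; omega
    have hD : (X : ℤ[X]) ^ (2 * d) * X ^ (2 * t) = X ^ (2 * d - 4) * X ^ (2 * t + 4) := by
      rw [← pow_add, ← pow_add]; congr 1; omega
    unfold PD
    rw [hu1, hu2, hw1, hw2, npow_even d hd]
    refine ⟨4 * (1 + X ^ 2) ^ 2 * X ^ (l + m - (2 * t + 4)) +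
      u1 * (1 + X + 2 * X ^ 2 + 2 * (1 + X ^ 2) * X ^ m + u2 * X ^ (2 * t + 4)) +
      u2 * (1 + X + 2 * X ^ 2 + 2 * (1 + X ^ 2) * X ^ l) -
      X ^ (2 * d - 4) * ((X + X ^ 2) * (w1 + w2) + X ^ (2 * t) * w1 * w2), ?_⟩
    linear_combination (4 * (1 + X ^ 2) ^ 2) * hLM - ((X + X ^ 2) * (w1 + w2) + X ^ (2 * t) * w1 * w2) * hD
  obtain ⟨R, e⟩ := e
  have e' : (PD X l m d : ℤ[X]) = C 1 + C 2 * X ^ 1 + C 5 * X ^ 2 + C 4 * X ^ 3 + C 4 * X ^ 4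
      + C 2 * (X ^ l + X ^ (l + 1) + C 3 * X ^ (l + 2) + X ^ (l + 3) + C 2 * X ^ (l + 4))
      + C 2 * (X ^ m + X ^ (m + 1) + C 3 * X ^ (m + 2) + X ^ (m + 3) + C 2 * X ^ (m + 4))
      - (X ^ (2 * d + 2) + C 2 * X ^ (2 * d + 3) + X ^ (2 * d + 4)) + R * X ^ (2 * t + 4) := by
    rw [e]; simp only [map_ofNat, map_one]; ring
  obtain ⟨x, hx⟩ := hl
  obtain ⟨y, hy⟩ := hm
  obtain ⟨z, hz⟩ := hd
  rw [e']
  simp only [coeff_add, coeff_sub, coeff_C_mul, coeff_X_pow, coeff_C]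
  constructor
  · rw [coeff_mul_X_pow', if_neg (show ¬ (2 * t + 4 ≤ 2 * t + 1) by omega)]
    simp only [show (2 * t + 1 = 0) = False from eq_false (by omega),
      show (2 * t + 1 = 1) = False from eq_false (by omega),
      show (2 * t + 1 = 2) = False from eq_false (by omega),
      show (2 * t + 1 = 4) = False from eq_false (by omega),
      show (2 * t + 1 = l) = False from eq_false (by omega),
      show (2 * t + 1 = l + 2) = False from eq_false (by omega),
      show (2 * t + 1 = l + 3) = False from eq_false (by omega),
      show (2 * t + 1 = l + 4) = False from eq_false (by omega),
      show (2 * t + 1 = m) = False from eq_false (by omega),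
      show (2 * t + 1 = m + 2) = False from eq_false (by omega),
      show (2 * t + 1 = m + 3) = False from eq_false (by omega),
      show (2 * t + 1 = m + 4) = False from eq_false (by omega),
      show (2 * t + 1 = 2 * d + 2) = False from eq_false (by omega),
      show (2 * t + 1 = 2 * d + 4) = False from eq_false (by omega),
      show (2 * t + 1 = 3) = (t = 1) from propext (by omega),
      show (2 * t + 1 = l + 1) = (2 * t = l) from propext (by omega),
      show (2 * t + 1 = m + 1) = (2 * t = m) from propext (by omega),
      show (2 * t + 1 = 2 * d + 3) = (t = d + 1) from propext (by omega), if_false]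
    ring
  · rw [coeff_mul_X_pow', if_neg (show ¬ (2 * t + 4 ≤ 2 * (t + 1) + 1) by omega)]
    simp only [show (2 * (t + 1) + 1 = 0) = False from eq_false (by omega),
      show (2 * (t + 1) + 1 = 1) = False from eq_false (by omega),
      show (2 * (t + 1) + 1 = 2) = False from eq_false (by omega),
      show (2 * (t + 1) + 1 = 3) = False from eq_false (by omega),
      show (2 * (t + 1) + 1 = 4) = False from eq_false (by omega),
      show (2 * (t + 1) + 1 = l) = False from eq_false (by omega),
      show (2 * (t + 1) + 1 = l + 2) = False from eq_false (by omega),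
      show (2 * (t + 1) + 1 = l + 4) = False from eq_false (by omega),
      show (2 * (t + 1) + 1 = m) = False from eq_false (by omega),
      show (2 * (t + 1) + 1 = m + 2) = False from eq_false (by omega),
      show (2 * (t + 1) + 1 = m + 4) = False from eq_false (by omega),
      show (2 * (t + 1) + 1 = 2 * d + 2) = False from eq_false (by omega),
      show (2 * (t + 1) + 1 = 2 * d + 4) = False from eq_false (by omega),
      show (2 * (t + 1) + 1 = l + 3) = (2 * t = l) from propext (by omega),
      show (2 * (t + 1) + 1 = m + 3) = (2 * t = m) from propext (by omega),
      show (2 * (t + 1) + 1 = l + 1) = (2 * t + 2 = l) from propext (by omega),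
      show (2 * (t + 1) + 1 = m + 1) = (2 * t + 2 = m) from propext (by omega),
      show (2 * (t + 1) + 1 = 2 * d + 3) = (t = d) from propext (by omega), if_false]
    ring

lemma arith2_cons (a b c l m d : ℕ) (ks : List ℕ) (h3 : ∀ k ∈ ks, 3 ≤ k)
    (h1 : Even a ∧ Even b ∧ Even c) (h2 : Even l ∧ Even m ∧ Even d)
    (p : 1 ≤ a ∧ 1 ≤ b ∧ 1 ≤ c) (hl : 3 ≤ l) (hm : 3 ≤ m) (hd : 1 ≤ d)
    (hs : a + b + c = l + m + d + ks.sum) (h : (PT X a b c : ℤ[X]) = PD X l m d * Cyc X ks) :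
    False := by
  have hl4 : 4 ≤ l := by obtain ⟨x, hx⟩ := h2.1; omega
  have hm4 : 4 ≤ m := by obtain ⟨x, hx⟩ := h2.2.1; omega
  have hd2 : 2 ≤ d := by obtain ⟨x, hx⟩ := h2.2.2; omega
  have ha2 : 2 ≤ a := by obtain ⟨x, hx⟩ := h1.1; omega
  have hb2 : 2 ≤ b := by obtain ⟨x, hx⟩ := h1.2.1; omega
  have hc2 : 2 ≤ c := by obtain ⟨x, hx⟩ := h1.2.2; omega
  obtain ⟨k, hk, hmin⟩ := list_min (l :: m :: ks) (by simp)
  have hkl := hmin l (by simp)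
  have hkm := hmin m (by simp)
  have hk3 : 3 ≤ k := by
    rcases List.mem_cons.1 hk with rfl | hk
    · exact hl
    rcases List.mem_cons.1 hk with rfl | hk
    · exact hm
    · exact h3 k hk
  obtain ⟨t, ht⟩ : ∃ t, k / 2 = t := ⟨_, rfl⟩
  obtain ⟨N, R, eC, hN, hc, -⟩ := Cyc_low t (by omega) ks h3 (fun k' hk' => by
    have := hmin k' (by simp [hk']); omega)
  obtain ⟨S, hS⟩ := PD_low l m d hl4 hm4 hd2
  obtain ⟨e1, e3⟩ := coeff_Cyc _ S _ N R _ hS eC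
  rw [← h] at e1 e3
  obtain ⟨f1, f3⟩ := PD_odd l m d t h2.1 h2.2.1 h2.2.2 hl4 hm4 hd2 (by omega) (by omega) (by omega)
  rw [f1] at e1
  rw [f3] at e3
  have u3 := PT_odd_nonpos a b c (t + 1) h1.1 h1.2.1 h1.2.2 (by omega) (by omega)
  have u1 : (PT X a b c : ℤ[X]).coeff (2 * t + 1) ≤ 4 * (if t = 1 then 1 else 0) := by
    by_cases h : t = 1
    · rw [PT_odd a b c t h1.1 h1.2.1 h1.2.2]
      simp only [show (t = 0) = False from eq_false (by omega), show (t = a + 1) = False from eq_false (by omega),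
        show (t = b + 1) = False from eq_false (by omega), show (t = c + 1) = False from eq_false (by omega),
        show (t = b + c) = False from eq_false (by omega), show (t = a + c) = False from eq_false (by omega),
        show (t = a + b) = False from eq_false (by omega), show (t = a + b + c) = False from eq_false (by omega),
        show (t = a + b + c + 1) = False from eq_false (by omega), if_false]
      omega
    · rw [if_neg h]
      exact PT_odd_nonpos a b c t h1.1 h1.2.1 h1.2.2 (by omega) (by omega)
  have n0 := hN 0
  have n1 := hN 1
  have n2 := hN 2
  have n3 := hN 3
  have nn : ∀ (p : Prop) [Decidable p], (0:ℤ) ≤ if p then 1 else 0 := by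
    intro p _; split_ifs <;> norm_num
  have key : 1 ≤ (if 2 * t = l then (1:ℤ) else 0) + (if 2 * t = m then 1 else 0) + N.coeff 0 + N.coeff 1 := by
    have g1 := nn (2 * t = l)
    have g2 := nn (2 * t = m)
    obtain ⟨x, hx⟩ := h2.1
    obtain ⟨y, hy⟩ := h2.2.1
    rcases List.mem_cons.1 hk with hk | hk
    · rw [if_pos (show 2 * t = l by omega)]; linarith
    rcases List.mem_cons.1 hk with hk | hk
    · rw [if_pos (show 2 * t = m by omega)]; linarith
    · have := hc ⟨k, hk, ht⟩; linarith
  have g1 := nn (2 * t = l)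
  have g2 := nn (2 * t = m)
  have g3 := nn (2 * t + 2 = l)
  have g4 := nn (2 * t + 2 = m)
  by_cases hdt : t = d + 1
  · rw [if_neg (show ¬ t = d by omega)] at e3
    linarith
  · rw [if_neg hdt] at e1
    linarith

theorem arith1 (a b c a' b' c' : ℕ) (ks : List ℕ) (h3 : ∀ k ∈ ks, 3 ≤ k)
    (p : 1 ≤ a' ∧ 1 ≤ b' ∧ 1 ≤ c')
    (hs : a + b + c = a' + b' + c' + ks.sum) (h : (PT X a b c : ℤ[X]) = PT X a' b' c' * Cyc X ks) :
    ks = [] ∧ Sam a b c a' b' c' := by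
  obtain ⟨a1, b1, c1, j, s1, s2, s3, s4, s5, s6⟩ := PT_norm a b c
  obtain ⟨a2, b2, c2, j', r1, r2, r3, r4, r5, r6⟩ := PT_norm a' b' c'
  rw [s4, r4] at h
  have h0 := congrArg J0 h
  rw [J0_mul, J0_PT _ _ _ _ s5 s6, J0_PT _ _ _ _ r5 r6] at h0
  rcases J0_Cyc ks with rfl | hk
  · have e : J0 (Cyc X []) = 1 := by simp [Cyc, J0]
    rw [e, mul_one] at h0
    have := Vl_nil j j' h0 (by omega) (by omega)
    subst this
    simp only [Cyc, List.map_nil, List.prod_nil, mul_one] at h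
    exact ⟨rfl, Sam_trans s1 (Sam_trans (arith1_nil j _ _ _ _ _ _ s5 r5 s6 (by simp at hs; omega) h) (Sam_symm r1))⟩
  · exfalso
    obtain ⟨rfl, rfl⟩ := Vl_cons j j' _ hk h0 s6 (by omega)
    unfold Ty at s5 r5
    simp at s5 r5
    refine arith1_cons a1 b1 c1 a2 b2 c2 ks ?_ h3 s5 r5 (r3 p.1 p.2.1 p.2.2) (by omega) h
    rintro rfl
    simp [Cyc, J0] at hk

theorem arith2 (a b c l m d : ℕ) (ks : List ℕ) (h3 : ∀ k ∈ ks, 3 ≤ k)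
    (p : 1 ≤ a ∧ 1 ≤ b ∧ 1 ≤ c) (hl : 3 ≤ l) (hm : 3 ≤ m) (hd : 1 ≤ d)
    (hs : a + b + c = l + m + d + ks.sum) (h : (PT X a b c : ℤ[X]) = PD X l m d * Cyc X ks) :
    False := by
  obtain ⟨a1, b1, c1, j, s1, s2, s3, s4, s5, s6⟩ := PT_norm a b c
  obtain ⟨l1, m1, j', r2, r3, r4, r5⟩ := PD_norm l m d
  have s3 := s3 p.1 p.2.1 p.2.2
  have r3 := r3 hl hm
  rw [s4, r4] at h
  have h0 := congrArg J0 h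
  rw [J0_mul, J0_PT _ _ _ _ s5 s6, J0_PD _ _ _ _ r5] at h0
  rcases J0_Cyc ks with rfl | hk
  · have e : J0 (Cyc X []) = 1 := by simp [Cyc, J0]
    rw [e, mul_one] at h0
    have := Vl_nil j j' h0 (by omega) (Ty_lt r5)
    subst this
    simp only [Cyc, List.map_nil, List.prod_nil, mul_one] at h
    exact arith2_nil j _ _ _ _ _ _ s5 r5 s6 s3.1 s3.2.1 s3.2.2 r3.1 r3.2 hd (by simp at hs; omega) h
  · obtain ⟨rfl, rfl⟩ := Vl_cons j j' _ hk h0 s6 (Ty_lt r5)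
    unfold Ty at s5 r5
    simp at s5 r5
    exact arith2_cons a1 b1 c1 l1 m1 d ks h3 s5 r5 s3 r3.1 r3.2 hd (by omega) h

section IsoStep

variable {V : Type*} [Fintype V]

theorem iso_of_hom {W : Type*} [Fintype W] (G : SimpleGraph V) (H : SimpleGraph W) (f : W → V)
    (hf : Function.Injective f) (hc : Fintype.card V = Fintype.card W)
    (hadj : ∀ u w, H.Adj u w → G.Adj (f u) (f w)) (hd : ∀ u, G.degree (f u) ≤ H.degree u) :
    Nonempty (G ≃g H) := by
  have hb : Function.Bijective f := (Fintype.bijective_iff_injective_and_card f).2 ⟨hf, hc.symm⟩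
  have key : ∀ u w, G.Adj (f u) (f w) → H.Adj u w := by
    intro u w h
    have hsub : (H.neighborFinset u).image f ⊆ G.neighborFinset (f u) := by
      intro z hz
      obtain ⟨t, ht, rfl⟩ := Finset.mem_image.1 hz
      rw [SimpleGraph.mem_neighborFinset] at ht ⊢
      exact hadj u t ht
    have heq := Finset.eq_of_subset_of_card_le hsub (by
      rw [Finset.card_image_of_injective _ hf, SimpleGraph.card_neighborFinset_eq_degree,
        SimpleGraph.card_neighborFinset_eq_degree]
      exact hd u)
    have : f w ∈ (H.neighborFinset u).image f := by
      rw [heq, SimpleGraph.mem_neighborFinset]; exact h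
    obtain ⟨t, ht, e⟩ := Finset.mem_image.1 this
    rw [SimpleGraph.mem_neighborFinset, hf e] at ht
    exact ht
  exact ⟨(⟨Equiv.ofBijective f hb, fun {u w} => ⟨key u w, hadj u w⟩⟩ : H ≃g G).symm⟩

theorem chain_facts (G : SimpleGraph V) (x y : V) (l : List V) (g : ℕ → V)
    (hg : ∀ n (h : n < l.length), g n = l[n]) (hc : List.IsChain G.Adj (x :: (l ++ [y]))) :
    (l.length = 0 → G.Adj x y) ∧ (0 < l.length → G.Adj x (g 0)) ∧
    (∀ n, n + 1 < l.length → G.Adj (g n) (g (n + 1))) ∧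
    (∀ n, n + 1 = l.length → G.Adj (g n) y) := by
  rw [List.isChain_iff_getElem] at hc
  refine ⟨?_, ?_, ?_, ?_⟩
  · intro h
    rw [List.length_eq_zero_iff] at h
    subst h
    simpa using hc 0 (by simp)
  · intro h
    have := hc 0 (by simp)
    rw [hg 0 h]
    simpa [List.getElem_append_left h] using this
  · intro n h
    have := hc (n + 1) (by simp; omega)
    rw [hg n (by omega), hg (n + 1) h]
    simpa [List.getElem_append_left h, List.getElem_append_left (show n < l.length by omega)] using this
  · intro n h
    have := hc (n + 1) (by simp; omega)
    rw [hg n (by omega)]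
    have e1 : (x :: (l ++ [y]))[n + 1]'(by simp; omega) = l[n] := by
      rw [List.getElem_cons_succ, List.getElem_append_left]
    have e2 : (x :: (l ++ [y]))[n + 1 + 1]'(by simp; omega) = y := by
      rw [List.getElem_cons_succ, List.getElem_append_right (by omega)]
      simp
    rw [e1, e2] at this
    exact this

theorem theta_Bi (p q r : ℕ) (h0 : (0 < p ∧ 0 < q) ∨ (0 < p ∧ 0 < r) ∨ (0 < q ∧ 0 < r))
    (G : SimpleGraph V) (e : V ≃ Fin (p + q + r + 2))
    (hG : ∀ u w, G.Adj u w ↔ (thetaGraph p q r).Adj (e u) (e w))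
    (x y : V) (hx : (e x).val = 0) (hy : (e y).val = 1) : Bi G x y := by
  obtain ⟨-, h1, h2⟩ := theta_form p q r h0 (1 : ℤ) G e hG x y hx hy
  refine ⟨?_, ?_, ?_, ?_⟩
  · rintro rfl; omega
  · rw [degree_hub G x y, h1]
  · rw [degree_hub G y x, Finset.pair_comm, G.adj_comm y x, h2]
  · intro u hu1 hu2
    obtain ⟨a, b, hab, h⟩ := theta_nbr p q r G e hG x y hx hy u (by simp [hu1, hu2])
    exact degree_two G u a b hab h

theorem theta_HF (p q r : ℕ) (h0 : (0 < p ∧ 0 < q) ∨ (0 < p ∧ 0 < r) ∨ (0 < q ∧ 0 < r))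
    (G : SimpleGraph V) (e : V ≃ Fin (p + q + r + 2))
    (hG : ∀ u w, G.Adj u w ↔ (thetaGraph p q r).Adj (e u) (e w))
    (x y : V) (hx : (e x).val = 0) (hy : (e y).val = 1) :
    (1 + X ^ 2) ^ 3 * HF G x y (X : ℤ[X]) = PT X (p + 1) (q + 1) (r + 1) :=
  (theta_form p q r h0 (X : ℤ[X]) G e hG x y hx hy).1

theorem theta_iso (G : SimpleGraph V) (x y : V) (hB : Bi G x y) (l1 l2 l3 : List V)
    (hT : ThetaData G x y l1 l2 l3)
    (h0 : (0 < l1.length ∧ 0 < l2.length) ∨ (0 < l1.length ∧ 0 < l3.length) ∨ (0 < l2.length ∧ 0 < l3.length))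
    (hc : Fintype.card V = l1.length + l2.length + l3.length + 2) :
    Nonempty (G ≃g thetaGraph l1.length l2.length l3.length) := by
  obtain ⟨p, hp⟩ : ∃ p, l1.length = p := ⟨_, rfl⟩
  obtain ⟨q, hq⟩ : ∃ q, l2.length = q := ⟨_, rfl⟩
  obtain ⟨r, hr⟩ : ∃ r, l3.length = r := ⟨_, rfl⟩
  rw [hp, hq, hr] at h0 hc ⊢
  have hlen : (x :: y :: (l1 ++ l2 ++ l3)).length = p + q + r + 2 := by
    simp [hp, hq, hr]; omega
  have hnd : (x :: y :: (l1 ++ l2 ++ l3)).Nodup := by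
    refine List.nodup_cons.2 ⟨?_, List.nodup_cons.2 ⟨hT.ny, hT.nd⟩⟩
    intro h
    rcases List.mem_cons.1 h with h | h
    · exact hB.1 h
    · exact hT.nx h
  obtain ⟨g, hg⟩ : ∃ g : ℕ → V, ∀ n (h : n < (x :: y :: (l1 ++ l2 ++ l3)).length),
      g n = (x :: y :: (l1 ++ l2 ++ l3))[n] := by
    refine ⟨fun n => (x :: y :: (l1 ++ l2 ++ l3)).getD n x, fun n h => ?_⟩
    exact List.getD_eq_getElem _ _ h
  have g0 : g 0 = x := by rw [hg 0 (by simp)]; rfl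
  have g1 : g 1 = y := by rw [hg 1 (by simp)]; rfl
  have C1 := chain_facts G x y l1 (fun n => g (n + 2)) (fun n h => by
    show g (n + 2) = _
    rw [hg (n + 2) (by omega)]
    simp [List.getElem_append, h]) hT.c1
  have C2 := chain_facts G x y l2 (fun n => g (n + (p + 2))) (fun n h => by
    show g (n + (p + 2)) = _
    rw [hg (n + (p + 2)) (by omega)]
    simp [List.getElem_append, h, ← add_assoc, hp]) hT.c2
  have C3 := chain_facts G x y l3 (fun n => g (n + (p + q + 2))) (fun n h => by
    show g (n + (p + q + 2)) = _
    rw [hg (n + (p + q + 2)) (by omega)]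
    have e1 : n + (p + q + 2) = (n + (p + q)) + 1 + 1 := by omega
    simp only [e1, List.getElem_cons_succ]
    rw [List.getElem_append_right (by simp; omega)]
    congr 1
    simp; omega) hT.c3
  rw [hp] at C1
  rw [hq] at C2
  rw [hr] at C3
  obtain ⟨a1, a2, a3, a4⟩ := C1
  obtain ⟨b1, b2, b3, b4⟩ := C2
  obtain ⟨c1, c2, c3, c4⟩ := C3
  have hBt := theta_Bi p q r h0 (thetaGraph p q r) (Equiv.refl _) (fun _ _ => Iff.rfl)
    ⟨0, by omega⟩ ⟨1, by omega⟩ rfl rfl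
  have dir : ∀ i j : ℕ, i < p + q + r + 2 → j < p + q + r + 2 → ((p = 0 ∧ i = 0 ∧ j = 1) ∨
    (0 < p ∧ i = 0 ∧ j = 2) ∨
    (2 ≤ i ∧ i + 1 = j ∧ j < p + 2) ∨
    (0 < p ∧ i = p + 1 ∧ j = 1) ∨
    (q = 0 ∧ i = 0 ∧ j = 1) ∨
    (0 < q ∧ i = 0 ∧ j = p + 2) ∨
    (p + 2 ≤ i ∧ i + 1 = j ∧ j < p + q + 2) ∨
    (0 < q ∧ i = p + q + 1 ∧ j = 1) ∨
    (r = 0 ∧ i = 0 ∧ j = 1) ∨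
    (0 < r ∧ i = 0 ∧ j = p + q + 2) ∨
    (p + q + 2 ≤ i ∧ i + 1 = j) ∨
    (0 < r ∧ i = p + q + r + 1 ∧ j = 1)) → G.Adj (g i) (g j) := by
    intro i j hi hj h
    rcases h with ⟨h, rfl, rfl⟩ | ⟨h, rfl, rfl⟩ | ⟨h, rfl, h'⟩ | ⟨h, rfl, rfl⟩ | ⟨h, rfl, rfl⟩ |
      ⟨h, rfl, rfl⟩ | ⟨h, rfl, h'⟩ | ⟨h, rfl, rfl⟩ | ⟨h, rfl, rfl⟩ | ⟨h, rfl, rfl⟩ | ⟨h, rfl⟩ | ⟨h, rfl, rfl⟩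
    · rw [g0, g1]; exact a1 h
    · rw [g0]; simpa using a2 h
    · convert a3 (i - 2) (by omega) using 2 <;> omega
    · rw [g1]; convert a4 (p - 1) (by omega) using 2 <;> omega
    · rw [g0, g1]; exact b1 h
    · rw [g0]; simpa using b2 h
    · convert b3 (i - (p + 2)) (by omega) using 2 <;> omega
    · rw [g1]; convert b4 (q - 1) (by omega) using 2 <;> omega
    · rw [g0, g1]; exact c1 h
    · rw [g0]; simpa using c2 h
    · convert c3 (i - (p + q + 2)) (by omega) using 2 <;> omega
    · rw [g1]; convert c4 (r - 1) (by omega) using 2 <;> omega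
  have hinj : Function.Injective (fun i : Fin (p + q + r + 2) => g i.val) := by
    intro i j h
    have h : g i.val = g j.val := h
    rw [hg i.val (by omega), hg j.val (by omega)] at h
    exact Fin.ext ((List.Nodup.getElem_inj_iff hnd).1 h)
  refine iso_of_hom G _ (fun i => g i.val) hinj (by rw [hc, Fintype.card_fin]) ?_ ?_
  · intro u w h
    rw [theta_adj] at h
    rcases h.2 with h | h
    · exact dir _ _ u.isLt w.isLt h
    · exact (dir _ _ w.isLt u.isLt h).symm
  · intro u
    obtain ⟨-, A1, A2, A3⟩ := hB
    obtain ⟨-, B1, B2, B3⟩ := hBt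
    by_cases hu : u = ⟨0, by omega⟩
    · subst hu
      show G.degree (g 0) ≤ _
      rw [g0, A1, B1]
    by_cases hu' : u = ⟨1, by omega⟩
    · subst hu'
      show G.degree (g 1) ≤ _
      rw [g1, A2, B2]
    · have k1 : g u.val ≠ x := by
        rw [← g0]; intro h; exact hu (hinj (a₂ := ⟨0, by omega⟩) h)
      have k2 : g u.val ≠ y := by
        rw [← g1]; intro h; exact hu' (hinj (a₂ := ⟨1, by omega⟩) h)
      rw [A3 _ k1 k2, B3 u hu hu']

theorem ThetaData.swap12 {G : SimpleGraph V} {x y : V} {l1 l2 l3 : List V}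
    (h : ThetaData G x y l1 l2 l3) : ThetaData G x y l2 l1 l3 := by
  have hp : (l1 ++ l2 ++ l3).Perm (l2 ++ l1 ++ l3) := List.Perm.append_right _ List.perm_append_comm
  exact ⟨h.c2, h.c1, h.c3, hp.nodup_iff.1 h.nd, fun k => h.nx (hp.mem_iff.2 k), fun k => h.ny (hp.mem_iff.2 k)⟩

theorem ThetaData.swap23 {G : SimpleGraph V} {x y : V} {l1 l2 l3 : List V}
    (h : ThetaData G x y l1 l2 l3) : ThetaData G x y l1 l3 l2 := by
  have hp : (l1 ++ l2 ++ l3).Perm (l1 ++ l3 ++ l2) := by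
    rw [List.append_assoc, List.append_assoc]
    exact List.Perm.append_left _ List.perm_append_comm
  exact ⟨h.c1, h.c3, h.c2, hp.nodup_iff.1 h.nd, fun k => h.nx (hp.mem_iff.2 k), fun k => h.ny (hp.mem_iff.2 k)⟩

theorem Sam_cases {a b c a' b' c' : ℕ} (h : Sam a b c a' b' c') :
    (a = a' ∧ b = b' ∧ c = c') ∨ (a = a' ∧ b = c' ∧ c = b') ∨ (a = b' ∧ b = a' ∧ c = c') ∨
    (a = b' ∧ b = c' ∧ c = a') ∨ (a = c' ∧ b = a' ∧ c = b') ∨ (a = c' ∧ b = b' ∧ c = a') := by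
  have pair : ∀ b c b' c' : ℕ, ({b, c} : Multiset ℕ) = {b', c'} → (b = b' ∧ c = c') ∨ (b = c' ∧ c = b') := by
    intro b c b' c' h
    have h1 : b ∈ ({b', c'} : Multiset ℕ) := h ▸ by simp
    have hs := congrArg Multiset.sum h
    simp at h1 hs
    omega
  have h1 : a ∈ ({a', b', c'} : Multiset ℕ) := h ▸ by simp
  simp at h1
  have inj : ∀ u v w v' w' : ℕ, Sam u v w u v' w' → ({v, w} : Multiset ℕ) = {v', w'} := by
    intro u v w v' w' h
    unfold Sam at h
    rw [Multiset.insert_eq_cons u, Multiset.insert_eq_cons u] at h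
    exact (Multiset.cons_inj_right u).1 h
  rcases h1 with h1 | h1 | h1
  · subst h1
    have := pair _ _ _ _ (inj _ _ _ _ _ h)
    rcases this with ⟨k1, k2⟩ | ⟨k1, k2⟩ <;> simp [k1, k2]
  · subst h1
    have := pair _ _ _ _ (inj _ _ _ _ _ (Sam_trans h (Sam_swap12 a' a c')))
    rcases this with ⟨k1, k2⟩ | ⟨k1, k2⟩ <;> simp [k1, k2]
  · subst h1
    have := pair _ _ _ _ (inj _ _ _ _ _ (Sam_trans (Sam_trans h (Sam_swap23 a' b' a)) (Sam_swap12 a' a b')))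
    rcases this with ⟨k1, k2⟩ | ⟨k1, k2⟩ <;> simp [k1, k2]

theorem final_theta (p q r : ℕ) (h0 : (0 < p ∧ 0 < q) ∨ (0 < p ∧ 0 < r) ∨ (0 < q ∧ 0 < r))
    (G : SimpleGraph V)
    (h : qPermPoly G = qPermPoly (thetaGraph p q r)) :
    Nonempty (G ≃g thetaGraph p q r) := by
  have hBt := theta_Bi p q r h0 (thetaGraph p q r) (Equiv.refl _) (fun _ _ => Iff.rfl)
    ⟨0, by omega⟩ ⟨1, by omega⟩ rfl rfl
  have hFt := theta_HF p q r h0 (thetaGraph p q r) (Equiv.refl _) (fun _ _ => Iff.rfl)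
    ⟨0, by omega⟩ ⟨1, by omega⟩ rfl rfl
  obtain ⟨hc, x, y, hB⟩ := bi_transfer G _ _ _ hBt h
  rw [← HF_transfer G _ x y _ _ hB hBt hc h] at hFt
  rw [Fintype.card_fin] at hc
  have hv : (1 + X ^ 2 : ℤ[X]) ≠ 0 := by
    intro h
    have := congrArg (fun p => p.coeff 0) h
    simp [coeff_X_pow] at this
  obtain ⟨hxy, d1, d2, d3⟩ := id hB
  have hO := classify (X : ℤ[X]) hv G x y hxy (fun u hu => by
      simp only [Finset.mem_insert, Finset.mem_singleton, not_or] at hu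
      exact of_degree_two G u (d3 u hu.1 hu.2))
    (by rw [← degree_hub G x y, d1]) (by rw [← d2, degree_hub G y x, Finset.pair_comm, G.adj_comm y x])
  obtain ⟨ks, hks, ⟨l1, l2, l3, hT, e2, e3, ec, eF⟩ | ⟨l, m, c, hl, hm, hc1, ec, eF⟩⟩ := hO
  · have eF' := hFt.symm.trans eF
    obtain ⟨rfl, hS⟩ := arith1 _ _ _ _ _ _ ks hks ⟨by omega, by omega, by omega⟩ (by omega) eF'
    have k2 := List.length_pos_of_ne_nil e2
    have k3 := List.length_pos_of_ne_nil e3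
    have fin : ∀ L1 L2 L3 : List V, ThetaData G x y L1 L2 L3 → p = L1.length → q = L2.length →
        r = L3.length → Nonempty (G ≃g thetaGraph p q r) := by
      rintro L1 L2 L3 hT rfl rfl rfl
      exact theta_iso G x y hB L1 L2 L3 hT h0 hc
    rcases Sam_cases hS with ⟨u1, u2, u3⟩ | ⟨u1, u2, u3⟩ | ⟨u1, u2, u3⟩ | ⟨u1, u2, u3⟩ | ⟨u1, u2, u3⟩ | ⟨u1, u2, u3⟩
    · exact fin _ _ _ hT (by omega) (by omega) (by omega)
    · exact fin _ _ _ hT.swap23 (by omega) (by omega) (by omega)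
    · exact fin _ _ _ hT.swap12 (by omega) (by omega) (by omega)
    · exact fin _ _ _ hT.swap12.swap23 (by omega) (by omega) (by omega)
    · exact fin _ _ _ hT.swap23.swap12 (by omega) (by omega) (by omega)
    · exact fin _ _ _ hT.swap12.swap23.swap12 (by omega) (by omega) (by omega)
  · exfalso
    have eF' := hFt.symm.trans eF
    exact arith2 _ _ _ l m c ks hks ⟨by omega, by omega, by omega⟩ hl hm hc1 (by omega) eF'

end IsoStep

/-- **Theorem 1.4.** The graph `θ(p,q,r)` is determined by its signless Laplacian
permanental polynomial. -/
theorem thetaGraph_determined_by_qPermPoly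
    (p q r : ℕ) (h0 : (0 < p ∧ 0 < q) ∨ (0 < p ∧ 0 < r) ∨ (0 < q ∧ 0 < r))
    {V : Type*} [Fintype V] (G : SimpleGraph V)
    (h : qPermPoly G = qPermPoly (thetaGraph p q r)) :
    Nonempty (G ≃g thetaGraph p q r) := by
  exact final_theta p q r h0 G h
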